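/- Let X be an algebraic variety defined over a number field k, let P be a smooth algebraic point of X, let σ ∈ Gal(k(P)/ℚ), and let Q = P^σ be the conjugate point on the conjugate variety X^σ. Then for any open set V_P ⊆ X(ℂ) containing P and any open set V_Q ⊆ X^σ(ℂ) containing Q (Euclidean topology), there exist an extension of σ to an automorphism of ℚ̄, an open neighborhood U_P ⊆ V_P of P containing a sequence (P_i)_{i∈ℕ} of algebraic points of X that is dense in U_P, and an open neighborhood U_Q ⊆ V_Q of Q, such that P_i^σ ∈ U_Q for all i and the set {P_i^σ : i ∈ ℕ} is dense in U_Q. -/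

import Mathlib

noncomputable section
namespace ConjugateDensity

open MvPolynomial

variable {N : ℕ}

/-- The set of complex points cut out in `ℂ^N` by the polynomials `polys` (with
coefficients in the subfield `k` of `ℂ`), after applying the embedding `τ : k → ℂ` to
their coefficients; with the Euclidean (subspace) topology. -/
def pointsOf (k : Subfield ℂ) (polys : Finset (MvPolynomial (Fin N) k)) (τ : k →+* ℂ) :
    Set (Fin N → ℂ) :=
  {v | ∀ F ∈ polys, MvPolynomial.aeval v (MvPolynomial.map τ F) = 0}

/-- `P` is a smooth (nonsingular) point of the algebraic set `X ⊆ ℂ^N`: in a Zariski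
neighbourhood of `P` (the nonvanishing locus of some `h` with `h(P) ≠ 0`), `X` is the
common zero locus of polynomials `g₁, …, g_c` vanishing on `X` whose Jacobian matrix at
`P` has maximal rank `c`. -/
def SmoothAt (X : Set (Fin N → ℂ)) (P : Fin N → ℂ) : Prop :=
  ∃ (c : ℕ) (g : Fin c → MvPolynomial (Fin N) ℂ),
    (∀ i, ∀ v ∈ X, MvPolynomial.aeval v (g i) = 0) ∧
    (∃ h : MvPolynomial (Fin N) ℂ, MvPolynomial.aeval P h ≠ 0 ∧
      ∀ v : Fin N → ℂ, MvPolynomial.aeval v h ≠ 0 →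
        (v ∈ X ↔ ∀ i, MvPolynomial.aeval v (g i) = 0)) ∧
    (Matrix.of fun (i : Fin c) (j : Fin N) =>
      MvPolynomial.aeval P (MvPolynomial.pderiv j (g i))).rank = c

/-- The field `k(P)`: the subfield of `ℂ` generated by `k` and the coordinates of `P`. -/
def kRes (k : Subfield ℂ) (P : Fin N → ℂ) : Subfield ℂ :=
  Subfield.closure (↑k ∪ Set.range P)

lemma le_kRes (k : Subfield ℂ) (P : Fin N → ℂ) : k ≤ kRes k P :=
  fun _ hx => Subfield.subset_closure (Or.inl hx)

/-- The conjugate point `Q = P^σ`, obtained by applying `σ : k(P) → ℂ` to the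
coordinates of `P`. -/
def conjPoint (k : Subfield ℂ) (P : Fin N → ℂ) (σ : kRes k P →+* ℂ) : Fin N → ℂ :=
  fun i => σ ⟨P i, Subfield.subset_closure (Or.inr ⟨i, rfl⟩)⟩

end ConjugateDensity

namespace ConjugateDensity

open Cardinal in
theorem ext_aux {R K K' : Type} [Field R] [Field K] [Field K'] [Algebra R K] [Algebra R K']
    [IsAlgClosed K] [IsAlgClosed K'] (hR : Cardinal.mk R ≤ ℵ₀) (hK : ℵ₀ < Cardinal.mk K) (hKK : Cardinal.mk K = Cardinal.mk K') :
    Nonempty (K →ₐ[R] K') := by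
  obtain ⟨s, hs⟩ := exists_isTranscendenceBasis R K
  obtain ⟨t, ht⟩ := exists_isTranscendenceBasis R K'
  have h1 := IsAlgClosed.cardinal_eq_cardinal_transcendence_basis_of_aleph0_lt' _ hs hR hK
  have h2 := IsAlgClosed.cardinal_eq_cardinal_transcendence_basis_of_aleph0_lt' _ ht hR
    (hKK ▸ hK)
  obtain ⟨e⟩ := Cardinal.eq.1 (h1.symm.trans (hKK.trans h2))
  let w : s → K' := fun i => (e i : K')
  have hw : AlgebraicIndependent R w := ht.1.comp e e.injective
  let A := Algebra.adjoin R (Set.range ((↑) : s → K))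
  let φ : A →ₐ[R] K' := (MvPolynomial.aeval w).comp hs.1.aevalEquiv.symm.toAlgHom
  have hφ : Function.Injective φ := by
    have : Function.Injective (MvPolynomial.aeval w : MvPolynomial s R →ₐ[R] K') := hw
    exact this.comp hs.1.aevalEquiv.symm.injective
  let : Algebra A K' := φ.toRingHom.toAlgebra
  have : Module.IsTorsionFree A K' :=
    Module.isTorsionFree_iff_algebraMap_injective.2 hφ
  have : Algebra.IsAlgebraic A K := hs.isAlgebraic
  let ψ : K →ₐ[A] K' := IsAlgClosed.lift
  refine ⟨{ ψ.toRingHom with commutes' := fun r => ?_ }⟩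
  have := ψ.commutes (algebraMap R A r)
  have h3 : algebraMap A K' (algebraMap R A r) = algebraMap R K' r := φ.commutes r
  rw [h3] at this
  exact this

open Cardinal in
theorem ext_hom (L : Subfield ℂ) (hL : ∀ x ∈ L, IsAlgebraic ℚ x) (f : L →+* ℂ) :
    ∃ τ : ℂ →+* ℂ, ∀ x : L, τ x = f x := by
  have hc : Cardinal.mk L ≤ ℵ₀ := by
    have h := Algebraic.countable ℚ ℂ
    have h2 : (L : Set ℂ).Countable := h.mono hL
    exact Cardinal.le_aleph0_iff_set_countable.2 h2
  have hC : ℵ₀ < Cardinal.mk ℂ := by rw [Cardinal.mk_complex]; exact Cardinal.aleph0_lt_continuum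
  obtain ⟨φ⟩ := @ext_aux L ℂ ℂ _ _ _ (Subfield.subtype L).toAlgebra f.toAlgebra _ _ hc hC rfl
  let : Algebra L ℂ := (Subfield.subtype L).toAlgebra
  refine ⟨@AlgHom.toRingHom L ℂ ℂ _ _ _ (Subfield.subtype L).toAlgebra f.toAlgebra φ, fun x => ?_⟩
  exact @AlgHom.commutes L ℂ ℂ _ _ _ (Subfield.subtype L).toAlgebra f.toAlgebra φ x

theorem root_aux {L K K' : Type} [Field L] [Field K] [Field K'] [Algebra L K] [Algebra L K']
    (x : K) (hx : IsIntegral L x) (y : K') (hy : Polynomial.aeval y (minpoly L x) = 0) :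
    ∃ g : IntermediateField.adjoin L {x} →ₐ[L] K',
      g ⟨x, IntermediateField.mem_adjoin_simple_self L x⟩ = y := by
  let pb := IntermediateField.adjoin.powerBasis hx
  have hgen : pb.gen = ⟨x, IntermediateField.mem_adjoin_simple_self L x⟩ := by
    simp [pb]; rfl
  have hy' : Polynomial.aeval y (minpoly L pb.gen) = 0 := by
    rw [IntermediateField.adjoin.powerBasis_gen]
    rwa [IntermediateField.minpoly_gen]
  refine ⟨pb.lift y hy', ?_⟩
  rw [← hgen, PowerBasis.lift_gen]

/-- extension of `τ|L` sending `x` to a prescribed conjugate `y`. -/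
theorem ext_root (L : Subfield ℂ) (hL : ∀ x ∈ L, IsAlgebraic ℚ x) (τ : ℂ →+* ℂ)
    (x : ℂ) (hx : IsAlgebraic ℚ x) (y : ℂ)
    (hy : (minpoly L x).eval₂ (τ.comp L.subtype) y = 0) :
    ∃ τ' : ℂ →+* ℂ, (∀ z ∈ L, τ' z = τ z) ∧ τ' x = y := by
  have hx' : IsIntegral L x := (hx.isIntegral).tower_top
  obtain ⟨g, hg⟩ := @root_aux L ℂ ℂ _ _ _ _ (τ.comp L.subtype).toAlgebra x hx' y (by
    exact hy)
  let M : IntermediateField L ℂ := IntermediateField.adjoin L {x}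
  have hM : ∀ z ∈ M.toSubfield, IsAlgebraic ℚ z := by
    intro z hz
    have : Algebra.IsAlgebraic ℚ L := ⟨fun a => by
      have := hL a a.2
      exact (isAlgebraic_algebraMap_iff (A := ℂ) (FaithfulSMul.algebraMap_injective L ℂ)).1 this⟩
    have h1 : IsAlgebraic L z := by
      have := IntermediateField.isAlgebraic_adjoin_simple hx'
      have := Algebra.IsAlgebraic.isAlgebraic (R := L) (⟨z, hz⟩ : IntermediateField.adjoin L {x})
      exact this.algebraMap (A := ℂ)
    exact h1.restrictScalars ℚ
  obtain ⟨τ', h⟩ := ext_hom M.toSubfield hM (@AlgHom.toRingHom L M ℂ _ _ _ _ (τ.comp L.subtype).toAlgebra g)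
  refine ⟨τ', fun z hz => ?_, ?_⟩
  · have h1 := h ⟨z, M.algebraMap_mem ⟨z, hz⟩⟩
    refine h1.trans ?_
    exact @AlgHom.commutes L M ℂ _ _ _ _ (τ.comp L.subtype).toAlgebra g ⟨z, hz⟩
  · exact (h ⟨x, IntermediateField.mem_adjoin_simple_self L x⟩).trans hg

/-- an algebraic number not in `L` is moved by some extension of any embedding of `L`. -/
theorem ext_move (L : Subfield ℂ) (hL : ∀ x ∈ L, IsAlgebraic ℚ x) (τ : ℂ →+* ℂ)
    (x : ℂ) (hx : IsAlgebraic ℚ x) (hxL : x ∉ L) (w : ℂ) :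
    ∃ τ' : ℂ →+* ℂ, (∀ z ∈ L, τ' z = τ z) ∧ τ' x ≠ w := by
  have hx' : IsIntegral L x := (hx.isIntegral).tower_top
  set q := (minpoly L x).map (τ.comp L.subtype) with hq
  have hsep : q.Separable := (minpoly.irreducible hx').separable.map
  have hdeg : 2 ≤ q.natDegree := by
    rw [hq, Polynomial.natDegree_map]
    rw [minpoly.two_le_natDegree_iff hx']
    rintro ⟨a, ha⟩
    exact hxL (ha ▸ a.2)
  have hcard : q.roots.toFinset.card = q.natDegree := by
    rw [Multiset.toFinset_card_of_nodup (Polynomial.nodup_roots hsep)]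
    exact (IsAlgClosed.splits q).natDegree_eq_card_roots.symm
  obtain ⟨y, hy, hyw⟩ := Finset.exists_mem_ne (by omega : 1 < q.roots.toFinset.card) w
  have hy' : q.eval y = 0 := by
    have := Multiset.mem_toFinset.1 hy
    exact Polynomial.isRoot_of_mem_roots this
  rw [hq, Polynomial.eval_map] at hy'
  obtain ⟨τ', h1, h2⟩ := ext_root L hL τ x hx y hy'
  exact ⟨τ', h1, h2 ▸ hyw⟩

theorem mem_of_fixed (L : Subfield ℂ) (hL : ∀ x ∈ L, IsAlgebraic ℚ x)
    (x : ℂ) (hx : IsAlgebraic ℚ x) (h : ∀ ρ : ℂ →+* ℂ, (∀ z ∈ L, ρ z = z) → ρ x = x) : x ∈ L := by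
  by_contra hxL
  obtain ⟨ρ, h1, h2⟩ := ext_move L hL (RingHom.id ℂ) x hx hxL x
  exact h2 (h ρ h1)

theorem alg_of_fin (L : Subfield ℂ) (hL : FiniteDimensional ℚ L) : ∀ x ∈ L, IsAlgebraic ℚ x := by
  intro x hx
  have h : IsAlgebraic ℚ (⟨x, hx⟩ : L) := Algebra.IsAlgebraic.isAlgebraic _
  exact h.algebraMap (A := ℂ)

theorem exists_big (L : Subfield ℂ) (hL : FiniteDimensional ℚ L) (s : Set ℂ) (hs : s.Finite)
    (ha : ∀ x ∈ s, IsAlgebraic ℚ x) :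
    ∃ L' : Subfield ℂ, FiniteDimensional ℚ L' ∧ L ≤ L' ∧ s ⊆ L' := by
  let M : IntermediateField L ℂ := IntermediateField.adjoin L s
  have h1 : FiniteDimensional L M := by
    have := hs.to_subtype
    exact IntermediateField.finiteDimensional_adjoin
      (fun x hx => (ha x hx).isIntegral.tower_top)
  refine ⟨M.toSubfield, ?_, ?_, ?_⟩
  · have : FiniteDimensional ℚ M := FiniteDimensional.trans ℚ L M
    exact this
  · intro x hx
    exact M.algebraMap_mem ⟨x, hx⟩
  · exact IntermediateField.subset_adjoin L s

end ConjugateDensity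

namespace ConjugateDensity

open Filter Topology

theorem diff_lim1 {ι : Type} [Fintype ι] (m : ℕ) (w o : ι → ℂ)
    (hS : ∀ n < m, ∑ j, w j * o j ^ n = 0) (l : ℕ) : ∀ (q i : ℕ), i + l ≤ m →
    Tendsto (fun z : ℂ => (∑ j, w j * o j ^ i * ((1 + o j * z) ^ q)⁻¹) / z ^ l) (𝓝[≠] 0)
      (𝓝 ((-1) ^ l * (Nat.multichoose q l : ℂ) * ∑ j, w j * o j ^ (i + l))) := by
  induction l with
  | zero =>
    intro q i hi
    simp only [pow_zero, div_one, Nat.multichoose_zero_right, Nat.cast_one, one_mul, add_zero]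
    have : ContinuousAt (fun z : ℂ => (∑ j, w j * o j ^ i * ((1 + o j * z) ^ q)⁻¹)) 0 := by
      refine tendsto_finsetSum _ fun j _ => ?_
      refine Tendsto.mul tendsto_const_nhds ?_
      refine ContinuousAt.inv₀ (by fun_prop) (by simp)
    have h := this.tendsto.mono_left (nhdsWithin_le_nhds (s := {0}ᶜ))
    simpa using h
  | succ l ih =>
    intro q
    induction q with
    | zero =>
      intro i hi
      simp [hS i (by omega)]
    | succ q ihq =>
      intro i hi
      have h1 := ihq i hi
      have h2 := ih (q + 1) (i + 1) (by omega)
      have h3 := h1.sub h2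
      rw [Nat.multichoose_succ_succ]
      have e : ((-1 : ℂ) ^ (l + 1) * (Nat.multichoose q (l + 1) : ℂ) * ∑ j, w j * o j ^ (i + (l + 1)))
          - ((-1) ^ l * (Nat.multichoose (q + 1) l : ℂ) * ∑ j, w j * o j ^ (i + 1 + l))
          = ((-1) ^ (l + 1) * ((Nat.multichoose q (l + 1) + Nat.multichoose (q + 1) l : ℕ) : ℂ)
            * ∑ j, w j * o j ^ (i + (l + 1))) := by
        have : i + 1 + l = i + (l + 1) := by omega
        rw [this]; push_cast; ring
      rw [← e]
      refine h3.congr' ?_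
      have hne : ∀ᶠ z : ℂ in 𝓝[≠] 0, ∀ j, 1 + o j * z ≠ 0 := by
        rw [eventually_all]
        intro j
        have : ContinuousAt (fun z : ℂ => 1 + o j * z) 0 := by fun_prop
        exact (this.eventually_ne (by simp)).filter_mono nhdsWithin_le_nhds
      filter_upwards [hne, self_mem_nhdsWithin] with z hz hz0
      have hz0 : z ≠ 0 := hz0
      have : ∀ A B C : ℂ, A - B * z = C → (A / z ^ (l + 1) - B / z ^ l) = C / z ^ (l + 1) := by
        intro A B C h
        rw [← h]; field_simp; ring
      apply this
      rw [Finset.sum_mul, ← Finset.sum_sub_distrib]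
      refine Finset.sum_congr rfl fun j _ => ?_
      have := hz j
      field_simp
      ring

theorem diff_lim2 {ι : Type} [Fintype ι] (m : ℕ) (w o : ι → ℂ)
    (hS : ∀ n < m, ∑ j, w j * o j ^ n = 0) (l : ℕ) : ∀ (η : ℂ → ℂ), AnalyticAt ℂ η 0 →
    ∀ (q i : ℕ), i + l ≤ m →
    Tendsto (fun z : ℂ => (∑ j, w j * o j ^ i * (((1 + o j * z) ^ q)⁻¹ * η (z / (1 + o j * z)))) / z ^ l)
      (𝓝[≠] 0)
      (𝓝 ((-1) ^ l * (Nat.multichoose q l : ℂ) * (∑ j, w j * o j ^ (i + l)) * η 0)) := by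
  induction l with
  | zero =>
    intro η hη q i hi
    simp only [pow_zero, div_one, Nat.multichoose_zero_right, Nat.cast_one, one_mul, add_zero]
    have : ContinuousAt (fun z : ℂ => (∑ j, w j * o j ^ i * (((1 + o j * z) ^ q)⁻¹ * η (z / (1 + o j * z))))) 0 := by
      refine tendsto_finsetSum _ fun j _ => ?_
      refine Tendsto.mul tendsto_const_nhds (Tendsto.mul ?_ ?_)
      · exact ContinuousAt.inv₀ (by fun_prop) (by simp)
      · have h1 : ContinuousAt (fun z : ℂ => z / (1 + o j * z)) 0 :=
          ContinuousAt.div (by fun_prop) (by fun_prop) (by simp)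
        have h2 : ContinuousAt η (0 / (1 + o j * 0)) := by simpa using hη.continuousAt
        exact ContinuousAt.comp (g := η) (f := fun z : ℂ => z / (1 + o j * z)) h2 h1
    have h := this.tendsto.mono_left (nhdsWithin_le_nhds (s := {0}ᶜ))
    simpa [Finset.sum_mul, mul_assoc] using h
  | succ l ih =>
    intro η hη q i hi
    have hη1 : AnalyticAt ℂ (dslope η 0) 0 := by
      obtain ⟨p, hp⟩ := hη
      exact ⟨_, hp.has_fpower_series_dslope_fslope⟩
    have h1 := (diff_lim1 m w o hS (l + 1) q i hi).mul_const (η 0)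
    have h2 := ih (dslope η 0) hη1 (q + 1) i (by omega)
    rw [hS (i + l) (by omega)] at h2
    have h3 := h1.add h2
    simp only [mul_zero, zero_mul, add_zero] at h3
    refine h3.congr' ?_
    have hne : ∀ᶠ z : ℂ in 𝓝[≠] 0, ∀ j, 1 + o j * z ≠ 0 := by
      rw [eventually_all]
      intro j
      have : ContinuousAt (fun z : ℂ => 1 + o j * z) 0 := by fun_prop
      exact (this.eventually_ne (by simp)).filter_mono nhdsWithin_le_nhds
    filter_upwards [hne, self_mem_nhdsWithin] with z hz hz0
    have hz0 : z ≠ 0 := hz0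
    have : ∀ A B C : ℂ, A * η 0 + z * B = C → (A / z ^ (l + 1) * η 0 + B / z ^ l) = C / z ^ (l + 1) := by
      intro A B C h
      rw [← h]; field_simp; ring
    apply this
    rw [Finset.sum_mul, Finset.mul_sum, ← Finset.sum_add_distrib]
    refine Finset.sum_congr rfl fun j _ => ?_
    have h5 : η (z / (1 + o j * z)) = η 0 + z / (1 + o j * z) * dslope η 0 (z / (1 + o j * z)) := by
      have := sub_smul_dslope η 0 (z / (1 + o j * z))
      simp only [sub_zero, smul_eq_mul] at this
      rw [this]; ring
    rw [h5]
    have := hz j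
    field_simp
    ring

theorem exists_weights (m : ℕ) (o : Fin (m + 1) → ℕ) (ho : Function.Injective o) :
    ∃ w : Fin (m + 1) → ℤ, (∀ n < m, ∑ j, w j * (o j : ℤ) ^ n = 0) ∧
      ∑ j, w j * (o j : ℤ) ^ m ≠ 0 := by
  let V : Matrix (Fin (m + 1)) (Fin (m + 1)) ℤ := Matrix.vandermonde (fun j => (o j : ℤ))
  have hV : V.det ≠ 0 := Matrix.det_vandermonde_ne_zero_iff.2 (fun a b h => ho (by simpa using h))
  have key : Matrix.vecMul (fun j => V.adjugate (Fin.last m) j) V = fun n => if n = Fin.last m then V.det else 0 := by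
    have h := Matrix.adjugate_mul V
    ext n
    have := congrFun (congrFun h (Fin.last m)) n
    simp only [Matrix.mul_apply, Matrix.smul_apply, Matrix.one_apply, smul_eq_mul, mul_ite, mul_one, mul_zero] at this
    simp only [Matrix.vecMul, dotProduct]
    rw [this]
    simp only [eq_comm]
  refine ⟨fun j => V.adjugate (Fin.last m) j, fun n hn => ?_, ?_⟩
  · have := congrFun key ⟨n, by omega⟩
    simp only [Matrix.vecMul, dotProduct, V, Matrix.vandermonde_apply] at this
    rw [this, if_neg]
    intro h; simp [Fin.ext_iff] at h; omega
  · have := congrFun key (Fin.last m)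
    simp only [Matrix.vecMul, dotProduct, V, Matrix.vandermonde_apply, Fin.val_last] at this
    rw [this, if_pos trivial]; exact hV

end ConjugateDensity

namespace ConjugateDensity

open Filter Topology

theorem norm_bound (L : Subfield ℂ) (hL : FiniteDimensional ℚ L) (x : L) (hx : IsIntegral ℤ x)
    (hx0 : x ≠ 0) (B : ℝ) (hB : 1 ≤ B) (h : ∀ ρ : L →+* ℂ, ‖ρ x‖ ≤ B) :
    1 ≤ ‖(x : ℂ)‖ * B ^ (Module.finrank ℚ L) := by
  have h1 : IsIntegral ℤ (Algebra.norm ℚ x) := Algebra.isIntegral_norm ℚ hx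
  obtain ⟨n, hn⟩ := IsIntegrallyClosed.isIntegral_iff.1 h1
  have hne : Algebra.norm ℚ x ≠ 0 := Algebra.norm_ne_zero_iff.2 hx0
  have hn0 : n ≠ 0 := by
    rintro rfl
    apply hne; rw [← hn]; simp
  have h2 := Algebra.norm_eq_prod_embeddings ℚ ℂ x
  rw [← hn] at h2
  have h3 : (1 : ℝ) ≤ ‖(algebraMap ℚ ℂ) ((algebraMap ℤ ℚ) n)‖ := by
    simp only [eq_intCast, map_intCast, Complex.norm_intCast]
    exact_mod_cast Int.one_le_abs hn0
  rw [h2, norm_prod] at h3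
  let ι0 : L →ₐ[ℚ] ℂ := L.subtype.toRatAlgHom
  classical
  rw [← Finset.mul_prod_erase _ _ (Finset.mem_univ ι0)] at h3
  refine h3.trans ?_
  have h4 : ι0 x = (x : ℂ) := rfl
  rw [h4]
  refine mul_le_mul_of_nonneg_left ?_ (norm_nonneg _)
  calc ∏ ρ ∈ Finset.univ.erase ι0, ‖ρ x‖ ≤ ∏ ρ ∈ Finset.univ.erase ι0, B :=
        Finset.prod_le_prod (fun _ _ => norm_nonneg _) (fun ρ _ => h ρ.toRingHom)
    _ = B ^ (Finset.univ.erase ι0).card := by simp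
    _ ≤ B ^ (Module.finrank ℚ L) := by
        apply pow_le_pow_right₀ hB
        rw [← AlgHom.card ℚ L ℂ, ← Finset.card_univ]
        exact Finset.card_le_card (Finset.erase_subset _ _)

theorem taylor_split (n : ℕ) : ∀ (θ : ℂ → ℂ), AnalyticAt ℂ θ 0 → ∃ (c : ℕ → ℂ) (η : ℂ → ℂ),
    AnalyticAt ℂ η 0 ∧ ∀ z, θ z = ∑ k ∈ Finset.range n, c k * z ^ k + z ^ n * η z := by
  induction n with
  | zero => intro θ h; exact ⟨0, θ, h, by simp⟩
  | succ n ih =>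
    intro θ h
    have hη1 : AnalyticAt ℂ (dslope θ 0) 0 := by
      obtain ⟨p, hp⟩ := h
      exact ⟨_, hp.has_fpower_series_dslope_fslope⟩
    obtain ⟨c, η, h1, h2⟩ := ih _ hη1
    refine ⟨fun k => if k = 0 then θ 0 else c (k - 1), η, h1, fun z => ?_⟩
    have h5 : θ z = θ 0 + z * dslope θ 0 z := by
      have := sub_smul_dslope θ 0 z
      simp only [sub_zero, smul_eq_mul] at this
      rw [this]; ring
    rw [h5, h2, Finset.sum_range_succ']
    simp only [Nat.add_eq_zero_iff, one_ne_zero, and_false, if_false, Nat.add_sub_cancel, if_true,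
      pow_zero, mul_one]
    rw [mul_add, Finset.mul_sum]
    have : ∀ k ∈ Finset.range n, z * (c k * z ^ k) = c k * z ^ (k + 1) := fun k _ => by ring
    rw [Finset.sum_congr rfl this]; ring

theorem weights_shift {ι : Type} [Fintype ι] (m : ℕ) (w o : ι → ℂ)
    (hS : ∀ n < m, ∑ j, w j * o j ^ n = 0) (e : ℕ) (he : e < m) (T : ℂ) :
    ∑ j, w j * (T + o j) ^ e = 0 := by
  simp_rw [add_comm T, add_pow, Finset.mul_sum]
  rw [Finset.sum_comm]
  refine Finset.sum_eq_zero fun i hi => ?_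
  have := hS i (by have := Finset.mem_range.1 hi; omega)
  calc _ = (∑ j, w j * o j ^ i) * (T ^ (e - i) * (e.choose i)) := by
        rw [Finset.sum_mul]; exact Finset.sum_congr rfl fun j _ => by ring
    _ = 0 := by rw [this, zero_mul]

/-- A polynomial over `ℂ` taking values in `L` at infinitely many naturals has coefficients in `L`. -/
theorem poly_coeffs (L : Subfield ℂ) (Q : Polynomial ℂ) (𝒯 : Set ℕ) (h𝒯 : 𝒯.Infinite)
    (h : ∀ t ∈ 𝒯, Q.eval (t : ℂ) ∈ L) : ∃ R : Polynomial L, R.map L.subtype = Q := by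
  classical
  obtain ⟨s, hs, hcard⟩ := h𝒯.exists_subset_card_eq (Q.natDegree + 1)
  have hinj : Set.InjOn (fun t : ℕ => (t : L)) s := fun a _ b _ hab => by simpa using hab
  have hinj' : Set.InjOn (fun t : ℕ => (t : ℂ)) s := fun a _ b _ hab => by simpa using hab
  let r : ℕ → L := fun t => if ht : Q.eval (t : ℂ) ∈ L then ⟨_, ht⟩ else 0
  refine ⟨Lagrange.interpolate s (fun t : ℕ => (t : L)) r, ?_⟩
  have hd : (Lagrange.interpolate s (fun t : ℕ => (t : L)) r).degree < s.card :=
    Lagrange.degree_interpolate_lt r hinj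
  refine Polynomial.eq_of_degrees_lt_of_eval_index_eq s (v := fun t : ℕ => (t : ℂ)) hinj' ?_ ?_ ?_
  · exact lt_of_le_of_lt Polynomial.degree_map_le hd
  · rw [hcard]
    exact lt_of_le_of_lt Polynomial.degree_le_natDegree (by exact_mod_cast Nat.lt_succ_self _)
  · intro t ht
    have h1 : (Lagrange.interpolate s (fun t : ℕ => (t : L)) r).eval (t : L) = r t :=
      Lagrange.eval_interpolate_at_node r hinj ht
    have h2 : ((t : L) : ℂ) = (t : ℂ) := by simp
    rw [Polynomial.eval_map, ← h2]
    have h3 : L.subtype (t : L) = ((t : L) : ℂ) := rfl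
    rw [← h3, Polynomial.eval₂_at_apply, h1]
    simp only [r, dif_pos (h t (hs ht))]
    simp

theorem dorge (L : Subfield ℂ) (hL : FiniteDimensional ℚ L) (E m : ℕ)
    (hm : E * Module.finrank ℚ L + E + 1 ≤ m)
    (θ : ℂ → ℂ) (hθ : AnalyticAt ℂ θ 0) (C : ℝ)
    (o : Fin (m + 1) → ℕ) (ho : Function.Injective o) (𝒯 : Set ℕ) (h𝒯 : 𝒯.Infinite)
    (h : ∀ T ∈ 𝒯, ∀ j, ∃ x : L, IsIntegral ℤ x ∧
      (x : ℂ) = ((T + o j : ℕ) : ℂ) ^ E * θ (((T + o j : ℕ) : ℂ)⁻¹) ∧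
      ∀ ρ : L →+* ℂ, ‖ρ x‖ ≤ C * ((T + o j : ℕ) : ℝ) ^ E) :
    ∃ Q : Polynomial L, Q.natDegree ≤ E ∧
      ∀ᶠ z in 𝓝 (0 : ℂ), z ≠ 0 → θ z = z ^ E * Q.eval₂ L.subtype z⁻¹ := by
  obtain ⟨c, η0, hη0, hsplit⟩ := taylor_split (E + 1) θ hθ
  obtain ⟨w, hw0, hwm⟩ := exists_weights m o ho
  have hS : ∀ n < m, ∑ j, (w j : ℂ) * (o j : ℂ) ^ n = 0 := fun n hn => by exact_mod_cast hw0 n hn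
  have hSm : ∑ j, (w j : ℂ) * (o j : ℂ) ^ m ≠ 0 := by exact_mod_cast hwm
  -- the polynomial part
  let Q : Polynomial ℂ := ∑ k ∈ Finset.range (E + 1), Polynomial.C (c k) * Polynomial.X ^ (E - k)
  have hQ : ∀ z : ℂ, z ≠ 0 → z ^ E * Q.eval z⁻¹ = ∑ k ∈ Finset.range (E + 1), c k * z ^ k := by
    intro z hz
    simp only [Q, Polynomial.eval_finsetSum, Polynomial.eval_mul, Polynomial.eval_C,
      Polynomial.eval_pow, Polynomial.eval_X, Finset.mul_sum]
    refine Finset.sum_congr rfl fun k hk => ?_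
    have : E = k + (E - k) := by have := Finset.mem_range.1 hk; omega
    have h2 : z ^ E = z ^ k * z ^ (E - k) := by rw [← pow_add, ← this]
    have h3 := pow_ne_zero (E - k) hz
    rw [h2, inv_pow]
    field_simp
  have hQdeg : Q.natDegree ≤ E := by
    refine Polynomial.natDegree_sum_le_of_forall_le _ _ fun k _ => ?_
    exact (Polynomial.natDegree_C_mul_X_pow_le _ _).trans (by omega)
  have hQΔ : ∀ T : ℂ, ∑ j, (w j : ℂ) * Q.eval (T + o j) = 0 := by
    intro T
    simp only [Q, Polynomial.eval_finsetSum, Polynomial.eval_mul, Polynomial.eval_C,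
      Polynomial.eval_pow, Polynomial.eval_X, Finset.mul_sum]
    rw [Finset.sum_comm]
    refine Finset.sum_eq_zero fun k _ => ?_
    have := weights_shift m (fun j => (w j : ℂ)) (fun j => (o j : ℂ)) hS (E - k) (by
      have : 0 ≤ E * Module.finrank ℚ L := Nat.zero_le _
      omega) T
    calc _ = c k * ∑ j, (w j : ℂ) * (T + o j) ^ (E - k) := by
          rw [Finset.mul_sum]; exact Finset.sum_congr rfl fun j _ => by ring
      _ = 0 := by rw [this, mul_zero]
  by_cases hz : ∀ᶠ z in 𝓝 (0 : ℂ), η0 z = 0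
  · have hev : ∀ᶠ z in 𝓝 (0 : ℂ), z ≠ 0 → θ z = z ^ E * Q.eval z⁻¹ := by
      filter_upwards [hz] with z hz hz0
      rw [hQ z hz0, hsplit, hz]; simp
    have hev2 : ∀ᶠ n : ℕ in atTop, ((n : ℂ)) ^ E * θ ((n : ℂ)⁻¹) = Q.eval (n : ℂ) := by
      have ht : Tendsto (fun n : ℕ => ((n : ℂ))⁻¹) atTop (𝓝 0) := tendsto_inv_atTop_nhds_zero_nat
      filter_upwards [ht.eventually hev, eventually_gt_atTop 0] with n hn hn0
      have hn0' : (n : ℂ) ≠ 0 := by exact_mod_cast hn0.ne'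
      rw [hn (inv_ne_zero hn0')]
      rw [inv_inv, ← mul_assoc, ← mul_pow, mul_inv_cancel₀ hn0', one_pow, one_mul]
    obtain ⟨n0, hn0⟩ := eventually_atTop.1 hev2
    obtain ⟨R, hR⟩ := poly_coeffs L Q ((fun T => T + o 0) '' (𝒯 \ Set.Iio n0)) (by
      refine Set.Infinite.image (fun a _ b _ hab => by simpa using hab) ?_
      exact h𝒯.sdiff (Set.finite_Iio _)) (by
      rintro _ ⟨T, ⟨hT, hT2⟩, rfl⟩
      obtain ⟨x, -, hx, -⟩ := h T hT 0
      have h3 := hn0 (T + o 0) (by simp at hT2; omega)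
      simp only
      rw [← h3, ← hx]; exact x.2)
    refine ⟨R, ?_, ?_⟩
    · rw [← hR] at hQdeg
      rwa [Polynomial.natDegree_map] at hQdeg
    · filter_upwards [hev] with z hz hz0
      rw [hz hz0, ← hR, Polynomial.eval_map]
  · exfalso
    obtain ⟨n, η, hη, hη0', hηe⟩ := (hη0.exists_eventuallyEq_pow_smul_nonzero_iff).2 hz
    have hlim := diff_lim2 m (fun j => (w j : ℂ)) (fun j => (o j : ℂ)) hS m η hη (n + 1) 0 (by omega)
    set a := ((-1) ^ m * (Nat.multichoose (n + 1) m : ℂ) *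
      (∑ j, (w j : ℂ) * (o j : ℂ) ^ (0 + m)) * η 0) with ha
    have ha0 : a ≠ 0 := by
      rw [ha, zero_add]
      refine mul_ne_zero (mul_ne_zero (mul_ne_zero (by simp) ?_) hSm) hη0'
      rw [Nat.multichoose_eq]
      exact_mod_cast (Nat.choose_pos (by omega)).ne'
    have ht0 : Tendsto (fun n : ℕ => ((n : ℂ))⁻¹) atTop (𝓝 0) := tendsto_inv_atTop_nhds_zero_nat
    have ht : Tendsto (fun n : ℕ => ((n : ℂ))⁻¹) atTop (𝓝[≠] 0) := by
      refine tendsto_nhdsWithin_iff.2 ⟨ht0, ?_⟩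
      filter_upwards [eventually_gt_atTop 0] with n hn
      have hn0' : (n : ℂ) ≠ 0 := by exact_mod_cast hn.ne'
      exact inv_ne_zero hn0'
    have hl2 := hlim.comp ht
    -- formula
    have hform : ∀ᶠ T : ℕ in atTop,
        ∑ j, (w j : ℂ) * (((T + o j : ℕ) : ℂ) ^ E * θ (((T + o j : ℕ) : ℂ)⁻¹)) =
        (T : ℂ)⁻¹ ^ (n + 1) * ∑ j, (w j : ℂ) * (o j : ℂ) ^ 0 *
          (((1 + o j * (T : ℂ)⁻¹) ^ (n + 1))⁻¹ * η ((T : ℂ)⁻¹ / (1 + o j * (T : ℂ)⁻¹))) := by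
      have hall : ∀ᶠ T : ℕ in atTop, ∀ j, η0 (((T + o j : ℕ) : ℂ)⁻¹) =
          (((T + o j : ℕ) : ℂ)⁻¹ - 0) ^ n • η (((T + o j : ℕ) : ℂ)⁻¹) := by
        rw [eventually_all]
        intro j
        have h6 : Tendsto (fun T : ℕ => T + o j) atTop atTop := tendsto_add_atTop_nat _
        exact (ht0.comp h6).eventually hηe
      filter_upwards [hall, eventually_gt_atTop 0] with T hT hT0
      have hT0' : (T : ℂ) ≠ 0 := by exact_mod_cast hT0.ne'
      have hstep : ∀ j, (((T + o j : ℕ) : ℂ) ^ E * θ (((T + o j : ℕ) : ℂ)⁻¹)) =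
          Q.eval ((T : ℂ) + o j) + (T : ℂ)⁻¹ ^ (n + 1) *
          (((1 + o j * (T : ℂ)⁻¹) ^ (n + 1))⁻¹ * η ((T : ℂ)⁻¹ / (1 + o j * (T : ℂ)⁻¹))) := by
        intro j
        set t : ℂ := ((T + o j : ℕ) : ℂ) with htdef
        have ht0 : t ≠ 0 := by rw [htdef]; exact_mod_cast (by omega : T + o j ≠ 0)
        have htT : t = T + o j := by rw [htdef]; push_cast; rfl
        have h7 : (T : ℂ)⁻¹ / (1 + o j * (T : ℂ)⁻¹) = t⁻¹ := by
          rw [htT] at ht0 ⊢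
          have : (1 + o j * (T : ℂ)⁻¹) ≠ 0 := by
            intro h; apply ht0
            have : (T : ℂ) * (1 + o j * (T : ℂ)⁻¹) = 0 := by rw [h, mul_zero]
            rw [← this]; field_simp
          field_simp
        have h8 : (T : ℂ)⁻¹ ^ (n + 1) * ((1 + o j * (T : ℂ)⁻¹) ^ (n + 1))⁻¹ = t⁻¹ ^ (n + 1) := by
          rw [← h7, div_pow, div_eq_mul_inv]
        rw [← mul_assoc, h8, h7, hsplit, hT j, ← hQ t⁻¹ (inv_ne_zero ht0), inv_inv, ← htT]
        simp only [sub_zero, smul_eq_mul]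
        rw [← htdef]
        have h9 : t ^ E * t⁻¹ ^ E = 1 := by rw [← mul_pow, mul_inv_cancel₀ ht0, one_pow]
        linear_combination (Polynomial.eval t Q + t⁻¹ ^ (n + 1) * η t⁻¹) * h9
      simp_rw [hstep, mul_add, Finset.sum_add_distrib, hQΔ, zero_add]
      rw [Finset.mul_sum]
      refine Finset.sum_congr rfl fun j _ => ?_
      rw [pow_zero]; ring
    -- main estimate
    set D : ℝ := (∑ j, |(w j : ℝ)| * (|C| * (1 + (o j : ℝ)) ^ E)) + 1 with hD
    have hD1 : 1 ≤ D := by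
      rw [hD]
      have : 0 ≤ (∑ j, |(w j : ℝ)| * (|C| * (1 + (o j : ℝ)) ^ E)) :=
        Finset.sum_nonneg fun j _ => by positivity
      linarith
    have hsmall : ∀ᶠ T : ℕ in atTop, (‖a‖ + 1) * D ^ (Module.finrank ℚ L) < (T : ℝ) :=
      (tendsto_natCast_atTop_atTop (R := ℝ)).eventually_gt_atTop _
    have hnear := hl2.eventually_ne ha0
    have hbdd : ∀ᶠ T : ℕ in atTop, ‖(∑ j, (w j : ℂ) * (o j : ℂ) ^ 0 *
          (((1 + o j * (T : ℂ)⁻¹) ^ (n + 1))⁻¹ * η ((T : ℂ)⁻¹ / (1 + o j * (T : ℂ)⁻¹)))) /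
            (T : ℂ)⁻¹ ^ m‖ < ‖a‖ + 1 :=
      hl2.norm.eventually_lt_const (by linarith)
    obtain ⟨T0, hT0⟩ := eventually_atTop.1
      (((hform.and hsmall).and (hnear.and hbdd)).and (eventually_gt_atTop 0))
    obtain ⟨T, hT, hTT0⟩ := h𝒯.exists_gt T0
    obtain ⟨⟨⟨e1, e2⟩, e3, e4⟩, e5⟩ := hT0 T hTT0.le
    have hTpos : (0 : ℝ) < T := by exact_mod_cast e5
    have hT1 : (1 : ℝ) ≤ T := by exact_mod_cast e5
    have hTc : (T : ℂ) ≠ 0 := by exact_mod_cast e5.ne'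
    choose x hx1 hx2 hx3 using h T hT
    set y : L := ∑ j, (w j : L) * x j with hy
    have hyint : IsIntegral ℤ y := by
      refine IsIntegral.sum _ fun j _ => IsIntegral.mul ?_ (hx1 j)
      exact isIntegral_algebraMap (R := ℤ) (x := w j)
    have hyval : (y : ℂ) = (T : ℂ)⁻¹ ^ (n + 1) * ∑ j, (w j : ℂ) * (o j : ℂ) ^ 0 *
          (((1 + o j * (T : ℂ)⁻¹) ^ (n + 1))⁻¹ * η ((T : ℂ)⁻¹ / (1 + o j * (T : ℂ)⁻¹))) := by
      rw [← e1, hy]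
      push_cast
      refine Finset.sum_congr rfl fun j _ => ?_
      rw [hx2 j]; push_cast; rfl
    simp only [Function.comp] at e3
    have hΞ0 := (div_ne_zero_iff.1 e3).1
    have hy0 : y ≠ 0 := by
      intro h0
      have : (y : ℂ) = 0 := by rw [h0]; rfl
      rw [hyval] at this
      rcases mul_eq_zero.1 this with h1 | h1
      · exact pow_ne_zero _ (inv_ne_zero hTc) h1
      · exact hΞ0 h1
    have hyρ : ∀ ρ : L →+* ℂ, ‖ρ y‖ ≤ D * (T : ℝ) ^ E := by
      intro ρ
      rw [hy, map_sum]
      calc ‖∑ j, ρ ((w j : L) * x j)‖ ≤ ∑ j, ‖ρ ((w j : L) * x j)‖ := norm_sum_le _ _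
        _ ≤ ∑ j, (|(w j : ℝ)| * (|C| * (1 + (o j : ℝ)) ^ E)) * (T : ℝ) ^ E := by
            refine Finset.sum_le_sum fun j _ => ?_
            rw [map_mul, map_intCast, norm_mul, Complex.norm_intCast, mul_assoc]
            refine mul_le_mul_of_nonneg_left ?_ (abs_nonneg _)
            refine (hx3 j ρ).trans ?_
            rw [mul_assoc, ← mul_pow]
            refine (mul_le_mul_of_nonneg_right (le_abs_self C) (by positivity)).trans ?_
            refine mul_le_mul_of_nonneg_left ?_ (abs_nonneg _)
            refine pow_le_pow_left₀ (by positivity) ?_ _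
            push_cast
            have : (0 : ℝ) ≤ o j := by positivity
            nlinarith
        _ = (∑ j, (|(w j : ℝ)| * (|C| * (1 + (o j : ℝ)) ^ E))) * (T : ℝ) ^ E := by
            rw [Finset.sum_mul]
        _ ≤ D * (T : ℝ) ^ E := by
            refine mul_le_mul_of_nonneg_right ?_ (by positivity)
            rw [hD]; linarith
    have hfin := norm_bound L hL y hyint hy0 (D * (T : ℝ) ^ E) (by
      have : (1 : ℝ) ≤ (T : ℝ) ^ E := one_le_pow₀ hT1
      nlinarith) hyρ
    have hynorm : ‖(y : ℂ)‖ ≤ (‖a‖ + 1) * ((T : ℝ)⁻¹) ^ (m + 1) := by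
      rw [hyval, norm_mul, norm_pow, norm_inv, Complex.norm_natCast]
      rw [norm_div, norm_pow, norm_inv, Complex.norm_natCast, div_lt_iff₀ (by positivity)] at e4
      calc _ ≤ ((T : ℝ)⁻¹) ^ (n + 1) * ((‖a‖ + 1) * ((T : ℝ)⁻¹) ^ m) :=
            mul_le_mul_of_nonneg_left e4.le (by positivity)
        _ ≤ ((T : ℝ)⁻¹) ^ 1 * ((‖a‖ + 1) * ((T : ℝ)⁻¹) ^ m) := by
            refine mul_le_mul_of_nonneg_right ?_ (by positivity)
            exact pow_le_pow_of_le_one (by positivity) (inv_le_one_of_one_le₀ hT1) (by omega)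
        _ = _ := by ring
    have hcontra : ‖(y : ℂ)‖ * (D * (T : ℝ) ^ E) ^ (Module.finrank ℚ L) < 1 := by
      calc _ ≤ ((‖a‖ + 1) * ((T : ℝ)⁻¹) ^ (m + 1)) * (D * (T : ℝ) ^ E) ^ (Module.finrank ℚ L) :=
            mul_le_mul_of_nonneg_right hynorm (by positivity)
        _ = ((‖a‖ + 1) * D ^ (Module.finrank ℚ L)) * (((T : ℝ)⁻¹) ^ (m + 1) * (T : ℝ) ^ (E * Module.finrank ℚ L)) := by
            rw [mul_pow, ← pow_mul]; ring
        _ ≤ ((‖a‖ + 1) * D ^ (Module.finrank ℚ L)) * (T : ℝ)⁻¹ := by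
            refine mul_le_mul_of_nonneg_left ?_ (by positivity)
            rw [pow_succ, mul_right_comm]
            refine mul_le_of_le_one_left (by positivity) ?_
            rw [inv_pow, inv_mul_le_iff₀ (by positivity), mul_one]
            exact pow_le_pow_right₀ hT1 (by omega)
        _ < 1 := by
            rw [← div_eq_mul_inv, div_lt_one hTpos]; exact e2
    linarith

end ConjugateDensity

namespace ConjugateDensity

open Filter Topology

section transfer
open MvPolynomial

/-- A holomorphic curve `y` on `ball 0 R` with `Φ (y s) = p + s b`, with nondegenerate Jacobian. -/
structure Curve {K : Type} [Field K] {N : ℕ} (f : K →+* ℂ) (Φ : Fin N → MvPolynomial (Fin N) K)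
    (p b : Fin N → K) (R : ℝ) (y : ℂ → Fin N → ℂ) : Prop where
  diff : ∀ i, DifferentiableOn ℂ (fun s => y s i) (Metric.ball 0 R)
  eq : ∀ s ∈ Metric.ball (0 : ℂ) R, ∀ i, eval₂ f (y s) (Φ i) = f (p i) + s * f (b i)
  det : ∀ s ∈ Metric.ball (0 : ℂ) R,
    (Matrix.of fun i j => eval₂ f (y s) (pderiv j (Φ i))).det ≠ 0

theorem hasDerivAt_eval₂ {K : Type} [Field K] {N : ℕ} (f : K →+* ℂ) (y : ℂ → Fin N → ℂ)
    (dy : Fin N → ℂ) (s : ℂ) (h : ∀ i, HasDerivAt (fun s => y s i) (dy i) s)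
    (H : MvPolynomial (Fin N) K) :
    HasDerivAt (fun s => eval₂ f (y s) H) (∑ i, eval₂ f (y s) (pderiv i H) * dy i) s := by
  induction H using MvPolynomial.induction_on with
  | C a => simpa using hasDerivAt_const s (f a)
  | add p q hp hq =>
    simp only [eval₂_add, map_add, add_mul, Finset.sum_add_distrib]
    exact hp.add hq
  | mul_X p j hp =>
    simp only [eval₂_mul, eval₂_X]
    refine (hp.mul (h j)).congr_deriv ?_
    simp only [Derivation.leibniz, pderiv_X, smul_eq_mul, eval₂_add, eval₂_mul, eval₂_X,
      add_mul, Finset.sum_add_distrib]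
    have : ∀ i, eval₂ f (y s) (Pi.single (M := fun _ => MvPolynomial (Fin N) K) i 1 j) =
        if i = j then 1 else 0 := by
      intro i
      by_cases hij : i = j
      · subst hij; simp
      · simp [Ne.symm hij, hij]
    simp only [this]
    simp only [mul_ite, ite_mul, mul_one, mul_zero, zero_mul, Finset.sum_ite_eq',
      Finset.mem_univ, if_true, Finset.sum_mul]
    rw [add_comm]
    congr 1
    exact Finset.sum_congr rfl fun i _ => by ring

/-- The polynomial vector field. -/
noncomputable def vf {K : Type} [Field K] {N : ℕ} (Φ : Fin N → MvPolynomial (Fin N) K)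
    (b : Fin N → K) (H : MvPolynomial (Fin N) K) : MvPolynomial (Fin N) K :=
  ∑ i, ((Matrix.of fun i j => pderiv j (Φ i)).adjugate.mulVec fun i => C (b i)) i * pderiv i H

theorem Curve.analytic {K : Type} [Field K] {N : ℕ} {f : K →+* ℂ}
    {Φ : Fin N → MvPolynomial (Fin N) K}
    {p b : Fin N → K} {R : ℝ} {y : ℂ → Fin N → ℂ} (h : Curve f Φ p b R y)
    (H : MvPolynomial (Fin N) K) :
    AnalyticOnNhd ℂ (fun s => eval₂ f (y s) H) (Metric.ball 0 R) := by
  refine DifferentiableOn.analyticOnNhd ?_ Metric.isOpen_ball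
  intro s hs
  have hd : ∀ i, HasDerivAt (fun s => y s i) (deriv (fun s => y s i) s) s := fun i =>
    ((h.diff i).differentiableAt (Metric.isOpen_ball.mem_nhds hs)).hasDerivAt
  exact (hasDerivAt_eval₂ f y _ s hd H).differentiableAt.differentiableWithinAt

theorem Curve.deriv_eq {K : Type} [Field K] {N : ℕ} {f : K →+* ℂ}
    {Φ : Fin N → MvPolynomial (Fin N) K}
    {p b : Fin N → K} {R : ℝ} {y : ℂ → Fin N → ℂ} (h : Curve f Φ p b R y)
    (H : MvPolynomial (Fin N) K) (s : ℂ) (hs : s ∈ Metric.ball (0 : ℂ) R) :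
    (Matrix.of fun i j => eval₂ f (y s) (pderiv j (Φ i))).det * deriv (fun s => eval₂ f (y s) H) s =
      eval₂ f (y s) (vf Φ b H) := by
  have hd : ∀ i, HasDerivAt (fun s => y s i) (deriv (fun s => y s i) s) s := fun i =>
    ((h.diff i).differentiableAt (Metric.isOpen_ball.mem_nhds hs)).hasDerivAt
  set dy : Fin N → ℂ := fun i => deriv (fun s => y s i) s with hdy
  set J : Matrix (Fin N) (Fin N) ℂ := Matrix.of fun i j => eval₂ f (y s) (pderiv j (Φ i)) with hJ
  have h1 : J.mulVec dy = fun i => f (b i) := by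
    ext i
    have e1 := hasDerivAt_eval₂ f y dy s hd (Φ i)
    have e2 : HasDerivAt (fun s => eval₂ f (y s) (Φ i)) (f (b i)) s := by
      have : HasDerivAt (fun s : ℂ => f (p i) + s * f (b i)) (f (b i)) s := by
        simpa using ((hasDerivAt_id s).mul_const (f (b i))).const_add (f (p i))
      refine this.congr_of_eventuallyEq ?_
      filter_upwards [Metric.isOpen_ball.mem_nhds hs] with z hz using h.eq z hz i
    rw [← e1.unique e2]
    simp [Matrix.mulVec, dotProduct, hJ]
  have h2 : J.det • dy = J.adjugate.mulVec fun i => f (b i) := by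
    rw [← h1, Matrix.mulVec_mulVec, Matrix.adjugate_mul, Matrix.smul_mulVec, Matrix.one_mulVec]
  have h3 : J = (eval₂Hom f (y s)).mapMatrix (Matrix.of fun i j => pderiv j (Φ i)) := by
    ext i j; simp [hJ]
  have h4 : ∀ i, eval₂ f (y s) (((Matrix.of fun i j => pderiv j (Φ i)).adjugate.mulVec
      fun i => C (b i)) i) = J.det * dy i := by
    intro i
    have := congrFun h2 i
    simp only [Pi.smul_apply, smul_eq_mul] at this
    rw [this, h3, ← RingHom.map_adjugate]
    simp only [Matrix.mulVec, dotProduct, eval₂_sum, eval₂_mul, eval₂_C]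
    rfl
  rw [(hasDerivAt_eval₂ f y dy s hd H).deriv, vf, eval₂_sum, Finset.mul_sum]
  refine Finset.sum_congr rfl fun i _ => ?_
  rw [eval₂_mul, h4]; ring

theorem Curve.all_zero {K : Type} [Field K] {N : ℕ} {f : K →+* ℂ}
    {Φ : Fin N → MvPolynomial (Fin N) K}
    {p b : Fin N → K} {R : ℝ} {y : ℂ → Fin N → ℂ} (h : Curve f Φ p b R y) (hR : 0 < R) (n : ℕ) :
    ∀ (H : MvPolynomial (Fin N) K), (∀ᶠ s in 𝓝 (0 : ℂ), eval₂ f (y s) H = 0) →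
    eval₂ f (y 0) ((vf Φ b)^[n] H) = 0 := by
  have h0 : Metric.ball (0 : ℂ) R ∈ 𝓝 0 := Metric.ball_mem_nhds _ hR
  induction n with
  | zero => intro H hH; exact hH.self_of_nhds
  | succ n ih =>
    intro H hH
    rw [Function.iterate_succ_apply]
    apply ih
    filter_upwards [hH.eventually_nhds, h0] with s hs hs2
    rw [← h.deriv_eq H s hs2]
    have : (fun s => eval₂ f (y s) H) =ᶠ[𝓝 s] fun _ => 0 := hs
    rw [this.deriv_eq]; simp

theorem Curve.zero_of {K : Type} [Field K] {N : ℕ} {f : K →+* ℂ}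
    {Φ : Fin N → MvPolynomial (Fin N) K}
    {p b : Fin N → K} {R : ℝ} {y : ℂ → Fin N → ℂ} (h : Curve f Φ p b R y) (hR : 0 < R)
    (H : MvPolynomial (Fin N) K) (hH : ∀ n, eval₂ f (y 0) ((vf Φ b)^[n] H) = 0) :
    ∀ᶠ s in 𝓝 (0 : ℂ), eval₂ f (y s) H = 0 := by
  have h0 : (0 : ℂ) ∈ Metric.ball (0 : ℂ) R := Metric.mem_ball_self hR
  by_contra hne
  have key : ∀ (n : ℕ) (H : MvPolynomial (Fin N) K),
      analyticOrderAt (fun s => eval₂ f (y s) H) 0 = n → ∃ m, eval₂ f (y 0) ((vf Φ b)^[m] H) ≠ 0 := by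
    intro n
    induction n with
    | zero =>
      intro H hn
      exact ⟨0, (h.analytic H 0 h0).analyticOrderAt_eq_zero.1 (by simpa using hn)⟩
    | succ n ih =>
      intro H hn
      by_cases hz : eval₂ f (y 0) H = 0
      · have e1 := (h.analytic H 0 h0).analyticOrderAt_deriv_add_one
        simp only [hz, sub_zero] at e1
        rw [hn] at e1
        have e2 : analyticOrderAt (deriv fun s => eval₂ f (y s) H) 0 = n := by
          push_cast at e1
          exact (ENat.add_left_injective_of_ne_top (by simp)) e1
        have e3 : (fun s => eval₂ f (y s) (vf Φ b H)) =ᶠ[𝓝 0]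
            (fun s => eval₂ f (y s) ((Matrix.of fun i j => pderiv j (Φ i)).det)) *
              (deriv fun s => eval₂ f (y s) H) := by
          filter_upwards [Metric.ball_mem_nhds _ hR] with s hs
          rw [← h.deriv_eq H s hs]
          simp only [Pi.mul_apply]
          congr 1
          have := (eval₂Hom f (y s)).map_det (Matrix.of fun i j => pderiv j (Φ i))
          rw [coe_eval₂Hom] at this
          rw [this]
          congr 1
        have e4 : analyticOrderAt (fun s => eval₂ f (y s) (vf Φ b H)) 0 = n := by
          rw [analyticOrderAt_congr e3, analyticOrderAt_mul (h.analytic _ 0 h0)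
            (h.analytic H 0 h0).deriv, e2]
          have : analyticOrderAt
              (fun s => eval₂ f (y s) ((Matrix.of fun i j => pderiv j (Φ i)).det)) 0 = 0 := by
            rw [(h.analytic _ 0 h0).analyticOrderAt_eq_zero]
            have h5 := h.det 0 h0
            have := (eval₂Hom f (y 0)).map_det (Matrix.of fun i j => pderiv j (Φ i))
            rw [coe_eval₂Hom] at this
            rw [this]
            convert h5 using 1
            congr 1
          rw [this, zero_add]
        obtain ⟨m, hm⟩ := ih _ e4
        exact ⟨m + 1, by rwa [Function.iterate_succ_apply]⟩
      · exact ⟨0, hz⟩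
  have hfin : analyticOrderAt (fun s => eval₂ f (y s) H) 0 ≠ ⊤ := by
    rwa [Ne, analyticOrderAt_eq_top]
  obtain ⟨n, hn⟩ := ENat.ne_top_iff_exists.1 hfin
  obtain ⟨m, hm⟩ := key n H hn.symm
  exact hm (hH m)

theorem Curve.zero_on {K : Type} [Field K] {N : ℕ} {f : K →+* ℂ}
    {Φ : Fin N → MvPolynomial (Fin N) K}
    {p b : Fin N → K} {R : ℝ} {y : ℂ → Fin N → ℂ} (h : Curve f Φ p b R y)
    (H : MvPolynomial (Fin N) K) (s0 : ℂ) (hs0 : s0 ∈ Metric.ball (0 : ℂ) R)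
    (hH : ∃ᶠ s in 𝓝[≠] s0, eval₂ f (y s) H = 0) (s : ℂ) (hs : s ∈ Metric.ball (0 : ℂ) R) :
    eval₂ f (y s) H = 0 := 
  (h.analytic H).eqOn_zero_of_preconnected_of_frequently_eq_zero
    (convex_ball _ _).isPreconnected hs0 hH hs

/-- Transfer of algebraic relations between conjugate curves. -/
theorem transfer {K : Type} [Field K] {N : ℕ} {f f' : K →+* ℂ}
    {Φ : Fin N → MvPolynomial (Fin N) K}
    {p b : Fin N → K} {R : ℝ} {y y' : ℂ → Fin N → ℂ} (h : Curve f Φ p b R y)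
    (h' : Curve f' Φ p b R y') (a : Fin N → K) (ha : ∀ i, y 0 i = f (a i))
    (ha' : ∀ i, y' 0 i = f' (a i))
    (H : MvPolynomial (Fin N) K) (s0 : ℂ) (hs0 : s0 ∈ Metric.ball (0 : ℂ) R)
    (hH : ∃ᶠ s in 𝓝[≠] s0, eval₂ f (y s) H = 0) (s : ℂ) (hs : s ∈ Metric.ball (0 : ℂ) R) :
    eval₂ f' (y' s) H = 0 := by
  have hR : 0 < R := Metric.pos_of_mem_ball hs
  have e1 : ∀ᶠ s in 𝓝 (0 : ℂ), eval₂ f (y s) H = 0 := by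
    filter_upwards [Metric.ball_mem_nhds _ hR] with s hs using h.zero_on H s0 hs0 hH s hs
  have e2 : ∀ n, eval₂ f' (y' 0) ((vf Φ b)^[n] H) = 0 := by
    intro n
    have e3 := h.all_zero hR n H e1
    have ey : y 0 = f ∘ a := funext ha
    have ey' : y' 0 = f' ∘ a := funext ha'
    rw [ey, ← eval₂_comp, map_eq_zero] at e3
    rw [ey', ← eval₂_comp, e3, map_zero]
  have e3 := h'.zero_of hR H e2
  refine h'.zero_on H 0 (Metric.mem_ball_self hR) ?_ s hs
  exact (e3.filter_mono nhdsWithin_le_nhds).frequently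

end transfer
end ConjugateDensity

namespace ConjugateDensity

open Filter Topology

section algebraicity
open MvPolynomial

theorem alg_core {K F : Type} [Field K] [Field F] [Algebra K F] [CharZero K]
    [Algebra.EssFiniteType K F] {N : ℕ} (y : Fin N → F)
    (hfrac : ∀ x : F, ∃ g h : MvPolynomial (Fin N) K, aeval y h ≠ 0 ∧ x * aeval y h = aeval y g)
    (s : F) (hs : Function.Injective (Polynomial.aeval (R := K) s))
    (Φ : Fin N → MvPolynomial (Fin N) K) (p b : Fin N → K)
    (hΦ : ∀ i, aeval y (Φ i) = algebraMap K F (p i) + s * algebraMap K F (b i))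
    (hdet : (Matrix.of fun i j => aeval y (pderiv j (Φ i))).det ≠ 0)
    (S : MvPolynomial (Fin N) K) (hsS : s = aeval y S) :
    ∃ G : MvPolynomial (Fin N) K,
    (∀ j, ∃ (c : Polynomial K) (Q : Polynomial (Polynomial K)), c ≠ 0 ∧
      Polynomial.aeval s c * y j = Q.eval₂ (Polynomial.aeval (R := K) s).toRingHom (aeval y G)) ∧
    ∃ (q A B : Polynomial (Polynomial K)) (D : Polynomial K), D ≠ 0 ∧
      A * q + B * Polynomial.derivative q = Polynomial.C D ∧
      q.eval₂ (Polynomial.aeval (R := K) s).toRingHom (aeval y G) = 0 := by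
  let alg1 : Algebra (Polynomial K) F := (Polynomial.aeval (R := K) s).toRingHom.toAlgebra
  have : FaithfulSMul (Polynomial K) F := (faithfulSMul_iff_algebraMap_injective _ _).2 hs
  let alg2 : Algebra (FractionRing (Polynomial K)) F := FractionRing.liftAlgebra (Polynomial K) F
  have tow : IsScalarTower (Polynomial K) (FractionRing (Polynomial K)) F :=
    FractionRing.isScalarTower_liftAlgebra _ _
  have tow2 : IsScalarTower K (Polynomial K) F := IsScalarTower.of_algebraMap_eq (fun k => by
    change _ = Polynomial.aeval s (Polynomial.C k); simp)
  have e1 : Algebra.EssFiniteType (Polynomial K) F := Algebra.EssFiniteType.of_comp K _ _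
  have e2 : Algebra.EssFiniteType (FractionRing (Polynomial K)) F :=
    Algebra.EssFiniteType.of_comp (Polynomial K) _ _
  let d := KaehlerDifferential.D (FractionRing (Polynomial K)) F
  have d0 : ∀ g : Polynomial K, d (Polynomial.aeval s g) = 0 := fun g => by
    have : Polynomial.aeval s g = algebraMap (FractionRing (Polynomial K)) F
        (algebraMap (Polynomial K) _ g) := by
      rw [← IsScalarTower.algebraMap_apply]; rfl
    rw [this]; exact d.map_algebraMap _
  have dK : ∀ k : K, d (algebraMap K F k) = 0 := fun k => by simpa using d0 (Polynomial.C k)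
  have dg : ∀ g : MvPolynomial (Fin N) K, d (aeval y g) = ∑ j, aeval y (pderiv j g) • d (y j) := by
    intro g
    induction g using MvPolynomial.induction_on with
    | C a => simp [dK]
    | add p q hp hq => simp only [map_add, hp, hq, add_smul, Finset.sum_add_distrib]
    | mul_X p j hp =>
      rw [map_mul, aeval_X, d.leibniz, hp]
      have h3 : ∀ i, aeval y (pderiv i (p * X j)) =
          aeval y p * (if i = j then 1 else 0) + y j * aeval y (pderiv i p) := by
        intro i
        rw [Derivation.leibniz, pderiv_X]
        by_cases hij : i = j
        · subst hij; simp
        · simp [Ne.symm hij, hij]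
      simp only [h3, add_smul, Finset.sum_add_distrib, mul_smul, Finset.smul_sum, ite_smul,
        one_smul, zero_smul, smul_ite, smul_zero, Finset.sum_ite_eq', Finset.mem_univ, if_true]
  set J : Matrix (Fin N) (Fin N) F := Matrix.of fun i j => aeval y (pderiv j (Φ i)) with hJ
  have hrow : ∀ i, ∑ j, J i j • d (y j) = 0 := by
    intro i
    have h1 := dg (Φ i)
    rw [hΦ, map_add, dK, d.leibniz, dK] at h1
    have h2 : d s = 0 := by simpa using d0 Polynomial.X
    rw [h2] at h1
    simpa [hJ] using h1.symm
  have dy : ∀ l, d (y l) = 0 := by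
    intro l
    have h1 : ∑ i, J.adjugate l i • ∑ j, J i j • d (y j) = J.det • d (y l) := by
      simp_rw [Finset.smul_sum, smul_smul]
      rw [Finset.sum_comm]
      simp_rw [← Finset.sum_smul]
      have h2 : ∀ j, ∑ i, J.adjugate l i * J i j = (J.adjugate * J) l j := fun j => rfl
      simp_rw [h2, Matrix.adjugate_mul]
      simp [Matrix.one_apply]
    simp only [hrow, smul_zero, Finset.sum_const_zero] at h1
    exact (smul_eq_zero.1 h1.symm).resolve_left hdet
  have dall : ∀ x : F, d x = 0 := by
    intro x
    obtain ⟨g, h, hh, hx⟩ := hfrac x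
    have h1 := congrArg d hx
    rw [d.leibniz, dg, dg] at h1
    simp only [dy, smul_zero, Finset.sum_const_zero, zero_add] at h1
    exact (smul_eq_zero.1 h1).resolve_left hh
  have : Algebra.FormallyUnramified (FractionRing (Polynomial K)) F := by
    constructor
    rw [← Submodule.subsingleton_iff F, ← subsingleton_iff_bot_eq_top,
      ← KaehlerDifferential.span_range_derivation, eq_comm, Submodule.span_eq_bot]
    rintro _ ⟨x, rfl⟩
    exact dall x
  have hsep : Algebra.IsSeparable (FractionRing (Polynomial K)) F :=
    (Algebra.FormallyUnramified.iff_isSeparable (FractionRing (Polynomial K)) F).1 inferInstance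
  have hfin : Module.Finite (FractionRing (Polynomial K)) F :=
    Algebra.FormallyUnramified.finite_of_free (FractionRing (Polynomial K)) F
  have hs0 : ∀ c : Polynomial K, c ≠ 0 → Polynomial.aeval s c ≠ 0 := fun c hc h =>
    hc (hs (by rw [h, map_zero]))
  have hsy : ∀ c : Polynomial K, Polynomial.aeval s c = aeval y (Polynomial.aeval S c) := fun c => by
    rw [hsS, Polynomial.aeval_algHom_apply]
  have hK0 : ∀ c : Polynomial K, algebraMap (FractionRing (Polynomial K)) F
      (algebraMap (Polynomial K) _ c) = Polynomial.aeval s c := fun c => by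
    rw [← IsScalarTower.algebraMap_apply]; rfl
  let U : Subalgebra (FractionRing (Polynomial K)) F :=
    { carrier := {x | ∃ c : Polynomial K, c ≠ 0 ∧ ∃ g : MvPolynomial (Fin N) K,
        Polynomial.aeval s c * x = aeval y g}
      mul_mem' := by
        rintro x1 x2 ⟨c1, hc1, g1, h1⟩ ⟨c2, hc2, g2, h2⟩
        refine ⟨c1 * c2, mul_ne_zero hc1 hc2, g1 * g2, ?_⟩
        rw [map_mul, map_mul, ← h1, ← h2]; ring
      add_mem' := by
        rintro x1 x2 ⟨c1, hc1, g1, h1⟩ ⟨c2, hc2, g2, h2⟩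
        refine ⟨c1 * c2, mul_ne_zero hc1 hc2,
          Polynomial.aeval S c2 * g1 + Polynomial.aeval S c1 * g2, ?_⟩
        rw [map_mul, map_add, map_mul, map_mul, ← h1, ← h2, ← hsy, ← hsy]; ring
      algebraMap_mem' := by
        intro r
        obtain ⟨c1, c2, hc2, hr⟩ := IsFractionRing.div_surjective (A := Polynomial K) r
        have hc2' : c2 ≠ 0 := nonZeroDivisors.ne_zero hc2
        refine ⟨c2, hc2', Polynomial.aeval S c1, ?_⟩
        rw [← hsy, ← hr, map_div₀, hK0, hK0, mul_div_cancel₀ _ (hs0 c2 hc2')] }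
  have hUy : ∀ g : MvPolynomial (Fin N) K, aeval y g ∈ U := fun g => ⟨1, one_ne_zero, g, by simp⟩
  have hU : ∀ x : F, x ∈ U := by
    intro x
    obtain ⟨g, h, hh, hx⟩ := hfrac x
    have : x = aeval y g * (aeval y h)⁻¹ := by rw [← hx]; field_simp
    rw [this]
    refine U.mul_mem (hUy g) ?_
    exact Subalgebra.inv_mem_of_algebraic U (x := ⟨_, hUy h⟩) (Algebra.IsAlgebraic.isAlgebraic _)
  obtain ⟨α, hα⟩ := Field.exists_primitive_element (FractionRing (Polynomial K)) F
  obtain ⟨c0, hc0, G, hG⟩ := hU α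
  have hGgen : Algebra.adjoin (FractionRing (Polynomial K)) {aeval y G} = ⊤ := by
    have h1 : α ∈ IntermediateField.adjoin (FractionRing (Polynomial K)) {aeval y G} := by
      have h2 : α = algebraMap _ F (algebraMap (Polynomial K) (FractionRing (Polynomial K)) c0)⁻¹ *
          aeval y G := by
        rw [← hG, map_inv₀, hK0]
        have := hs0 c0 hc0
        field_simp
      rw [h2]
      exact mul_mem (IntermediateField.algebraMap_mem _ _)
        (IntermediateField.mem_adjoin_simple_self _ _)
    have h2 : IntermediateField.adjoin (FractionRing (Polynomial K)) {aeval y G} = ⊤ := by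
      rw [eq_top_iff, ← hα, IntermediateField.adjoin_simple_le_iff]; exact h1
    rw [← IntermediateField.adjoin_simple_toSubalgebra_of_isAlgebraic
      (Algebra.IsAlgebraic.isAlgebraic _), h2]; rfl
  refine ⟨G, fun j => ?_, ?_⟩
  · have h1 : y j ∈ Algebra.adjoin (FractionRing (Polynomial K)) {aeval y G} := by
      rw [hGgen]; trivial
    rw [Algebra.adjoin_singleton_eq_range_aeval] at h1
    obtain ⟨Q, hQ⟩ := h1
    obtain ⟨c, hc, h2⟩ := IsLocalization.integerNormalization_spec (nonZeroDivisors (Polynomial K)) Q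
    refine ⟨c, IsLocalization.integerNormalization (nonZeroDivisors (Polynomial K)) Q,
      nonZeroDivisors.ne_zero hc, ?_⟩
    have h3 := congrArg (Polynomial.aeval (aeval y G)) h2
    rw [Polynomial.aeval_map_algebraMap, ← algebraMap_smul (FractionRing (Polynomial K)) c Q,
      map_smul] at h3
    change Polynomial.aeval (aeval y G) Q = y j at hQ
    rw [hQ, Algebra.smul_def, hK0] at h3
    rw [← h3]; rfl
  generalize aeval y G = x
  have hm : (minpoly (FractionRing (Polynomial K)) x).Separable :=
    Algebra.IsSeparable.isSeparable _ x
  set m := minpoly (FractionRing (Polynomial K)) x with hmdef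
  obtain ⟨a, b', hab⟩ := hm
  obtain ⟨c1, hc1, h1⟩ := IsLocalization.integerNormalization_spec (nonZeroDivisors (Polynomial K)) m
  obtain ⟨c2, hc2, h2⟩ := IsLocalization.integerNormalization_spec (nonZeroDivisors (Polynomial K)) a
  obtain ⟨c3, hc3, h3⟩ := IsLocalization.integerNormalization_spec (nonZeroDivisors (Polynomial K)) b'
  refine ⟨_, Polynomial.C c3 * IsLocalization.integerNormalization (nonZeroDivisors (Polynomial K)) a,
    Polynomial.C c2 * IsLocalization.integerNormalization (nonZeroDivisors (Polynomial K)) b',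
    c1 * c2 * c3, ?_, ?_,
    IsLocalization.integerNormalization_aeval_eq_zero (nonZeroDivisors (Polynomial K)) m
      (minpoly.aeval _ x)⟩
  · exact mul_ne_zero (mul_ne_zero (nonZeroDivisors.ne_zero hc1) (nonZeroDivisors.ne_zero hc2))
      (nonZeroDivisors.ne_zero hc3)
  · apply Polynomial.map_injective (algebraMap (Polynomial K) (FractionRing (Polynomial K)))
      (IsFractionRing.injective _ _)
    have hsm : ∀ (c : Polynomial K) (g : Polynomial (FractionRing (Polynomial K))), c • g =
        Polynomial.C (algebraMap (Polynomial K) (FractionRing (Polynomial K)) c) * g := by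
      intro c g
      rw [← Polynomial.smul_eq_C_mul, algebraMap_smul]
    rw [hsm] at h1 h2 h3
    simp only [Polynomial.map_add, Polynomial.map_mul, ← Polynomial.derivative_map, h1, h2, h3,
      Polynomial.map_C, Polynomial.derivative_C_mul, map_mul]
    linear_combination (Polynomial.C (algebraMap (Polynomial K) (FractionRing (Polynomial K)) c1) *
      Polynomial.C (algebraMap (Polynomial K) (FractionRing (Polynomial K)) c2) *
      Polynomial.C (algebraMap (Polynomial K) (FractionRing (Polynomial K)) c3)) * hab

/-- the coordinate polynomial expressing the parameter `s` -/
noncomputable def parPoly {K : Type} [Field K] {N : ℕ} (Φ : Fin N → MvPolynomial (Fin N) K)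
    (p b : Fin N → K) (i : Fin N) : MvPolynomial (Fin N) K := C (b i)⁻¹ * (Φ i - C (p i))

theorem Curve.parPoly_eq {K : Type} [Field K] {N : ℕ} {f : K →+* ℂ}
    {Φ : Fin N → MvPolynomial (Fin N) K}
    {p b : Fin N → K} {R : ℝ} {y : ℂ → Fin N → ℂ} (h : Curve f Φ p b R y) (i : Fin N)
    (hb : b i ≠ 0) (s : ℂ) (hs : s ∈ Metric.ball (0 : ℂ) R) :
    eval₂ f (y s) (parPoly Φ p b i) = s := by
  have : f (b i) ≠ 0 := by simpa using hb
  rw [parPoly, eval₂_mul, eval₂_sub, eval₂_C, eval₂_C, h.eq s hs i, map_inv₀]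
  field_simp
  ring

theorem Curve.primitive {K : Type} [Field K] [CharZero K] {N : ℕ} {f : K →+* ℂ}
    {Φ : Fin N → MvPolynomial (Fin N) K}
    {p b : Fin N → K} {R : ℝ} {y : ℂ → Fin N → ℂ} (h : Curve f Φ p b R y) (hR : 0 < R)
    (i0 : Fin N) (hb : b i0 ≠ 0) :
    ∃ G : MvPolynomial (Fin N) K,
    (∀ j, ∃ (c : Polynomial K) (Q : Polynomial (Polynomial K)), c ≠ 0 ∧
      ∀ s ∈ Metric.ball (0 : ℂ) R, eval₂ f (y s) (Polynomial.aeval (parPoly Φ p b i0) c * X j -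
        Q.eval₂ (Polynomial.aeval (R := K) (parPoly Φ p b i0)).toRingHom G) = 0) ∧
    ∃ (q A B : Polynomial (Polynomial K)) (D : Polynomial K), D ≠ 0 ∧
      A * q + B * Polynomial.derivative q = Polynomial.C D ∧
      ∀ s ∈ Metric.ball (0 : ℂ) R, eval₂ f (y s)
        (q.eval₂ (Polynomial.aeval (R := K) (parPoly Φ p b i0)).toRingHom G) = 0 := by
  have h0 : (0 : ℂ) ∈ Metric.ball (0 : ℂ) R := Metric.mem_ball_self hR
  let ev : MvPolynomial (Fin N) K →+* (Metric.ball (0 : ℂ) R → ℂ) :=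
    RingHom.pi fun s => eval₂Hom f (y s)
  have hev : ∀ g s, ev g s = eval₂ f (y s) g := fun g s => rfl
  let 𝔭 := RingHom.ker ev
  have hmem : ∀ g, g ∈ 𝔭 ↔ ∀ s ∈ Metric.ball (0 : ℂ) R, eval₂ f (y s) g = 0 := by
    intro g
    rw [RingHom.mem_ker]
    constructor
    · intro hg s hs; exact congrFun hg ⟨s, hs⟩
    · intro hg; ext s; exact hg s s.2
  have : 𝔭.IsPrime := by
    refine ⟨?_, ?_⟩
    · rw [Ideal.ne_top_iff_one, hmem]
      intro h1
      have := h1 0 h0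
      simp at this
    · intro g1 g2 hg
      rw [hmem] at hg
      rw [hmem, hmem]
      refine AnalyticOnNhd.eq_zero_or_eq_zero_of_mul_eq_zero (h.analytic g1) (h.analytic g2) ?_
        (convex_ball (0 : ℂ) R).isPreconnected
      intro s hs
      rw [← eval₂_mul]; exact hg s hs
  let A := MvPolynomial (Fin N) K ⧸ 𝔭
  let F := FractionRing A
  let ybar : Fin N → F := fun i => algebraMap A F (Ideal.Quotient.mk 𝔭 (X i))
  have haev : ∀ g : MvPolynomial (Fin N) K, aeval ybar g = algebraMap A F (Ideal.Quotient.mk 𝔭 g) := by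
    intro g
    have : (aeval ybar : MvPolynomial (Fin N) K →ₐ[K] F) =
      (IsScalarTower.toAlgHom K A F).comp (Ideal.Quotient.mkₐ K 𝔭) := by
      ext i; simp [ybar]; rfl
    rw [this]; rfl
  have hz : ∀ g : MvPolynomial (Fin N) K, aeval ybar g = 0 ↔
      ∀ s ∈ Metric.ball (0 : ℂ) R, eval₂ f (y s) g = 0 := by
    intro g
    rw [haev, ← hmem, ← Ideal.Quotient.eq_zero_iff_mem]
    exact map_eq_zero_iff _ (IsFractionRing.injective A F)
  have : Algebra.EssFiniteType A F := Algebra.EssFiniteType.of_isLocalization F (nonZeroDivisors A)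
  have : Algebra.EssFiniteType K F := Algebra.EssFiniteType.comp K A F
  set S := parPoly Φ p b i0 with hS
  have hbi : ∀ g : Polynomial K, ∀ s ∈ Metric.ball (0 : ℂ) R,
      eval₂ f (y s) (Polynomial.aeval S g) = g.eval₂ f s := by
    intro g s hs
    have h1 : (eval₂Hom f (y s)).comp ((Polynomial.aeval S).toRingHom) =
        Polynomial.eval₂RingHom f s := by
      refine Polynomial.ringHom_ext (fun a => ?_) ?_
      · simp
      · simpa using h.parPoly_eq i0 hb s hs
    exact DFunLike.congr_fun h1 g
  have c1 : ∀ x : F, ∃ g h : MvPolynomial (Fin N) K, aeval ybar h ≠ 0 ∧ x * aeval ybar h = aeval ybar g := by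
    intro x
    obtain ⟨g, h', hx⟩ := IsFractionRing.div_surjective (A := A) x
    obtain ⟨g, rfl⟩ := Ideal.Quotient.mk_surjective g
    obtain ⟨h'', rfl⟩ := Ideal.Quotient.mk_surjective h'
    have hne : aeval ybar h'' ≠ 0 := by
      rw [haev]
      exact (map_ne_zero_iff _ (IsFractionRing.injective A F)).2 (nonZeroDivisors.ne_zero hx.1)
    refine ⟨g, h'', hne, ?_⟩
    rw [← hx.2, ← haev, ← haev, div_mul_cancel₀ _ hne]
  have c2 : Function.Injective (Polynomial.aeval (R := K) (aeval ybar S)) := by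
    rw [injective_iff_map_eq_zero]
    intro g hg
    have h1 : aeval ybar (Polynomial.aeval S g) = 0 := by
      rw [← hg, Polynomial.aeval_algHom_apply]
    rw [hz] at h1
    have h2 : (g.map f) = 0 := by
      refine Polynomial.eq_zero_of_infinite_isRoot _ (Set.Infinite.mono (s := Metric.ball (0 : ℂ) R) ?_ ?_)
      · intro s hs
        have := h1 s hs
        rw [hbi g s hs] at this
        rw [Set.mem_setOf_eq, Polynomial.IsRoot, Polynomial.eval_map]; exact this
      · exact infinite_of_mem_nhds 0 (Metric.ball_mem_nhds _ hR)
    rwa [Polynomial.map_eq_zero] at h2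
  have c3 : ∀ i, aeval ybar (Φ i) = algebraMap K F (p i) + aeval ybar S * algebraMap K F (b i) := by
    intro i
    have : aeval ybar (Φ i - (C (p i) + S * C (b i))) = 0 := by
      rw [hz]
      intro s hs
      rw [eval₂_sub, eval₂_add, eval₂_mul, eval₂_C, eval₂_C, h.eq s hs, h.parPoly_eq i0 hb s hs,
        sub_self]
    rw [map_sub, map_add, map_mul, sub_eq_zero] at this
    simpa using this
  have c4 : (Matrix.of fun i j => aeval ybar (pderiv j (Φ i))).det ≠ 0 := by
    have h1 : (Matrix.of fun i j => aeval ybar (pderiv j (Φ i))) =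
      (aeval (R := K) ybar).mapMatrix (Matrix.of fun i j => pderiv j (Φ i)) := by
      ext i j; simp
    rw [h1, ← AlgHom.map_det, Ne, hz]
    intro h2
    have h3 := h2 0 h0
    apply h.det 0 h0
    refine Eq.trans ?_ h3
    have := (eval₂Hom f (y 0)).map_det (Matrix.of fun i j => pderiv j (Φ i))
    rw [coe_eval₂Hom] at this
    rw [this]
    congr 1
  have key : ∀ (Q : Polynomial (Polynomial K)) (G : MvPolynomial (Fin N) K),
      aeval ybar (Q.eval₂ (Polynomial.aeval (R := K) S).toRingHom G) =
      Q.eval₂ (Polynomial.aeval (R := K) (aeval ybar S)).toRingHom (aeval ybar G) := by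
    intro Q G
    have := Polynomial.hom_eval₂ Q (Polynomial.aeval (R := K) S).toRingHom
      (aeval (R := K) ybar).toRingHom G
    have e : ((aeval (R := K) ybar).toRingHom.comp (Polynomial.aeval (R := K) S).toRingHom) =
      (Polynomial.aeval (R := K) (aeval ybar S)).toRingHom := by
      refine Polynomial.ringHom_ext (fun a => ?_) ?_ <;> simp
    rw [e] at this
    exact this
  obtain ⟨G, hG, q, A', B', D, hD, hAB, hq⟩ := alg_core ybar c1 (aeval ybar S) c2 Φ p b c3 c4 S rfl
  refine ⟨G, fun j => ?_, q, A', B', D, hD, hAB, ?_⟩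
  · obtain ⟨c, Q, hc, hQ⟩ := hG j
    refine ⟨c, Q, hc, ?_⟩
    rw [← hz, map_sub, map_mul, key, aeval_X, ← hQ, Polynomial.aeval_algHom_apply, sub_self]
  · rw [← hz, key, hq]

theorem eval_bi {K : Type} [Field K] {N : ℕ} (f : K →+* ℂ) (S G : MvPolynomial (Fin N) K)
    (q : Polynomial (Polynomial K)) (v : Fin N → ℂ) :
    eval₂ f v (q.eval₂ (Polynomial.aeval (R := K) S).toRingHom G) =
      q.eval₂ (Polynomial.eval₂RingHom f (eval₂ f v S)) (eval₂ f v G) := by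
  have h3 := Polynomial.hom_eval₂ q (Polynomial.aeval (R := K) S).toRingHom (eval₂Hom f v) G
  have e : ((eval₂Hom f v).comp (Polynomial.aeval (R := K) S).toRingHom) =
      Polynomial.eval₂RingHom f (eval₂ f v S) := by
    refine Polynomial.ringHom_ext (fun a => ?_) ?_ <;> simp
  rw [e] at h3
  exact h3

theorem eval_uni {K : Type} [Field K] {N : ℕ} (f : K →+* ℂ) (S : MvPolynomial (Fin N) K)
    (q : Polynomial K) (v : Fin N → ℂ) :
    eval₂ f v (Polynomial.aeval S q) = q.eval₂ f (eval₂ f v S) := by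
  have e : ((eval₂Hom f v).comp (Polynomial.aeval (R := K) S).toRingHom) =
      Polynomial.eval₂RingHom f (eval₂ f v S) := by
    refine Polynomial.ringHom_ext (fun a => ?_) ?_ <;> simp
  exact DFunLike.congr_fun e q

end algebraicity
end ConjugateDensity

namespace ConjugateDensity

open Filter Topology

section branches
open Polynomial

theorem branch_one (q : ℂ[X][X]) (r : ℂ) (h0 : (q.map (evalRingHom 0)).eval r = 0)
    (h1 : ((derivative q).map (evalRingHom 0)).eval r ≠ 0) :
    ∃ g : ℂ → ℂ, AnalyticAt ℂ g 0 ∧ g 0 = r ∧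
      ∀ᶠ x in 𝓝 (0 : ℂ), (q.map (evalRingHom x)).eval (g x) = 0 := by
  let F : ℂ × ℂ → ℂ := fun p => (q.map (evalRingHom p.1)).eval p.2
  have hF : F = fun p => ∑ k ∈ Finset.range (q.natDegree + 1), (q.coeff k).eval p.1 * p.2 ^ k := by
    funext p
    simp only [F]
    rw [eval_map, eval₂_eq_sum_range]
    rfl
  have cF : ContDiff ℂ (⊤ : WithTop ℕ∞) F := by
    rw [hF]
    refine ContDiff.sum (fun k _ => ContDiff.mul ?_ (by fun_prop))
    have := (Polynomial.contDiff_aeval (𝕜 := ℂ) (q.coeff k) (⊤ : WithTop ℕ∞) ).comp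
      (contDiff_fst (𝕜 := ℂ) (E := ℂ) (F := ℂ))
    simpa [Function.comp_def, Polynomial.coe_aeval_eq_eval] using this
  have cFa : ContDiffAt ℂ (⊤ : WithTop ℕ∞) F (0, r) := cF.contDiffAt
  have ne : (⊤ : WithTop ℕ∞) ≠ 0 := by simp
  have hd : HasDerivAt (fun w => F (0, w)) (((derivative q).map (evalRingHom 0)).eval r) r := by
    rw [← Polynomial.derivative_map]
    exact Polynomial.hasDerivAt (q.map (evalRingHom (0:ℂ))) r
  have hd2 : HasDerivAt (fun w => F (0, w)) (fderiv ℂ F (0, r) (0, 1)) r := by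
    have e1 : HasFDerivAt F (fderiv ℂ F (0, r)) (0, r) :=
      (cFa.differentiableAt ne).hasFDerivAt
    have e2 : HasDerivAt (fun w : ℂ => ((0 : ℂ), w)) (0, 1) r :=
      (hasDerivAt_const r (0 : ℂ)).prodMk (hasDerivAt_id r)
    exact e1.comp_hasDerivAt r e2
  have heq := hd2.unique hd
  have inv : (fderiv ℂ F (0, r) ∘L .inr ℂ ℂ ℂ).IsInvertible := by
    refine ⟨ContinuousLinearEquiv.unitsEquivAut ℂ (Units.mk0 _ h1), ?_⟩
    ext
    simp [← heq]
  refine ⟨cFa.implicitFunction ne inv, ?_, cFa.implicitFunction_apply_self ne inv, ?_⟩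
  · exact (cFa.contDiffAt_implicitFunction ne inv).analyticAt
  · filter_upwards [cFa.eventually_apply_implicitFunction ne inv] with x hx
    exact hx.trans h0

theorem branches (q A B : ℂ[X][X]) (D : ℂ[X]) (hAB : A * q + B * derivative q = C D)
    (hD : D.eval 0 ≠ 0) (hlc : q.leadingCoeff.eval 0 ≠ 0) :
    ∃ g : Fin q.natDegree → ℂ → ℂ, (∀ i, AnalyticAt ℂ (g i) 0) ∧
      ∀ᶠ x in 𝓝 (0 : ℂ), q.leadingCoeff.eval x ≠ 0 ∧ Function.Injective (fun i => g i x) ∧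
        q.map (evalRingHom x) = C (q.leadingCoeff.eval x) * ∏ i, (X - C (g i x)) := by
  have hdeg : ∀ x : ℂ, q.leadingCoeff.eval x ≠ 0 → (q.map (evalRingHom x)).natDegree = q.natDegree :=
    fun x hx => natDegree_map_of_leadingCoeff_ne_zero _ hx
  have hlead : ∀ x : ℂ, q.leadingCoeff.eval x ≠ 0 →
      (q.map (evalRingHom x)).leadingCoeff = q.leadingCoeff.eval x :=
    fun x hx => leadingCoeff_map_of_leadingCoeff_ne_zero _ hx
  set p := q.map (evalRingHom 0) with hp
  have hp0 : p ≠ 0 := by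
    intro h
    have := hlead 0 hlc
    rw [← hp, h, leadingCoeff_zero] at this
    exact hlc this.symm
  have hab := congrArg (Polynomial.map (evalRingHom (0:ℂ))) hAB
  rw [Polynomial.map_add, Polynomial.map_mul, Polynomial.map_mul, ← Polynomial.derivative_map,
    ← hp, map_C, coe_evalRingHom] at hab
  have hsep : p.Separable := by
    refine ⟨C (D.eval 0)⁻¹ * A.map (evalRingHom 0), C (D.eval 0)⁻¹ * B.map (evalRingHom 0), ?_⟩
    rw [mul_assoc, mul_assoc, ← mul_add, hab, ← C_mul, inv_mul_cancel₀ hD, C_1]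
  have hnd : p.roots.Nodup := nodup_roots hsep
  have hcard : p.roots.toFinset.card = q.natDegree := by
    rw [Multiset.toFinset_card_of_nodup hnd, ← hdeg 0 hlc]
    exact (splits_iff_card_roots.1 (IsAlgClosed.splits p))
  let r : Fin q.natDegree ≃ p.roots.toFinset := (Fintype.equivFinOfCardEq (by simpa using hcard)).symm
  have hr : ∀ i, p.eval (r i : ℂ) = 0 := fun i => by
    have := (r i).2
    rw [Multiset.mem_toFinset, mem_roots hp0] at this
    exact this
  have hex : ∀ i, ∃ g : ℂ → ℂ, AnalyticAt ℂ g 0 ∧ g 0 = r i ∧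
      ∀ᶠ x in 𝓝 (0 : ℂ), (q.map (evalRingHom x)).eval (g x) = 0 := by
    intro i
    refine branch_one q (r i) (hr i) ?_
    rw [← Polynomial.derivative_map, ← hp]
    intro h
    have := congrArg (Polynomial.eval (r i : ℂ)) hab
    rw [eval_add, eval_mul, eval_mul, hr, h, mul_zero, mul_zero, add_zero, eval_C] at this
    exact hD this.symm
  choose g hg hg0 hgr using hex
  refine ⟨g, hg, ?_⟩
  have e1 : ∀ᶠ x in 𝓝 (0 : ℂ), q.leadingCoeff.eval x ≠ 0 :=
    q.leadingCoeff.continuous.continuousAt.eventually_ne hlc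
  have e2 : ∀ᶠ x in 𝓝 (0 : ℂ), ∀ i j, i ≠ j → g i x ≠ g j x := by
    rw [eventually_all]; intro i
    rw [eventually_all]; intro j
    by_cases hij : i = j
    · simp [hij]
    · have : ∀ᶠ x in 𝓝 (0 : ℂ), g i x - g j x ≠ 0 := by
        refine ((hg i).continuousAt.sub (hg j).continuousAt).eventually_ne ?_
        rw [Pi.sub_apply, hg0, hg0, sub_ne_zero]
        intro h
        exact hij (r.injective (Subtype.ext h))
      filter_upwards [this] with x hx _ using sub_ne_zero.1 hx
  filter_upwards [e1, e2, eventually_all.2 hgr] with x h1 h2 h3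
  have hinj : Function.Injective (fun i => g i x) := by
    intro i j hij
    by_contra hne
    exact h2 i j hne hij
  refine ⟨h1, hinj, ?_⟩
  have hdvd : ∏ i, (X - C (g i x)) ∣ q.map (evalRingHom x) := by
    refine Finset.prod_dvd_of_coprime ?_ ?_
    · intro i _ j _ hij
      exact Polynomial.isCoprime_X_sub_C_of_isUnit_sub (sub_ne_zero.2 (h2 i j hij)).isUnit
    · intro i _
      exact dvd_iff_isRoot.2 (h3 i)
  have hm : (∏ i, (X - C (g i x))).Monic := monic_prod_X_sub_C _ _
  have := eq_leadingCoeff_mul_of_monic_of_dvd_of_natDegree_le hm hdvd (by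
    rw [hdeg x h1, natDegree_prod_of_monic _ _ (fun i _ => monic_X_sub_C _)]
    simp)
  rw [hlead x h1] at this
  exact this

end branches
end ConjugateDensity

namespace ConjugateDensity

open Filter Topology

section coeffs
open Polynomial

theorem prodcoeff_mem {ι : Type} (R : Subring ℂ) (S : Finset ι) (v : ι → ℂ) (hv : ∀ i ∈ S, v i ∈ R) :
    ∀ k, (∏ i ∈ S, (X - C (v i))).coeff k ∈ R := by
  classical
  induction S using Finset.induction_on with
  | empty => intro k; rw [Finset.prod_empty, coeff_one]; split_ifs; exacts [R.one_mem, R.zero_mem]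
  | insert a S ha ih =>
    have ih := ih (fun i hi => hv i (Finset.mem_insert_of_mem hi))
    have h1 := hv a (Finset.mem_insert_self _ _)
    intro k
    rw [Finset.prod_insert ha, sub_mul, coeff_sub, coeff_C_mul]
    refine R.sub_mem ?_ (R.mul_mem h1 (ih k))
    cases k with
    | zero => simp
    | succ k => rw [coeff_X_mul]; exact ih k

theorem prodcoeff_bound {ι : Type} (S : Finset ι) (v : ι → ℂ) (K : ℝ) (hK : 0 ≤ K)
    (hv : ∀ i ∈ S, ‖v i‖ ≤ K) :
    ∀ k, ‖(∏ i ∈ S, (X - C (v i))).coeff k‖ ≤ (1 + K) ^ S.card := by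
  classical
  induction S using Finset.induction_on with
  | empty => intro k; rw [Finset.prod_empty, coeff_one]; split_ifs <;> simp
  | insert a S ha ih =>
    have ih := ih (fun i hi => hv i (Finset.mem_insert_of_mem hi))
    have h1 := hv a (Finset.mem_insert_self _ _)
    intro k
    rw [Finset.prod_insert ha, sub_mul, coeff_sub, coeff_C_mul, Finset.card_insert_of_notMem ha,
      pow_succ, mul_comm _ (1 + K), add_mul, one_mul]
    refine (norm_sub_le _ _).trans (add_le_add ?_ ?_)
    · cases k with
      | zero => simp; positivity
      | succ k => rw [coeff_X_mul]; exact ih k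
    · rw [norm_mul]; exact mul_le_mul h1 (ih k) (norm_nonneg _) hK

theorem prodcoeff_scale {ι : Type} (S : Finset ι) (v : ι → ℂ) (t : ℂ) (k : ℕ) :
    (∏ i ∈ S, (X - C (t * v i))).coeff k =
      t ^ (S.card - k) * (∏ i ∈ S, (X - C (v i))).coeff k := by
  classical
  induction S using Finset.induction_on generalizing k with
  | empty => rw [Finset.prod_empty, Finset.prod_empty, coeff_one]; split_ifs <;> simp
  | insert a S ha ih =>
    rw [Finset.prod_insert ha, Finset.prod_insert ha, sub_mul, coeff_sub, coeff_C_mul, sub_mul,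
      coeff_sub, coeff_C_mul, Finset.card_insert_of_notMem ha, mul_sub]
    have hz : S.card < k → (∏ i ∈ S, (X - C (v i))).coeff k = 0 := by
      intro h
      apply coeff_eq_zero_of_natDegree_lt
      rw [natDegree_prod_of_monic _ _ (fun i _ => monic_X_sub_C _)]
      simpa using h
    congr 1
    · cases k with
      | zero => simp
      | succ k => rw [coeff_X_mul, coeff_X_mul, ih, Nat.add_sub_add_right]
    · rw [ih]
      rcases lt_or_ge S.card k with h | h
      · rw [hz h]; simp
      · rw [Nat.succ_sub h, pow_succ]; ring

theorem prodcoeff_analytic {ι : Type} (S : Finset ι) (u : ι → ℂ → ℂ)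
    (hu : ∀ i, AnalyticAt ℂ (u i) 0) (k : ℕ) :
    AnalyticAt ℂ (fun x => (∏ i ∈ S, (X - C (u i x))).coeff k) 0 := by
  classical
  induction S using Finset.induction_on generalizing k with
  | empty => simp only [Finset.prod_empty]; exact analyticAt_const
  | insert a S ha ih =>
    simp only [Finset.prod_insert ha, sub_mul, coeff_sub, coeff_C_mul]
    refine AnalyticAt.sub ?_ ((hu a).mul (ih k))
    cases k with
    | zero => simp; exact analyticAt_const
    | succ k => simp only [coeff_X_mul]; exact ih k

theorem root_bound (p : ℂ[X]) (w : ℂ) (hp : p ≠ 0) (hw : p.eval w = 0) (K : ℝ)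
    (hK : ∀ k, ‖p.coeff k‖ ≤ K) : ‖p.leadingCoeff * w‖ ≤ 2 * K := by
  have h := IsRoot.norm_lt_cauchyBound hp hw
  have hl : 0 < ‖p.leadingCoeff‖ := norm_pos_iff.2 (leadingCoeff_ne_zero.2 hp)
  have h0 : 0 ≤ K := (norm_nonneg _).trans (hK 0)
  unfold cauchyBound at h
  have h1 : ((Finset.range p.natDegree).sup fun x => ‖p.coeff x‖₊ : NNReal) ≤ (⟨K, h0⟩ : NNReal) := by
    refine Finset.sup_le (fun i _ => ?_)
    exact hK i
  have h2 : (((Finset.range p.natDegree).sup fun x => ‖p.coeff x‖₊ : NNReal) : ℝ) ≤ K := h1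
  have h' : ‖w‖ < (((Finset.range p.natDegree).sup fun x => ‖p.coeff x‖₊ : NNReal) : ℝ)
      / ‖p.leadingCoeff‖ + 1 := by
    have := NNReal.coe_lt_coe.2 h
    push_cast at this
    exact this
  rw [norm_mul]
  calc ‖p.leadingCoeff‖ * ‖w‖ ≤ ‖p.leadingCoeff‖ * (K / ‖p.leadingCoeff‖ + 1) := by
        gcongr
        refine h'.le.trans ?_
        gcongr
    _ = K + ‖p.leadingCoeff‖ := by field_simp
    _ ≤ 2 * K := by have := hK p.natDegree; rw [coeff_natDegree] at this; linarith

theorem root_integral (p : ℂ[X]) (w : ℂ) (hw : p.eval w = 0)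
    (hp : ∀ k, IsIntegral ℤ (p.coeff k)) : IsIntegral ℤ (p.leadingCoeff * w) := by
  let A := integralClosure ℤ ℂ
  have h1 : p ∈ lifts (algebraMap A ℂ) := by
    rw [lifts_iff_coeff_lifts]
    intro k
    exact ⟨⟨p.coeff k, hp k⟩, rfl⟩
  obtain ⟨P, hP⟩ := h1
  rw [coe_mapRingHom] at hP
  have hinj : Function.Injective (algebraMap A ℂ) := Subtype.val_injective
  have h2 : IsIntegral A (P.leadingCoeff • w) := by
    apply isIntegral_leadingCoeff_smul
    rw [aeval_def, ← eval_map, hP, hw]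
  have h3 : p.leadingCoeff * w = P.leadingCoeff • w := by
    rw [← hP, leadingCoeff_map_of_injective hinj, Algebra.smul_def]
  rw [h3]
  exact isIntegral_trans _ h2

theorem common_denom {ι : Type} (s : Finset ι) (a : ι → ℂ) (ha : ∀ i ∈ s, IsAlgebraic ℚ (a i)) :
    ∃ m : ℕ, m ≠ 0 ∧ ∀ i ∈ s, IsIntegral ℤ ((m : ℂ) * a i) := by
  classical
  induction s using Finset.induction_on with
  | empty => exact ⟨1, one_ne_zero, by simp⟩
  | insert j s hj ih =>
    obtain ⟨m, hm, h⟩ := ih (fun i hi => ha i (Finset.mem_insert_of_mem hi))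
    have h1 : IsAlgebraic ℤ (a j) :=
      (IsFractionRing.isAlgebraic_iff ℤ ℚ ℂ).2 (ha j (Finset.mem_insert_self _ _))
    obtain ⟨y, hy, hyi⟩ := IsAlgebraic.exists_integral_multiple h1
    have hy2 : IsIntegral ℤ ((y.natAbs : ℂ) * a j) := by
      rw [zsmul_eq_mul] at hyi
      rcases Int.natAbs_eq y with e | e
      · rw [e] at hyi; simpa using hyi
      · rw [e] at hyi; simpa using hyi.neg
    have hnat : ∀ n : ℕ, IsIntegral ℤ (n : ℂ) := fun n => by
      simpa using isIntegral_algebraMap (R := ℤ) (A := ℂ) (x := (n : ℤ))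
    refine ⟨m * y.natAbs, mul_ne_zero hm (Int.natAbs_ne_zero.2 hy), ?_⟩
    intro i hi
    rcases Finset.mem_insert.1 hi with rfl | hi
    · push_cast
      rw [mul_assoc]; exact (hnat m).mul (by simpa using hy2)
    · have := (hnat y.natAbs).mul (h i hi)
      rw [← mul_assoc, mul_comm (y.natAbs : ℂ) (m : ℂ)] at this
      rw [Nat.cast_mul]
      exact this

/-- pigeonhole on blocks -/
theorem blocks {α : Type} [Finite α] (χ : ℕ → α) (m : ℕ) :
    ∃ (S : α) (o : Fin (m + 1) → ℕ) (𝒯 : Set ℕ), Function.Injective o ∧ 𝒯.Infinite ∧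
      ∀ T ∈ 𝒯, ∀ j, χ (T + o j) = S := by
  classical
  have := Fintype.ofFinite α
  let B := Fintype.card α * m + 1
  obtain ⟨π, hπ⟩ := Finite.exists_infinite_fiber (fun T : ℕ => fun j : Fin B => χ (T + j))
  have h1 : ∃ S ∈ (Finset.univ : Finset α), m < (Finset.univ.filter fun j : Fin B => π j = S).card := by
    apply Finset.exists_lt_card_fiber_of_mul_lt_card_of_maps_to
    · simp
    · simp [B]
  obtain ⟨S, -, hS⟩ := h1
  obtain ⟨t, ht, htc⟩ := Finset.exists_subset_card_eq (Nat.succ_le_of_lt hS)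
  let e := t.orderEmbOfFin htc
  refine ⟨S, fun j => (e j : ℕ), _, ?_, Set.infinite_coe_iff.1 hπ, ?_⟩
  · intro a b hab
    exact e.injective (Fin.ext hab)
  · intro T hT j
    have h2 := congrFun (hT : (fun j : Fin B => χ (T + j)) = π) (e j)
    have h3 := ht (t.orderEmbOfFin_mem htc j)
    rw [Finset.mem_filter] at h3
    exact h2.trans h3.2

end coeffs
end ConjugateDensity

namespace ConjugateDensity

open Filter Topology

section hit
open Polynomial

theorem sp_conj {K : Type} [Field K] (f : K →+* ℂ) (ρ : ℂ →+* ℂ) (q : K[X][X]) (x w : ℂ) :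
    ρ ((q.map (eval₂RingHom f x)).eval w) =
      (q.map (eval₂RingHom (ρ.comp f) (ρ x))).eval (ρ w) := by
  rw [eval_map, eval_map, hom_eval₂]
  congr 1
  refine ringHom_ext (fun a => ?_) ?_ <;> simp

theorem sp_conj1 {K : Type} [Field K] (f : K →+* ℂ) (ρ : ℂ →+* ℂ) (q : K[X]) (x : ℂ) :
    ρ (q.eval₂ f x) = q.eval₂ (ρ.comp f) (ρ x) := hom_eval₂ _ _ _ _

theorem int_val (L : Subfield ℂ) (q : L[X][X]) (hL : ∀ x ∈ L, IsAlgebraic ℚ x) :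
    ∃ (m0 : ℕ) (e : ℕ), m0 ≠ 0 ∧ ∀ t : ℕ, t ≠ 0 → ∀ k, IsIntegral ℤ
      ((m0 : ℂ) * (t : ℂ) ^ e * (q.coeff k).eval₂ L.subtype (t : ℂ)⁻¹) := by
  let e := (Finset.range (q.natDegree + 1)).sup fun k => (q.coeff k).natDegree
  have he : ∀ k, (q.coeff k).natDegree ≤ e := by
    intro k
    by_cases hk : k ∈ Finset.range (q.natDegree + 1)
    · exact Finset.le_sup (f := fun k => (q.coeff k).natDegree) hk
    · rw [coeff_eq_zero_of_natDegree_lt (by simpa using hk)]; simp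
  obtain ⟨m0, hm0, h⟩ := common_denom (Finset.range (q.natDegree + 1) ×ˢ Finset.range (e + 1))
    (fun kj => (((q.coeff kj.1).coeff kj.2 : L) : ℂ)) (fun kj _ => hL _ (SetLike.coe_mem _))
  refine ⟨m0, e, hm0, ?_⟩
  intro t ht k
  by_cases hk : k ∈ Finset.range (q.natDegree + 1)
  · rw [eval₂_eq_sum_range' _ (Nat.lt_succ_of_le (he k)), Finset.mul_sum]
    refine IsIntegral.sum _ (fun j hj => ?_)
    have h1 := h (k, j) (Finset.mem_product.2 ⟨hk, hj⟩)
    have h2 : IsIntegral ℤ ((t : ℂ) ^ (e - j)) := by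
      refine IsIntegral.pow ?_ _
      simpa using isIntegral_algebraMap (R := ℤ) (A := ℂ) (x := (t : ℤ))
    have h3 := h1.mul h2
    have hj' : j ≤ e := Nat.lt_succ_iff.1 (Finset.mem_range.1 hj)
    have ht' : (t : ℂ) ≠ 0 := Nat.cast_ne_zero.2 ht
    have : (m0 : ℂ) * (t : ℂ) ^ e * (L.subtype ((q.coeff k).coeff j) * (t : ℂ)⁻¹ ^ j) =
       (m0 : ℂ) * (((q.coeff k).coeff j : L) : ℂ) * (t : ℂ) ^ (e - j) := by
      rw [pow_sub₀ _ ht' hj', inv_pow, Subfield.subtype_apply]; ring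
    rw [this]; exact h3
  · rw [coeff_eq_zero_of_natDegree_lt (by simpa using hk)]; simp [isIntegral_zero]

theorem unif_bound (L : Subfield ℂ) (hL : FiniteDimensional ℚ L) (q : L[X][X]) :
    ∃ K : ℝ, 0 ≤ K ∧ ∀ (ρ : L →+* ℂ) (x : ℂ) (k : ℕ), ‖x‖ ≤ 1 → ‖(q.coeff k).eval₂ ρ x‖ ≤ K := by
  have : NumberField L := ⟨⟩
  have hfin : Finite (L →+* ℂ) := inferInstance
  have := Fintype.ofFinite (L →+* ℂ)
  refine ⟨∑ ρ : L →+* ℂ, ∑ k ∈ Finset.range (q.natDegree + 1),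
    ∑ j ∈ Finset.range ((q.coeff k).natDegree + 1), ‖ρ ((q.coeff k).coeff j)‖, by positivity, ?_⟩
  intro ρ x k hx
  by_cases hk : k ∈ Finset.range (q.natDegree + 1)
  · refine le_trans ?_ (Finset.single_le_sum (f := fun ρ : L →+* ℂ => ∑ k ∈ Finset.range (q.natDegree + 1),
      ∑ j ∈ Finset.range ((q.coeff k).natDegree + 1), ‖ρ ((q.coeff k).coeff j)‖)
      (fun _ _ => by positivity) (Finset.mem_univ ρ))
    refine le_trans ?_ (Finset.single_le_sum (f := fun k => 
      ∑ j ∈ Finset.range ((q.coeff k).natDegree + 1), ‖ρ ((q.coeff k).coeff j)‖)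
      (fun _ _ => by positivity) hk)
    rw [eval₂_eq_sum_range]
    refine (norm_sum_le _ _).trans (Finset.sum_le_sum fun j _ => ?_)
    rw [norm_mul, norm_pow]
    exact mul_le_of_le_one_right (norm_nonneg _) (pow_le_one₀ (norm_nonneg _) hx)
  · rw [coeff_eq_zero_of_natDegree_lt (by simpa using hk)]; simp; positivity

/-- The product over a Galois-stable set of roots is fixed. -/
theorem coeff_fixed {ι : Type} (S : Finset ι) (r : ι → ℂ) (hr : Set.InjOn r S) (ρ : ℂ →+* ℂ)
    (hρ : ∀ i ∈ S, ∃ j ∈ S, ρ (r i) = r j) (a : ℂ) (ha : ρ a = a) (k : ℕ) :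
    ρ ((∏ i ∈ S, (X - C (a * r i))).coeff k) = (∏ i ∈ S, (X - C (a * r i))).coeff k := by
  classical
  have h1 : (∏ i ∈ S, (X - C (a * r i))).map ρ = ∏ i ∈ S, (X - C (a * r i)) := by
    rw [Polynomial.map_prod]
    have e1 : ∀ i ∈ S, (X - C (a * r i)).map ρ = X - C (a * ρ (r i)) := by
      intro i _
      rw [Polynomial.map_sub, map_X, map_C, map_mul, ha]
    rw [Finset.prod_congr rfl e1]
    have e2 : (S.image r).image ρ = S.image r := by
      refine Finset.eq_of_subset_of_card_le ?_ ?_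
      · intro y hy
        simp only [Finset.mem_image] at hy ⊢
        obtain ⟨_, ⟨i, hi, rfl⟩, rfl⟩ := hy
        obtain ⟨j, hj, h⟩ := hρ i hi
        exact ⟨j, hj, h.symm⟩
      · rw [Finset.card_image_of_injective _ ρ.injective]
    have e3 : ∏ i ∈ S, (X - C (a * r i)) = ∏ y ∈ S.image r, (X - C (a * y)) := by
      rw [Finset.prod_image hr]
    rw [e3, ← e2, Finset.prod_image (fun _ _ _ _ h => ρ.injective h), Finset.prod_image hr]
  conv_rhs => rw [← h1]
  rw [coeff_map]

end hit
end ConjugateDensity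

namespace ConjugateDensity

open Filter Topology

section hit2
open Polynomial

theorem hit_coeff (L : Subfield ℂ) (hL : FiniteDimensional ℚ L) (q : L[X][X]) (m0 e : ℕ)
    (t : ℕ) (ht : t ≠ 0)
    (hinteg : ∀ k, IsIntegral ℤ
      ((m0 : ℂ) * (t : ℂ) ^ e * (q.coeff k).eval₂ L.subtype (t : ℂ)⁻¹))
    (K : ℝ) (hK0 : 0 ≤ K) 
    (hK : ∀ (ρ : L →+* ℂ) (x : ℂ) (k : ℕ), ‖x‖ ≤ 1 → ‖(q.coeff k).eval₂ ρ x‖ ≤ K)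
    (d : ℕ) (g : Fin d → ℂ) (ginj : Function.Injective g) (lc : ℂ) (hlc : lc ≠ 0)
    (hlc' : lc = q.leadingCoeff.eval₂ L.subtype (t : ℂ)⁻¹)
    (hfac : q.map (eval₂RingHom L.subtype (t : ℂ)⁻¹) = C lc * ∏ i, (X - C (g i)))
    (z0 : ℂ) (S : Finset (Fin d))
    (hS : ∀ i, i ∈ S ↔ ∃ ρ : ℂ →+* ℂ, (∀ y ∈ L, ρ y = y) ∧ ρ z0 = g i) (k : ℕ) :
    ∃ x : L, IsIntegral ℤ x ∧ (x : ℂ) = (t : ℂ) ^ (e * (S.card - k)) *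
        (∏ i ∈ S, (X - C (m0 * lc * g i))).coeff k ∧
      ∀ ρ : L →+* ℂ, ‖ρ x‖ ≤ (1 + m0 * (2 * K)) ^ S.card * (t : ℝ) ^ (e * (S.card - k)) := by
  have hLa := alg_of_fin L hL
  have htC : (t : ℂ) ≠ 0 := Nat.cast_ne_zero.2 ht
  have hroot : ∀ i, (q.map (eval₂RingHom L.subtype (t : ℂ)⁻¹)).eval (g i) = 0 := by
    intro i
    rw [hfac, eval_mul, eval_prod, Finset.prod_eq_zero (Finset.mem_univ i) (by simp), mul_zero]
  have hroot' : ∀ w, (q.map (eval₂RingHom L.subtype (t : ℂ)⁻¹)).eval w = 0 → ∃ i, w = g i := by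
    intro w hw
    rw [hfac, eval_mul, eval_C, eval_prod, mul_eq_zero, or_iff_right hlc, Finset.prod_eq_zero_iff] at hw
    obtain ⟨i, -, hi⟩ := hw
    exact ⟨i, by simpa [sub_eq_zero] using hi⟩
  have hlcL : lc ∈ L := by
    rw [hlc', eval₂_eq_sum_range]
    exact sum_mem fun j _ => mul_mem (SetLike.coe_mem _) (pow_mem (inv_mem (natCast_mem _ _)) _)
  set a : ℂ := (t : ℂ) ^ e * (m0 * lc) with ha
  have haL : a ∈ L := mul_mem (pow_mem (natCast_mem _ _) _) (mul_mem (natCast_mem _ _) hlcL)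
  have hscale : (t : ℂ) ^ (e * (S.card - k)) * (∏ i ∈ S, (X - C (m0 * lc * g i))).coeff k =
      (∏ i ∈ S, (X - C (a * g i))).coeff k := by
    rw [pow_mul, ← prodcoeff_scale]
    congr 1
    refine Finset.prod_congr rfl (fun i _ => ?_)
    rw [ha]; ring_nf
  rw [hscale]
  have hvint : ∀ i, IsIntegral ℤ (a * g i) := by
    intro i
    have h1 : (C ((m0 : ℂ) * (t : ℂ) ^ e) * q.map (eval₂RingHom L.subtype (t : ℂ)⁻¹)).leadingCoeff =
        a := by
      rw [leadingCoeff_mul, leadingCoeff_C, hfac, leadingCoeff_mul, leadingCoeff_C,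
        (monic_prod_X_sub_C _ _).leadingCoeff]
      rw [ha]; ring
    rw [← h1]
    apply root_integral
    · rw [eval_mul, hroot, mul_zero]
    · intro k
      rw [coeff_C_mul, coeff_map]
      exact hinteg k
  have hψint : IsIntegral ℤ ((∏ i ∈ S, (X - C (a * g i))).coeff k) :=
    prodcoeff_mem (integralClosure ℤ ℂ).toSubring S _ (fun i _ => hvint i) k
  have hψL : (∏ i ∈ S, (X - C (a * g i))).coeff k ∈ L := by
    refine mem_of_fixed L hLa _ ?_ ?_
    · exact (IsFractionRing.isAlgebraic_iff ℤ ℚ ℂ).1 hψint.isAlgebraic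
    · intro ρ hρ
      refine coeff_fixed S g ginj.injOn ρ ?_ a (hρ a haL) k
      intro i hi
      obtain ⟨ρ', hρ', hz⟩ := (hS i).1 hi
      have h1 := sp_conj L.subtype ρ q (t : ℂ)⁻¹ (g i)
      have e1 : ρ.comp L.subtype = L.subtype := RingHom.ext fun y => hρ y y.2
      rw [hroot, map_zero, e1, map_inv₀, map_natCast] at h1
      obtain ⟨j, hj⟩ := hroot' _ h1.symm
      refine ⟨j, (hS j).2 ⟨ρ.comp ρ', ?_, ?_⟩, hj⟩
      · intro y hy
        rw [RingHom.comp_apply, hρ' y hy, hρ y hy]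
      · rw [RingHom.comp_apply, hz, hj]
  refine ⟨⟨_, hψL⟩, ?_, rfl, ?_⟩
  · refine (isIntegral_algHom_iff (R := ℤ) (A := L) (B := ℂ) (L.subtype.toIntAlgHom) L.subtype.injective).1 ?_
    exact hψint
  · intro ρ
    obtain ⟨τ, hτ⟩ := ext_hom L hLa ρ
    have e1 : τ.comp L.subtype = ρ := RingHom.ext fun y => hτ y
    rw [← hτ]
    have e2 : τ ((∏ i ∈ S, (X - C (a * g i))).coeff k) = (t : ℂ) ^ (e * (S.card - k)) *
        (∏ i ∈ S, (X - C (m0 * (τ lc * τ (g i))))).coeff k := by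
      rw [pow_mul, ← prodcoeff_scale, ← coeff_map, Polynomial.map_prod]
      congr 1
      refine Finset.prod_congr rfl (fun i _ => ?_)
      rw [Polynomial.map_sub, map_X, map_C, ha]
      simp only [map_mul, map_pow, map_natCast]
      ring_nf
    have e3 := prodcoeff_bound S (fun i => (m0 : ℂ) * (τ lc * τ (g i))) (m0 * (2 * K)) (by positivity) ?_ k
    · change ‖τ ((∏ i ∈ S, (X - C (a * g i))).coeff k)‖ ≤ _
      rw [e2, norm_mul, norm_pow, Complex.norm_natCast, mul_comm]
      gcongr
    · intro i _
      rw [norm_mul, Complex.norm_natCast]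
      gcongr
      have h1 := sp_conj L.subtype τ q (t : ℂ)⁻¹ (g i)
      rw [hroot, map_zero, e1, map_inv₀, map_natCast] at h1
      have h2 : eval₂RingHom ρ (t : ℂ)⁻¹ q.leadingCoeff = τ lc := by
        rw [hlc', sp_conj1, e1, map_inv₀, map_natCast]; rfl
      have h3 : τ lc ≠ 0 := by simpa using hlc
      have h4 := leadingCoeff_map_of_leadingCoeff_ne_zero (p := q) (eval₂RingHom ρ (t : ℂ)⁻¹) (by rwa [h2])
      rw [h2] at h4
      rw [← h4]
      refine root_bound _ _ ?_ h1.symm K ?_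
      · intro h5; rw [h5, leadingCoeff_zero] at h4; exact h3 h4.symm
      · intro k
        rw [coeff_map]
        refine hK ρ _ k ?_
        rw [norm_inv, Complex.norm_natCast]
        exact inv_le_one_of_one_le₀ (by exact_mod_cast Nat.one_le_iff_ne_zero.2 ht)

theorem hit0 (L : Subfield ℂ) (hL : FiniteDimensional ℚ L) (q A B : L[X][X]) (D : L[X])
    (hAB : A * q + B * derivative q = C D) (hD : D.eval₂ L.subtype 0 ≠ 0)
    (hlc : q.leadingCoeff.eval₂ L.subtype 0 ≠ 0) (z : ℂ → ℂ)
    (hq : ∀ᶠ x in 𝓝 (0 : ℂ), (q.map (eval₂RingHom L.subtype x)).eval (z x) = 0) :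
    ∃ᶠ t : ℕ in atTop, ∃ M : L[X][X],
      (∃ᶠ x in 𝓝[≠] (0 : ℂ), (M.map (eval₂RingHom L.subtype x)).eval (z x) = 0) ∧
      M.map (eval₂RingHom L.subtype (t : ℂ)⁻¹) ≠ 0 ∧
      ∀ w, (M.map (eval₂RingHom L.subtype (t : ℂ)⁻¹)).eval w = 0 →
        ∃ ρ : ℂ →+* ℂ, (∀ y ∈ L, ρ y = y) ∧ ρ (z (t : ℂ)⁻¹) = w := by
  classical
  let ι := L.subtype
  let μ : L[X] →+* ℂ[X] := mapRingHom ι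
  have hμ : ∀ x, (evalRingHom x).comp μ = eval₂RingHom ι x := by
    intro x
    refine ringHom_ext (fun a => ?_) ?_ <;> simp [μ]
  have hμinj : Function.Injective μ := map_injective _ ι.injective
  have hlead : (q.map μ).leadingCoeff = μ q.leadingCoeff := leadingCoeff_map_of_injective hμinj _
  have hμe : ∀ (c : L[X]) x, (μ c).eval x = c.eval₂ ι x := fun c x => by
    simp [μ, eval_map]
  obtain ⟨g, hg, hgev⟩ := branches (q.map μ) (A.map μ) (B.map μ) (μ D)
    (by rw [derivative_map, ← Polynomial.map_mul, ← Polynomial.map_mul, ← Polynomial.map_add, hAB,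
      map_C])
    (by rw [hμe]; exact hD) (by rw [hlead, hμe]; exact hlc)
  simp only [Polynomial.map_map, hμ, hlead, hμe] at hgev
  generalize (q.map μ).natDegree = d at g hg hgev
  set lc : ℂ → ℂ := fun x => q.leadingCoeff.eval₂ ι x with hlcdef
  have hlcan : AnalyticAt ℂ lc 0 := by
    have : lc = fun x => aeval x (μ q.leadingCoeff) := by
      funext x; rw [coe_aeval_eq_eval, hμe]
    rw [this]
    exact AnalyticAt.aeval_polynomial analyticAt_id _
  obtain ⟨m0, e, hm0, hinteg⟩ := int_val L q (alg_of_fin L hL)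
  obtain ⟨K, hK0, hK⟩ := unif_bound L hL q
  have htend : Tendsto (fun t : ℕ => (t : ℂ)⁻¹) atTop (𝓝[≠] 0) := by
    rw [tendsto_nhdsWithin_iff]
    refine ⟨tendsto_inv_atTop_nhds_zero_nat (𝕜 := ℂ), ?_⟩
    filter_upwards [eventually_ne_atTop 0] with t ht
    simpa using ht
  have htend0 := htend.mono_right nhdsWithin_le_nhds
  obtain ⟨N0, hN0⟩ := eventually_atTop.1 ((htend0.eventually (hgev.and hq)).and (eventually_ne_atTop 0))
  let χ : ℕ → Finset (Fin d) := fun t => Finset.univ.filter fun i =>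
    ∃ ρ : ℂ →+* ℂ, (∀ y ∈ L, ρ y = y) ∧ ρ (z (t : ℂ)⁻¹) = g i (t : ℂ)⁻¹
  set m := e * d * Module.finrank ℚ L + e * d + 1 with hm
  obtain ⟨S, o, 𝒯0, ho, h𝒯0, hχ⟩ := blocks χ m
  have hScard : S.card ≤ d := by simpa using S.card_le_univ
  let 𝒯 : Set ℕ := 𝒯0 \ Set.Iio N0
  have h𝒯 : 𝒯.Infinite := h𝒯0.sdiff (Set.finite_Iio N0)
  let u : Fin d → ℂ → ℂ := fun i x => m0 * lc x * g i x
  have hu : ∀ i, AnalyticAt ℂ (u i) 0 := fun i => (analyticAt_const.mul hlcan).mul (hg i)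
  have hdorge : ∀ k, ∃ Q : Polynomial L, Q.natDegree ≤ e * (S.card - k) ∧
      ∀ᶠ z in 𝓝 (0 : ℂ), z ≠ 0 → (∏ i ∈ S, (X - C (u i z))).coeff k =
        z ^ (e * (S.card - k)) * Q.eval₂ L.subtype z⁻¹ := by
    intro k
    have hE : e * (S.card - k) ≤ e * d := Nat.mul_le_mul_left _ ((Nat.sub_le _ _).trans hScard)
    refine dorge L hL _ m ?_ (fun x => (∏ i ∈ S, (X - C (u i x))).coeff k)
      (prodcoeff_analytic S u hu k) ((1 + m0 * (2 * K)) ^ S.card) o ho 𝒯 h𝒯 ?_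
    · rw [hm]; gcongr
    · intro T hT j
      have hTN : N0 ≤ T := by simpa using hT.2
      obtain ⟨⟨⟨h1, h2, h3⟩, h4⟩, h5⟩ := hN0 (T + o j) (by omega)
      refine hit_coeff L hL q m0 e (T + o j) h5 (hinteg _ h5) K hK0 hK d
        (fun i => g i ((T + o j : ℕ) : ℂ)⁻¹) h2 (lc ((T + o j : ℕ) : ℂ)⁻¹) h1 rfl h3 
        (z ((T + o j : ℕ) : ℂ)⁻¹) S ?_ k
      intro i
      rw [← hχ T hT.1 j]
      simp [χ]
  choose Q hQd hQ using hdorge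
  let M0 : L[X][X] := ∑ k ∈ Finset.range (S.card + 1), C ((Q k).reflect (e * (S.card - k))) * X ^ k
  let M : L[X][X] := M0.comp (C (C (m0 : L) * q.leadingCoeff) * X)
  have hM : ∀ᶠ x in 𝓝[≠] (0 : ℂ), ∀ w, (M.map (eval₂RingHom ι x)).eval w =
      ∏ i ∈ S, (m0 * lc x * (w - g i x)) := by
    have h1 : ∀ᶠ x in 𝓝 (0 : ℂ), ∀ k ∈ Finset.range (S.card + 1), x ≠ 0 →
      (∏ i ∈ S, (X - C (u i x))).coeff k =
        x ^ (e * (S.card - k)) * (Q k).eval₂ L.subtype x⁻¹ := by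
      rw [Filter.eventually_all_finset]
      intro k _; exact hQ k
    filter_upwards [h1.filter_mono nhdsWithin_le_nhds, self_mem_nhdsWithin] with x hx hx0 w
    have hx0 : x ≠ 0 := hx0
    have e1 : M0.map (eval₂RingHom ι x) = ∏ i ∈ S, (X - C (u i x)) := by
      have hnd : (∏ i ∈ S, (X - C (u i x))).natDegree < S.card + 1 := by
        rw [natDegree_prod_of_monic _ _ (fun i _ => monic_X_sub_C _)]; simp
      rw [Polynomial.as_sum_range' (∏ i ∈ S, (X - C (u i x))) _ hnd, Polynomial.map_sum]
      refine Finset.sum_congr rfl (fun k hk => ?_)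
      rw [Polynomial.map_mul, map_C, Polynomial.map_pow, map_X, hx k hk hx0, C_mul_X_pow_eq_monomial]
      congr 1
      have hinv : Invertible (x⁻¹) := invertibleOfNonzero (inv_ne_zero hx0)
      have h2 := eval₂_reflect_mul_pow ι x⁻¹ _ _ (hQd k)
      rw [invOf_eq_inv, inv_inv] at h2
      change eval₂ ι x _ = x ^ _ * eval₂ ι x⁻¹ _
      rw [← h2, mul_left_comm, ← mul_pow, mul_inv_cancel₀ hx0, one_pow, mul_one]
    rw [Polynomial.map_comp, eval_comp, e1, eval_prod]
    refine Finset.prod_congr rfl (fun i _ => ?_)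
    simp only [Polynomial.map_mul, map_C, map_X, eval_mul, eval_C, eval_X, eval_sub, u]
    have : eval₂RingHom ι x (C (m0 : L) * q.leadingCoeff) = m0 * lc x := by
      rw [map_mul]; simp [hlcdef]
    rw [this]; ring
  obtain ⟨N1, hN1⟩ := eventually_atTop.1 (htend.eventually hM)
  have hfreq : ∃ᶠ t : ℕ in atTop, N0 ≤ t ∧ N1 ≤ t ∧ χ t = S := by
    rw [frequently_atTop]
    intro a
    obtain ⟨T, hT, hTa⟩ := h𝒯0.exists_gt (a + N0 + N1)
    exact ⟨T + o 0, by omega, by omega, by omega, hχ T hT 0⟩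
  have hMz : ∀ t : ℕ, N0 ≤ t ∧ N1 ≤ t ∧ χ t = S →
      (M.map (eval₂RingHom ι (t : ℂ)⁻¹)).eval (z (t : ℂ)⁻¹) = 0 := by
    rintro t ⟨ht0, ht1, htS⟩
    rw [hN1 t ht1]
    obtain ⟨⟨⟨h1, h2, h3⟩, h4⟩, h5⟩ := hN0 t ht0
    rw [h3, eval_mul, eval_C, eval_prod, mul_eq_zero, or_iff_right h1, Finset.prod_eq_zero_iff] at h4
    obtain ⟨i, -, hi⟩ := h4
    have hi' : z (t : ℂ)⁻¹ = g i (t : ℂ)⁻¹ := by simpa [sub_eq_zero] using hi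
    have hiS : i ∈ S := by
      rw [← htS]
      simp only [χ, Finset.mem_filter, Finset.mem_univ, true_and]
      exact ⟨RingHom.id ℂ, fun _ _ => rfl, hi'⟩
    refine Finset.prod_eq_zero hiS ?_
    rw [hi', sub_self, mul_zero]
  refine hfreq.mono ?_
  rintro t ⟨ht0, ht1, htS⟩
  obtain ⟨⟨⟨h1, h2, h3⟩, h4⟩, h5⟩ := hN0 t ht0
  have hr : ∀ w, (M.map (eval₂RingHom ι (t : ℂ)⁻¹)).eval w = 0 → ∃ i ∈ S, w = g i (t : ℂ)⁻¹ := by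
    intro w hw
    rw [hN1 t ht1, Finset.prod_eq_zero_iff] at hw
    obtain ⟨i, hi, hw⟩ := hw
    refine ⟨i, hi, ?_⟩
    have : (m0 : ℂ) * lc (t : ℂ)⁻¹ ≠ 0 := mul_ne_zero (Nat.cast_ne_zero.2 hm0) h1
    rw [mul_eq_zero, or_iff_right this, sub_eq_zero] at hw
    exact hw
  refine ⟨M, htend.frequently (hfreq.mono hMz), ?_, ?_⟩
  · intro h0
    obtain ⟨w, hw⟩ := Infinite.exists_notMem_finset (S.image fun i => g i (t : ℂ)⁻¹)
    obtain ⟨i, hi, hiw⟩ := hr w (by rw [h0, eval_zero])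
    exact hw (Finset.mem_image.2 ⟨i, hi, hiw.symm⟩)
  · intro w hw
    obtain ⟨i, hi, rfl⟩ := hr w hw
    rw [← htS] at hi
    simpa [χ] using hi

end hit2
end ConjugateDensity

namespace ConjugateDensity

open Filter Topology

section curvelemma

theorem hit (L : Subfield ℂ) (hL : FiniteDimensional ℚ L) (q A B : Polynomial (Polynomial L))
    (D : Polynomial L) (s0 : L)
    (hAB : A * q + B * Polynomial.derivative q = Polynomial.C D)
    (hD : D.eval₂ L.subtype (s0 : ℂ) ≠ 0)
    (hlc : q.leadingCoeff.eval₂ L.subtype (s0 : ℂ) ≠ 0) (z : ℂ → ℂ)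
    (hq : ∀ᶠ x in 𝓝 (s0 : ℂ), (q.map (Polynomial.eval₂RingHom L.subtype x)).eval (z x) = 0) :
    ∃ᶠ t : ℕ in atTop, ∃ M : Polynomial (Polynomial L),
      (∃ᶠ x in 𝓝[≠] (s0 : ℂ), (M.map (Polynomial.eval₂RingHom L.subtype x)).eval (z x) = 0) ∧
      M.map (Polynomial.eval₂RingHom L.subtype (s0 + (t : ℂ)⁻¹)) ≠ 0 ∧
      ∀ w, (M.map (Polynomial.eval₂RingHom L.subtype (s0 + (t : ℂ)⁻¹))).eval w = 0 →
        ∃ ρ : ℂ →+* ℂ, (∀ y ∈ L, ρ y = y) ∧ ρ (z (s0 + (t : ℂ)⁻¹)) = w := by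
  let κ : Polynomial L →+* Polynomial L := Polynomial.compRingHom (Polynomial.X + Polynomial.C s0)
  let κ' : Polynomial L →+* Polynomial L := Polynomial.compRingHom (Polynomial.X - Polynomial.C s0)
  have hκ : ∀ x, (Polynomial.eval₂RingHom L.subtype x).comp κ =
      Polynomial.eval₂RingHom L.subtype (s0 + x) := by
    intro x
    refine Polynomial.ringHom_ext (fun a => ?_) ?_ <;> simp [κ, add_comm]
  have hκ' : ∀ x, (Polynomial.eval₂RingHom L.subtype x).comp κ' =
      Polynomial.eval₂RingHom L.subtype (x - s0) := by
    intro x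
    refine Polynomial.ringHom_ext (fun a => ?_) ?_ <;> simp [κ']
  have hκe : ∀ c : Polynomial L, (κ c).eval₂ L.subtype 0 = c.eval₂ L.subtype (s0 : ℂ) := by
    intro c
    have := DFunLike.congr_fun (hκ 0) c
    simpa using this
  have hκinj : Function.Injective κ := by
    have : κ'.comp κ = RingHom.id _ := by
      refine Polynomial.ringHom_ext (fun a => ?_) ?_ <;> simp [κ, κ']
    intro a b hab
    have h2 := congrArg κ' hab
    have h3 : ∀ c, κ' (κ c) = c := fun c => DFunLike.congr_fun this c
    rwa [h3, h3] at h2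
  have h0 := hit0 L hL (q.map κ) (A.map κ) (B.map κ) (κ D)
    (by rw [Polynomial.derivative_map, ← Polynomial.map_mul, ← Polynomial.map_mul,
      ← Polynomial.map_add, hAB, Polynomial.map_C])
    (by rw [hκe]; exact hD)
    (by rw [Polynomial.leadingCoeff_map_of_injective hκinj, hκe]; exact hlc)
    (fun x => z (s0 + x))
    (by
      have ht : Tendsto (fun x : ℂ => (s0 : ℂ) + x) (𝓝 0) (𝓝 (s0 : ℂ)) := by
        have : Continuous (fun x : ℂ => (s0 : ℂ) + x) := by fun_prop
        simpa using this.tendsto 0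
      filter_upwards [ht.eventually hq] with x hx
      rw [Polynomial.map_map, hκ]; exact hx)
  refine h0.mono ?_
  rintro t ⟨M, h1, h2, h3⟩
  have e : ∀ x, (M.map κ').map (Polynomial.eval₂RingHom L.subtype (s0 + x)) =
      M.map (Polynomial.eval₂RingHom L.subtype x) := by
    intro x
    rw [Polynomial.map_map, hκ', add_sub_cancel_left]
  refine ⟨M.map κ', ?_, ?_, ?_⟩
  · have ht : Tendsto (fun x : ℂ => (s0 : ℂ) + x) (𝓝[≠] 0) (𝓝[≠] (s0 : ℂ)) := by
      rw [tendsto_nhdsWithin_iff]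
      constructor
      · have : Continuous (fun x : ℂ => (s0 : ℂ) + x) := by fun_prop
        simpa using (this.tendsto 0).mono_left nhdsWithin_le_nhds
      · filter_upwards [self_mem_nhdsWithin] with x hx
        simpa using hx
    refine ht.frequently (h1.mono ?_)
    intro x hx
    rw [e]; exact hx
  · rw [e]; exact h2
  · intro w hw
    rw [e] at hw
    exact h3 w hw

theorem root_lift (τ : ℂ →+* ℂ) (p : Polynomial ℂ) (hp : p ≠ 0) (x : ℂ) (h : (p.map τ).eval x = 0) :
    ∃ w, p.eval w = 0 ∧ τ w = x := by
  have h1 : x ∈ (p.map τ).roots := by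
    rw [Polynomial.mem_roots ((Polynomial.map_ne_zero_iff τ.injective).2 hp)]; exact h
  rw [(IsAlgClosed.splits p).roots_map, Multiset.mem_map] at h1
  obtain ⟨w, hw, hx⟩ := h1
  exact ⟨w, (Polynomial.mem_roots hp).1 hw, hx⟩

theorem alg_root (p : Polynomial ℂ) (hp : p ≠ 0) (hc : ∀ k, IsAlgebraic ℚ (p.coeff k)) (w : ℂ)
    (h : p.eval w = 0) : IsAlgebraic ℚ w := by
  have h1 : p ∈ Polynomial.lifts (algebraMap (algebraicClosure ℚ ℂ) ℂ) := by
    rw [Polynomial.lifts_iff_coeff_lifts]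
    intro k
    exact ⟨⟨p.coeff k, (mem_algebraicClosure_iff).2 (hc k)⟩, rfl⟩
  obtain ⟨P, hP⟩ := h1
  rw [Polynomial.coe_mapRingHom] at hP
  have h2 : IsAlgebraic (algebraicClosure ℚ ℂ) w := by
    refine ⟨P, ?_, ?_⟩
    · rintro rfl; simp at hP; exact hp hP.symm
    · rw [Polynomial.aeval_def, ← Polynomial.eval_map, hP, h]
  have : Algebra.IsAlgebraic ℚ (algebraicClosure ℚ ℂ) := algebraicClosure.isAlgebraic ℚ ℂ
  exact h2.restrictScalars ℚ

theorem alg_eval1 (L : Subfield ℂ) (hL : ∀ x ∈ L, IsAlgebraic ℚ x) (c : Polynomial L) (s : ℂ)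
    (hs : IsAlgebraic ℚ s) : IsAlgebraic ℚ (c.eval₂ L.subtype s) := by
  have h1 : ∀ x ∈ L, x ∈ algebraicClosure ℚ ℂ := fun x hx => mem_algebraicClosure_iff.2 (hL x hx)
  rw [← mem_algebraicClosure_iff (F := ℚ) (E := ℂ)] at hs ⊢
  rw [Polynomial.eval₂_eq_sum_range]
  exact sum_mem fun j _ => mul_mem (h1 _ (SetLike.coe_mem _)) (pow_mem hs _)

theorem alg_eval2 (L : Subfield ℂ) (hL : ∀ x ∈ L, IsAlgebraic ℚ x) (q : Polynomial (Polynomial L))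
    (s : ℂ) (hs : IsAlgebraic ℚ s) (w : ℂ) (hw : IsAlgebraic ℚ w) :
    IsAlgebraic ℚ ((q.map (Polynomial.eval₂RingHom L.subtype s)).eval w) := by
  have h1 : ∀ k, (q.map (Polynomial.eval₂RingHom L.subtype s)).coeff k ∈ algebraicClosure ℚ ℂ := by
    intro k
    rw [Polynomial.coeff_map]
    exact mem_algebraicClosure_iff.2 (alg_eval1 L hL _ s hs)
  rw [← mem_algebraicClosure_iff (F := ℚ) (E := ℂ)] at hw ⊢
  rw [Polynomial.eval_eq_sum_range]
  exact sum_mem fun j _ => mul_mem (h1 _) (pow_mem hw _)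

theorem rat_avoid (F : Polynomial ℂ) (hF : F ≠ 0) (δ : ℝ) (hδ : 0 < δ) :
    ∃ s : ℚ, |(s : ℝ) - 1| < δ ∧ F.eval (s : ℂ) ≠ 0 := by
  by_contra hcon
  push Not at hcon
  refine hF (Polynomial.eq_zero_of_infinite_isRoot F ?_)
  obtain ⟨r, hr0, hr1⟩ := exists_rat_btwn hδ
  have hr0' : 0 < r := by exact_mod_cast hr0
  have : Set.Infinite (Set.Ioo (1 : ℚ) (1 + r)) := Set.Ioo_infinite (by linarith)
  refine (this.image (f := fun s : ℚ => (s : ℂ)) ?_).mono ?_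
  · intro a _ b _ hab
    exact Rat.cast_injective hab
  · rintro _ ⟨s, hs, rfl⟩
    refine hcon s ?_
    have h3 : (s : ℝ) < 1 + (r : ℝ) := by exact_mod_cast hs.2
    have h4 : (1 : ℝ) < s := by exact_mod_cast hs.1
    rw [abs_of_pos (by linarith)]; linarith

open MvPolynomial in
theorem curve_lemma (L : Subfield ℂ) (hL : FiniteDimensional ℚ L) (τ : ℂ →+* ℂ) {N : ℕ}
    {Φ : Fin N → MvPolynomial (Fin N) L}
    {p b : Fin N → L} {R : ℝ} {y y' : ℂ → Fin N → ℂ} (h : Curve L.subtype Φ p b R y)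
    (h' : Curve (τ.comp L.subtype) Φ p b R y') (a : Fin N → L) (ha : ∀ i, y 0 i = a i)
    (ha' : ∀ i, y' 0 i = τ (a i)) (hR : 1 < R) (i0 : Fin N) (hb : b i0 ≠ 0) (δ : ℝ) (hδ : 0 < δ) :
    ∃ s : ℚ, |(s : ℝ) - 1| < δ ∧ (∀ j, IsAlgebraic ℚ (y s j)) ∧
      ∃ τ' : ℂ →+* ℂ, (∀ x ∈ L, τ' x = τ x) ∧ ∀ j, τ' (y s j) = y' s j := by
  have hR0 : 0 < R := by linarith
  have hLa := alg_of_fin L hL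
  obtain ⟨G, hG, q, A, B, D, hD, hAB, hq⟩ := h.primitive hR0 i0 hb
  choose c Q hc hQ using hG
  set S := parPoly Φ p b i0 with hSdef
  have hS : ∀ s ∈ Metric.ball (0 : ℂ) R, eval₂ L.subtype (y s) S = s :=
    fun s hs => h.parPoly_eq i0 hb s hs
  have hS' : ∀ s ∈ Metric.ball (0 : ℂ) R, eval₂ (τ.comp L.subtype) (y' s) S = s :=
    fun s hs => h'.parPoly_eq i0 hb s hs
  let z : ℂ → ℂ := fun s => eval₂ L.subtype (y s) G
  let z' : ℂ → ℂ := fun s => eval₂ (τ.comp L.subtype) (y' s) G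
  have ev : ∀ (M : Polynomial (Polynomial L)), ∀ s ∈ Metric.ball (0 : ℂ) R,
      eval₂ L.subtype (y s) (M.eval₂ (Polynomial.aeval (R := L) S).toRingHom G) =
      (M.map (Polynomial.eval₂RingHom L.subtype s)).eval (z s) := by
    intro M s hs
    rw [eval_bi, hS s hs, Polynomial.eval_map]
  have ev' : ∀ (M : Polynomial (Polynomial L)), ∀ s ∈ Metric.ball (0 : ℂ) R,
      eval₂ (τ.comp L.subtype) (y' s) (M.eval₂ (Polynomial.aeval (R := L) S).toRingHom G) =
      (M.map (Polynomial.eval₂RingHom (τ.comp L.subtype) s)).eval (z' s) := by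
    intro M s hs
    rw [eval_bi, hS' s hs, Polynomial.eval_map]
  have hq0 : q ≠ 0 := by
    rintro rfl
    apply hD
    have : Polynomial.C D = 0 := by rw [← hAB]; simp
    simpa using this
  -- choose the base point
  let F : Polynomial L := D * q.leadingCoeff * ∏ j, c j
  have hF : F ≠ 0 := mul_ne_zero (mul_ne_zero hD (Polynomial.leadingCoeff_ne_zero.2 hq0))
    (Finset.prod_ne_zero_iff.2 fun j _ => hc j)
  have hδ' : 0 < min δ (R - 1) / 2 := by
    have : 0 < min δ (R - 1) := lt_min hδ (by linarith)
    linarith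
  obtain ⟨s0, hs0, hFs⟩ := rat_avoid (F.map L.subtype)
    ((Polynomial.map_ne_zero_iff L.subtype.injective).2 hF) _ hδ'
  rw [Polynomial.eval_map] at hFs
  have hFs2 := hFs
  simp only [F, Polynomial.eval₂_mul, Polynomial.eval₂_finsetProd] at hFs2
  have hDs : D.eval₂ L.subtype (s0 : ℂ) ≠ 0 := left_ne_zero_of_mul (left_ne_zero_of_mul hFs2)
  have hls : q.leadingCoeff.eval₂ L.subtype (s0 : ℂ) ≠ 0 :=
    right_ne_zero_of_mul (left_ne_zero_of_mul hFs2)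
  have hball : ∀ s : ℚ, |(s : ℝ) - 1| < R - 1 → (s : ℂ) ∈ Metric.ball (0 : ℂ) R := by
    intro s hs
    rw [mem_ball_zero_iff, Complex.norm_ratCast]
    have := abs_lt.1 hs
    rw [abs_lt]; constructor <;> linarith
  have hmin : min δ (R - 1) / 2 < R - 1 := by
    have := min_le_right δ (R - 1)
    linarith
  have hs0b := hball s0 (hs0.trans hmin)
  have hcast : (((s0 : L) : L) : ℂ) = (s0 : ℂ) := by simp
  have hit1 := hit L hL q A B D (s0 : L) hAB (by simpa using hDs) (by simpa using hls) z (by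
    filter_upwards [Metric.isOpen_ball.mem_nhds (show (((s0 : L) : L) : ℂ) ∈ Metric.ball (0 : ℂ) R by
      rw [hcast]; exact hs0b)] with s hs
    rw [← ev q s hs]; exact hq s hs)
  rw [hcast] at hit1
  have htend : Tendsto (fun t : ℕ => (t : ℂ)⁻¹) atTop (𝓝 0) := 
    tendsto_inv_atTop_nhds_zero_nat (𝕜 := ℂ)
  have ev1 : ∀ᶠ t : ℕ in atTop, F.eval₂ L.subtype ((s0 : ℂ) + (t : ℂ)⁻¹) ≠ 0 := by
    have h1 : Tendsto (fun t : ℕ => (s0 : ℂ) + (t : ℂ)⁻¹) atTop (𝓝 (s0 : ℂ)) := by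
      simpa using htend.const_add (s0 : ℂ)
    have h2 : ContinuousAt (fun x => (F.map L.subtype).eval x) (s0 : ℂ) :=
      (F.map L.subtype).continuous.continuousAt
    have h3 := h1.eventually (h2.eventually_ne (by rw [Polynomial.eval_map]; exact hFs))
    filter_upwards [h3] with t ht
    rwa [Polynomial.eval_map] at ht
  have ev2 : ∀ᶠ t : ℕ in atTop, (t : ℝ)⁻¹ < min δ (R - 1) / 2 :=
    (tendsto_inv_atTop_nhds_zero_nat (𝕜 := ℝ)).eventually_lt_const hδ'
  obtain ⟨t, ⟨M, hM1, hM2, hM3⟩, hFt, htδ⟩ := (hit1.and_eventually (ev1.and ev2)).exists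
  let s : ℚ := s0 + (t : ℚ)⁻¹
  have hsC : (s : ℂ) = (s0 : ℂ) + (t : ℂ)⁻¹ := by simp [s]
  rw [← hsC] at hM2 hM3 hFt
  have hsδ : |(s : ℝ) - 1| < min δ (R - 1) := by
    have e1 : (s : ℝ) - 1 = ((s0 : ℝ) - 1) + (t : ℝ)⁻¹ := by simp [s]; ring
    rw [e1]
    refine (abs_add_le _ _).trans_lt ?_
    rw [abs_of_nonneg (by positivity : (0 : ℝ) ≤ (t : ℝ)⁻¹)]
    linarith
  have hsb : (s : ℂ) ∈ Metric.ball (0 : ℂ) R := hball s (hsδ.trans_le (min_le_right _ _))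
  have hsalg : IsAlgebraic ℚ (s : ℂ) := by
    simpa using isAlgebraic_algebraMap (A := ℂ) s
  have hcs : ∀ j, (c j).eval₂ L.subtype (s : ℂ) ≠ 0 := by
    simp only [F, Polynomial.eval₂_mul, Polynomial.eval₂_finsetProd] at hFt
    intro j
    exact Finset.prod_ne_zero_iff.1 (right_ne_zero_of_mul hFt) j (Finset.mem_univ j)
  -- the relation for the conjugate curve
  have hfreq : ∃ᶠ x in 𝓝[≠] (s0 : ℂ), eval₂ L.subtype (y x)
      (M.eval₂ (Polynomial.aeval (R := L) S).toRingHom G) = 0 := by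
    have e1 : ∀ᶠ x in 𝓝[≠] (s0 : ℂ), x ∈ Metric.ball (0 : ℂ) R :=
      nhdsWithin_le_nhds (Metric.isOpen_ball.mem_nhds hs0b)
    refine (hM1.and_eventually e1).mono ?_
    rintro x ⟨hx, hxb⟩
    rw [ev M x hxb]; exact hx
  have hz0 : (M.map (Polynomial.eval₂RingHom L.subtype (s : ℂ))).eval (z s) = 0 := by
    rw [← ev M s hsb]; exact h.zero_on _ (s0 : ℂ) hs0b hfreq s hsb
  have hz'0 : (M.map (Polynomial.eval₂RingHom (τ.comp L.subtype) (s : ℂ))).eval (z' s) = 0 := by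
    rw [← ev' M s hsb]; exact transfer h h' a ha ha' _ (s0 : ℂ) hs0b hfreq s hsb
  have hτs : ∀ τ : ℂ →+* ℂ, τ (s : ℂ) = s := fun τ => map_ratCast τ s
  have hmap : M.map (Polynomial.eval₂RingHom (τ.comp L.subtype) (s : ℂ)) =
      (M.map (Polynomial.eval₂RingHom L.subtype (s : ℂ))).map τ := by
    rw [Polynomial.map_map]
    congr 1
    refine Polynomial.ringHom_ext (fun a => ?_) ?_
    · simp
    · simp
  rw [hmap] at hz'0
  obtain ⟨w, hw, hτw⟩ := root_lift τ _ hM2 _ hz'0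
  obtain ⟨ρ, hρ, hρz⟩ := hM3 w hw
  have hzalg : IsAlgebraic ℚ (z s) := by
    refine alg_root _ hM2 ?_ _ hz0
    intro k
    rw [Polynomial.coeff_map]
    exact alg_eval1 L hLa _ _ hsalg
  have hrel : ∀ j, (c j).eval₂ L.subtype (s : ℂ) * y s j =
      ((Q j).map (Polynomial.eval₂RingHom L.subtype (s : ℂ))).eval (z s) := by
    intro j
    have := hQ j s hsb
    rw [eval₂_sub, eval₂_mul, eval_uni, eval₂_X, hS s hsb, ev _ s hsb, sub_eq_zero] at this
    exact this
  have hrel' : ∀ j, (c j).eval₂ (τ.comp L.subtype) (s : ℂ) * y' s j =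
      ((Q j).map (Polynomial.eval₂RingHom (τ.comp L.subtype) (s : ℂ))).eval (z' s) := by
    intro j
    have : eval₂ (τ.comp L.subtype) (y' s) (Polynomial.aeval S (c j) * X j -
        (Q j).eval₂ (Polynomial.aeval (R := L) S).toRingHom G) = 0 := by
      refine transfer h h' a ha ha' _ (s0 : ℂ) hs0b ?_ s hsb
      refine Eventually.frequently ?_
      filter_upwards [nhdsWithin_le_nhds (Metric.isOpen_ball.mem_nhds hs0b)] with x hx
      exact hQ j x hx
    rw [eval₂_sub, eval₂_mul, eval_uni, eval₂_X, hS' s hsb, ev' _ s hsb, sub_eq_zero] at this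
    exact this
  have hcomp : (τ.comp ρ).comp L.subtype = τ.comp L.subtype := by
    ext x
    simp [hρ x x.2]
  refine ⟨s, hsδ.trans_le (min_le_left _ _), ?_, τ.comp ρ, ?_, ?_⟩
  · intro j
    have h1 : y s j = ((c j).eval₂ L.subtype (s : ℂ))⁻¹ *
        ((Q j).map (Polynomial.eval₂RingHom L.subtype (s : ℂ))).eval (z s) := by
      rw [← hrel, inv_mul_cancel_left₀ (hcs j)]
    rw [h1]
    exact (alg_eval1 L hLa _ _ hsalg).inv.mul (alg_eval2 L hLa _ _ hsalg _ hzalg)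
  · intro x hx
    rw [RingHom.comp_apply, hρ x hx]
  · intro j
    have h1 := congrArg (τ.comp ρ) (hrel j)
    rw [map_mul, sp_conj1, sp_conj, hcomp, hτs] at h1
    have h2 : (τ.comp ρ) (z s) = z' s := by rw [RingHom.comp_apply, hρz, hτw]
    rw [h2, ← hrel'] at h1
    refine mul_left_cancel₀ ?_ h1
    have h3 : (c j).eval₂ (τ.comp L.subtype) (s : ℂ) = τ ((c j).eval₂ L.subtype (s : ℂ)) := by
      rw [sp_conj1, hτs]
    rw [h3]
    simpa using hcs j

end curvelemma
end ConjugateDensity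

namespace ConjugateDensity

open Filter Topology

section twoemb

theorem exists_real_alg (L : Subfield ℂ) (hL : FiniteDimensional ℚ L) :
    ∃ θ : ℝ, IsAlgebraic ℚ (θ : ℂ) ∧ (θ : ℂ) ∉ L := by
  obtain ⟨p, hp, hpp⟩ := Nat.exists_infinite_primes (Module.finrank ℚ L + 1)
  have hp0 : p ≠ 0 := hpp.ne_zero
  let θ : ℝ := (2 : ℝ) ^ ((p : ℝ)⁻¹)
  have hθ : θ ^ p = 2 := Real.rpow_inv_natCast_pow (by norm_num) hp0
  have hθC : (θ : ℂ) ^ p = 2 := by exact_mod_cast hθ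
  have hirr : Irreducible (Polynomial.X ^ p - Polynomial.C (2 : ℚ)) := by
    refine X_pow_sub_C_irreducible_of_prime hpp ?_
    intro b hb
    have hb0 : b ≠ 0 := by rintro rfl; simp [hp0] at hb
    have h2 := congrArg (padicValRat 2) hb
    haveI : Fact (Nat.Prime 2) := ⟨Nat.prime_two⟩
    rw [padicValRat.pow] at h2
    have h3 : padicValRat 2 (2 : ℚ) = 1 := by
      simpa using padicValRat.self (p := 2) (by norm_num)
    rw [h3] at h2
    have h4 : (p : ℤ) ∣ 1 := ⟨_, h2.symm⟩
    have h5 : p ∣ 1 := by exact_mod_cast h4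
    exact hpp.one_lt.ne' (Nat.dvd_one.1 h5)
  have hmon : (Polynomial.X ^ p - Polynomial.C (2 : ℚ)).Monic := Polynomial.monic_X_pow_sub_C _ hp0
  have hroot : Polynomial.aeval (θ : ℂ) (Polynomial.X ^ p - Polynomial.C (2 : ℚ)) = 0 := by
    simp [hθC]
  refine ⟨θ, ⟨_, hmon.ne_zero, hroot⟩, ?_⟩
  intro hmem
  have hmin : minpoly ℚ (⟨θ, hmem⟩ : L) = Polynomial.X ^ p - Polynomial.C (2 : ℚ) := by
    refine (minpoly.eq_of_irreducible_of_monic hirr ?_ hmon).symm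
    have : ((⟨θ, hmem⟩ : L) ^ p - 2 : L) = 0 := by
      apply Subtype.ext
      have e : (((⟨θ, hmem⟩ : L) ^ p - 2 : L) : ℂ) = (θ : ℂ) ^ p - 2 := rfl
      rw [e, hθC]; simp
    rw [map_sub, map_pow, Polynomial.aeval_X, Polynomial.aeval_C, map_ofNat]
    exact this
  have h1 := minpoly.natDegree_le (A := ℚ) (⟨θ, hmem⟩ : L)
  rw [hmin, Polynomial.natDegree_X_pow_sub_C] at h1
  omega

theorem two_emb (L : Subfield ℂ) (hL : FiniteDimensional ℚ L) (τ : ℂ →+* ℂ) :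
    ∃ (L2 : Subfield ℂ) (τ1 : ℂ →+* ℂ), FiniteDimensional ℚ L2 ∧ L ≤ L2 ∧ (∀ x ∈ L, τ1 x = τ x) ∧
      ∀ u u' : ℂ, ∀ δ : ℝ, 0 < δ → ∃ β ∈ L2, ‖β - u‖ < δ ∧ ‖τ1 β - u'‖ < δ := by
  obtain ⟨θ, hθa, hθL⟩ := exists_real_alg L hL
  obtain ⟨τ1, h1, h2⟩ := ext_move L (alg_of_fin L hL) τ θ hθa hθL θ
  have hIa : IsAlgebraic ℚ Complex.I := by
    refine ⟨Polynomial.X ^ 2 + 1, ?_, by simp⟩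
    exact (Polynomial.monic_X_pow_add_C (1 : ℚ) (n := 2) (by norm_num)).ne_zero
  obtain ⟨L2, hL2, hLL, hs⟩ := exists_big L hL {Complex.I, (θ : ℂ)} (by simp)
    (by rintro x (rfl | rfl) <;> assumption)
  have hI2 : Complex.I ∈ L2 := hs (by simp)
  have hθ2 : (θ : ℂ) ∈ L2 := hs (by simp)
  refine ⟨L2, τ1, hL2, hLL, h1, ?_⟩
  set J := τ1 Complex.I with hJ
  set θ' := τ1 θ with hθ'
  let F : (ℝ × ℝ) × (ℝ × ℝ) → ℂ × ℂ := fun x =>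
    ((x.1.1 + x.1.2 * Complex.I) + (x.2.1 + x.2.2 * Complex.I) * θ,
     (x.1.1 + x.1.2 * J) + (x.2.1 + x.2.2 * J) * θ')
  have hFc : Continuous F := by fun_prop
  have hJJ : J = Complex.I ∨ J = - Complex.I := by
    have : J ^ 2 = Complex.I ^ 2 := by rw [hJ, ← map_pow]; simp
    exact sq_eq_sq_iff_eq_or_eq_neg.1 this
  have hFs : Function.Surjective F := by
    rintro ⟨u, u'⟩
    rcases hJJ with hJ1 | hJ1
    · have hne : (θ : ℂ) - θ' ≠ 0 := sub_ne_zero.2 h2.symm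
      let b := (u - u') / (θ - θ')
      let a := u - b * θ
      have hb : b * (θ - θ') = u - u' := div_mul_cancel₀ _ hne
      refine ⟨((a.re, a.im), (b.re, b.im)), ?_⟩
      simp only [F, hJ1, Complex.re_add_im]
      ext1
      · simp [a]
      · simp only [a]; linear_combination -hb
    · have hne : (θ : ℂ) - (starRingEnd ℂ) θ' ≠ 0 := by
        intro h
        apply h2
        have := congrArg (starRingEnd ℂ) h
        simp [sub_eq_zero] at this
        exact this.symm
      let b := (u - (starRingEnd ℂ) u') / (θ - (starRingEnd ℂ) θ')
      let a := u - b * θ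
      have hb : b * (θ - (starRingEnd ℂ) θ') = u - (starRingEnd ℂ) u' := div_mul_cancel₀ _ hne
      have hconj : ∀ z : ℂ, (z.re : ℂ) + z.im * (-Complex.I) = (starRingEnd ℂ) z := by
        intro z; apply Complex.ext <;> simp
      refine ⟨((a.re, a.im), (b.re, b.im)), ?_⟩
      simp only [F, hJ1, Complex.re_add_im, hconj]
      have hb' := congrArg (starRingEnd ℂ) hb
      simp only [map_mul, map_sub, Complex.conj_conj, Complex.conj_ofReal] at hb'
      ext1
      · simp [a]
      · simp only [a, map_sub, map_mul, Complex.conj_ofReal]; linear_combination -hb'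
  have hQ : DenseRange ((↑) : ℚ → ℝ) := Rat.denseRange_cast
  have hd := hFs.denseRange.comp ((hQ.prodMap hQ).prodMap (hQ.prodMap hQ)) hFc
  intro u u' δ hδ
  obtain ⟨⟨⟨a, b⟩, ⟨c, d⟩⟩, hx⟩ := hd.exists_dist_lt (u, u') hδ
  rw [dist_comm, Prod.dist_eq, max_lt_iff] at hx
  have hq : ∀ q : ℚ, (q : ℂ) ∈ L2 := fun q => SubfieldClass.ratCast_mem L2 q
  refine ⟨((a : ℂ) + b * Complex.I) + (c + d * Complex.I) * θ, ?_, ?_, ?_⟩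
  · exact add_mem (add_mem (hq _) (mul_mem (hq _) hI2))
      (mul_mem (add_mem (hq _) (mul_mem (hq _) hI2)) hθ2)
  · have := hx.1
    rw [dist_eq_norm] at this
    simpa [F] using this
  · have := hx.2
    rw [dist_eq_norm] at this
    simpa [F] using this

end twoemb
end ConjugateDensity

namespace ConjugateDensity

open Filter Topology

section ift
open MvPolynomial

/-- The polynomial map attached to `Φ`, evaluated through the embedding `f`. -/
noncomputable def pmap {K : Type} [Field K] {N : ℕ} (f : K →+* ℂ) (Φ : Fin N → MvPolynomial (Fin N) K)
    (v : Fin N → ℂ) : Fin N → ℂ := fun i => eval₂ f v (Φ i)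

/-- The Jacobian matrix of `pmap`. -/
noncomputable def pjac {K : Type} [Field K] {N : ℕ} (f : K →+* ℂ) (Φ : Fin N → MvPolynomial (Fin N) K)
    (v : Fin N → ℂ) : Matrix (Fin N) (Fin N) ℂ :=
  Matrix.of fun i j => eval₂ f v (pderiv j (Φ i))

theorem continuous_eval₂ {K : Type} [Field K] {N : ℕ} (f : K →+* ℂ) (H : MvPolynomial (Fin N) K) :
    Continuous (fun v : Fin N → ℂ => eval₂ f v H) := by
  simp only [← eval_map]
  exact MvPolynomial.continuous_eval _

theorem hasStrict_eval₂ {K : Type} [Field K] {N : ℕ} (f : K →+* ℂ) (v : Fin N → ℂ)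
    (H : MvPolynomial (Fin N) K) :
    HasStrictFDerivAt (fun v : Fin N → ℂ => eval₂ f v H)
      (∑ i, eval₂ f v (pderiv i H) • (ContinuousLinearMap.proj (R := ℂ) (φ := fun _ : Fin N => ℂ) i))
      v := by
  induction H using MvPolynomial.induction_on with
  | C a =>
    simp only [eval₂_C]
    refine (hasStrictFDerivAt_const (𝕜 := ℂ) (f a) v).congr_fderiv ?_
    ext x; simp
  | add p q hp hq =>
    simp only [eval₂_add]
    refine (hp.add hq).congr_fderiv ?_
    ext x
    simp [add_mul, Finset.sum_add_distrib]
  | mul_X p j hp =>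
    simp only [eval₂_mul, eval₂_X]
    refine (hp.mul (hasStrictFDerivAt_apply (𝕜 := ℂ) j v)).congr_fderiv ?_
    have : ∀ i, eval₂ f v (Pi.single (M := fun _ => MvPolynomial (Fin N) K) i 1 j) =
        if i = j then 1 else 0 := by
      intro i
      by_cases hij : i = j
      · subst hij; simp
      · simp [Ne.symm hij, hij]
    ext x
    simp [Derivation.leibniz, pderiv_X, this, add_mul, Finset.sum_add_distrib, Finset.mul_sum,
      mul_assoc]

theorem hasStrict_pmap {K : Type} [Field K] {N : ℕ} (f : K →+* ℂ)
    (Φ : Fin N → MvPolynomial (Fin N) K) (v : Fin N → ℂ) (h : (pjac f Φ v).det ≠ 0) :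
    ∃ e : (Fin N → ℂ) ≃L[ℂ] (Fin N → ℂ),
      HasStrictFDerivAt (pmap f Φ) (e : (Fin N → ℂ) →L[ℂ] (Fin N → ℂ)) v := by
  have hinv : Invertible (pjac f Φ v) := Matrix.invertibleOfIsUnitDet _ (Ne.isUnit h)
  refine ⟨((pjac f Φ v).toLinearEquiv' hinv).toContinuousLinearEquiv, ?_⟩
  rw [hasStrictFDerivAt_pi']
  intro i
  refine (hasStrict_eval₂ f v (Φ i)).congr_fderiv ?_
  ext x
  have : ((pjac f Φ v).toLinearEquiv' hinv) x = (pjac f Φ v).mulVec x := rfl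
  simp [this]
  simp [pjac, Matrix.mulVec, dotProduct]

structure LocInv {K : Type} [Field K] {N : ℕ} (f : K →+* ℂ) (Φ : Fin N → MvPolynomial (Fin N) K)
    (P : Fin N → ℂ) (U : Set (Fin N → ℂ)) (ε : ℝ) (Ψ : (Fin N → ℂ) → Fin N → ℂ) : Prop where
  pos : 0 < ε
  isOpen : IsOpen U
  mem : P ∈ U
  maps : ∀ v ∈ U, pmap f Φ v ∈ Metric.ball (pmap f Φ P) ε
  maps' : ∀ w ∈ Metric.ball (pmap f Φ P) ε, Ψ w ∈ U
  right : ∀ w ∈ Metric.ball (pmap f Φ P) ε, pmap f Φ (Ψ w) = w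
  left : ∀ v ∈ U, Ψ (pmap f Φ v) = v
  diff : DifferentiableOn ℂ Ψ (Metric.ball (pmap f Φ P) ε)
  det : ∀ v ∈ U, (pjac f Φ v).det ≠ 0

theorem exists_locInv {K : Type} [Field K] {N : ℕ} (f : K →+* ℂ)
    (Φ : Fin N → MvPolynomial (Fin N) K) (P : Fin N → ℂ) (h : (pjac f Φ P).det ≠ 0)
    (V : Set (Fin N → ℂ)) (hV : V ∈ 𝓝 P) :
    ∃ U ε Ψ, U ⊆ V ∧ LocInv f Φ P U ε Ψ := by
  obtain ⟨e', he'⟩ := hasStrict_pmap f Φ P h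
  let e := he'.toOpenPartialHomeomorph (pmap f Φ)
  have hcoe : ∀ v, e v = pmap f Φ v := fun v => rfl
  have hPs : P ∈ e.source := he'.mem_toOpenPartialHomeomorph_source
  have hPt : pmap f Φ P ∈ e.target := he'.image_mem_toOpenPartialHomeomorph_target
  have hdetc : Continuous fun v => (pjac f Φ v).det := by
    refine Continuous.matrix_det ?_
    exact continuous_matrix fun i j => continuous_eval₂ f _
  let W := interior V ∩ {v | (pjac f Φ v).det ≠ 0}
  have hW : IsOpen W := isOpen_interior.inter (isOpen_ne_fun hdetc continuous_const)
  have hPW : P ∈ W := ⟨mem_interior_iff_mem_nhds.2 hV, h⟩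
  have hopen : IsOpen (e.target ∩ e.symm ⁻¹' W) := e.isOpen_inter_preimage_symm hW
  have hmem : pmap f Φ P ∈ e.target ∩ e.symm ⁻¹' W := by
    refine ⟨hPt, ?_⟩
    have : e.symm (pmap f Φ P) = P := e.left_inv hPs
    rw [Set.mem_preimage, this]; exact hPW
  obtain ⟨ε, hε, hball⟩ := Metric.isOpen_iff.1 hopen _ hmem
  have hUW : ∀ v ∈ e.source ∩ e ⁻¹' Metric.ball (pmap f Φ P) ε, v ∈ W := by
    rintro v ⟨h1, h2⟩
    have h3 := (hball h2).2
    rwa [Set.mem_preimage, e.left_inv h1] at h3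
  refine ⟨e.source ∩ e ⁻¹' Metric.ball (pmap f Φ P) ε, ε, e.symm,
    fun v hv => interior_subset (hUW v hv).1, hε, e.isOpen_inter_preimage Metric.isOpen_ball,
    ⟨hPs, Metric.mem_ball_self hε⟩, fun v hv => hv.2, ?_, ?_, ?_, ?_, ?_⟩
  · intro w hw
    refine ⟨e.map_target (hball hw).1, ?_⟩
    rw [Set.mem_preimage, e.right_inv (hball hw).1]; exact hw
  · intro w hw
    exact e.right_inv (hball hw).1
  · intro v hv
    exact e.left_inv hv.1
  · intro w hw
    obtain ⟨e2, he2⟩ := hasStrict_pmap f Φ (e.symm w) (hball hw).2.2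
    exact (e.hasFDerivAt_symm (hball hw).1 he2.hasFDerivAt).differentiableAt.differentiableWithinAt
  · intro v hv
    exact (hUW v hv).2

/-- A line through the base point in the target gives a `Curve`. -/
theorem LocInv.curve {K : Type} [Field K] {N : ℕ} {f : K →+* ℂ}
    {Φ : Fin N → MvPolynomial (Fin N) K} {P : Fin N → ℂ} {U : Set (Fin N → ℂ)} {ε : ℝ}
    {Ψ : (Fin N → ℂ) → Fin N → ℂ} (h : LocInv f Φ P U ε Ψ) (p b : Fin N → K)
    (hp : ∀ i, f (p i) = pmap f Φ P i) (hb : ‖fun i => f (b i)‖ < ε) :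
    ∀ R, R * ‖fun i => f (b i)‖ < ε →
    Curve f Φ p b R (fun s => Ψ (fun i => pmap f Φ P i + s * f (b i))) := by
  intro R hR
  have hin : ∀ s ∈ Metric.ball (0 : ℂ) R, (fun i => pmap f Φ P i + s * f (b i)) ∈
      Metric.ball (pmap f Φ P) ε := by
    intro s hs
    rw [mem_ball_zero_iff] at hs
    rw [mem_ball_iff_norm]
    have : (fun i => pmap f Φ P i + s * f (b i)) - pmap f Φ P = s • (fun i => f (b i)) := by
      ext i; simp
    rw [this, norm_smul]
    exact (mul_le_mul_of_nonneg_right hs.le (norm_nonneg _)).trans_lt hR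
  refine ⟨?_, ?_, ?_⟩
  · intro i s hs
    have h1 := (h.diff _ (hin s hs)).differentiableAt (Metric.isOpen_ball.mem_nhds (hin s hs))
    have h2 : DifferentiableAt ℂ (fun s : ℂ => (fun i => pmap f Φ P i + s * f (b i))) s := by
      rw [differentiableAt_pi]; intro i; fun_prop
    have h3 := h1.comp s h2
    rw [differentiableAt_pi] at h3
    exact (h3 i).differentiableWithinAt
  · intro s hs i
    rw [hp]
    exact congrFun (h.right _ (hin s hs)) i
  · intro s hs
    exact h.det _ (h.maps' _ (hin s hs))

end ift
end ConjugateDensity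

namespace ConjugateDensity

open Filter Topology

section descent
open MvPolynomial

variable {A : Type} [Field A] [Algebra A ℂ]

theorem row_descent {n : ℕ} (D : (Fin n → ℂ) →ₗ[ℂ] ℂ) (x : Fin n → ℂ) (h : D x ≠ 0) :
    ∃ ℓ : ℂ →ₗ[A] A, D (fun j => algebraMap A ℂ (ℓ (x j))) ≠ 0 := by
  by_contra hcon
  push Not at hcon
  apply h
  let b := Module.Basis.ofVectorSpace A ℂ
  have h1 : ∀ α, ∑ j, algebraMap A ℂ (b.repr (x j) α) * D (fun k => if j = k then 1 else 0) = 0 := by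
    intro α
    have := hcon (b.coord α)
    rw [LinearMap.pi_apply_eq_sum_univ] at this
    simpa using this
  classical
  let T := Finset.univ.biUnion fun j => (b.repr (x j)).support
  have h2 : ∀ j, x j = ∑ α ∈ T, algebraMap A ℂ (b.repr (x j) α) * b α := by
    intro j
    conv_lhs => rw [← b.linearCombination_repr (x j)]
    rw [Finsupp.linearCombination_apply, Finsupp.sum]
    simp only [Algebra.smul_def]
    refine Finset.sum_subset ?_ ?_
    · intro α hα; exact Finset.mem_biUnion.2 ⟨j, Finset.mem_univ _, hα⟩
    · intro α _ hα
      rw [Finsupp.notMem_support_iff.1 hα]; simp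
  rw [LinearMap.pi_apply_eq_sum_univ]
  calc ∑ j, x j • D (fun k => if j = k then 1 else 0)
      = ∑ j, ∑ α ∈ T, b α * (algebraMap A ℂ (b.repr (x j) α) * D (fun k => if j = k then 1 else 0)) := by
        refine Finset.sum_congr rfl fun j _ => ?_
        rw [smul_eq_mul]
        conv_lhs => rw [h2 j]
        rw [Finset.sum_mul]
        exact Finset.sum_congr rfl fun α _ => by ring
    _ = ∑ α ∈ T, b α * ∑ j, (algebraMap A ℂ (b.repr (x j) α) * D (fun k => if j = k then 1 else 0)) := by
        rw [Finset.sum_comm]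
        simp only [Finset.mul_sum]
    _ = 0 := by simp [h1]

theorem det_descent {n : ℕ} (M : Matrix (Fin n) (Fin n) ℂ) (h : M.det ≠ 0) :
    ∃ ℓ : Fin n → (ℂ →ₗ[A] A),
      (Matrix.of fun i j => algebraMap A ℂ (ℓ i (M i j))).det ≠ 0 := by
  classical
  have key : ∀ S : Finset (Fin n), ∃ ℓ : Fin n → (ℂ →ₗ[A] A),
      (Matrix.of fun i j => if i ∈ S then algebraMap A ℂ (ℓ i (M i j)) else M i j).det ≠ 0 := by
    intro S
    induction S using Finset.induction_on with
    | empty => exact ⟨0, by simpa using (show (Matrix.of fun i j => M i j).det ≠ 0 from h)⟩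
    | insert i S hi ih =>
      obtain ⟨ℓ, hℓ⟩ := ih
      set B := (Matrix.of fun i j => if i ∈ S then algebraMap A ℂ (ℓ i (M i j)) else M i j) with hB
      let D : (Fin n → ℂ) →ₗ[ℂ] ℂ := (LinearMap.proj i).comp (B.transpose.cramer)
      have hD : ∀ x, D x = (B.updateRow i x).det := fun x => Matrix.cramer_transpose_apply B x i
      have hrow : M i = B i := by ext j; simp [hB, hi]
      obtain ⟨l, hl⟩ := row_descent (A := A) D (M i) (by
        rw [hD, hrow, Matrix.updateRow_eq_self]; exact hℓ)
      refine ⟨Function.update ℓ i l, ?_⟩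
      rw [hD] at hl
      convert hl using 2
      ext a j
      by_cases ha : a = i
      · subst ha; simp
      · simp [Matrix.updateRow_ne ha, hB, ha, Function.update_of_ne ha]
  obtain ⟨ℓ, hℓ⟩ := key Finset.univ
  exact ⟨ℓ, by simpa using hℓ⟩

variable {N : ℕ}

/-- Apply a linear functional to all coefficients. -/
noncomputable def coeffMap (ℓ : ℂ →ₗ[A] A) (H : MvPolynomial (Fin N) ℂ) : MvPolynomial (Fin N) A :=
  ∑ m ∈ H.support, monomial m (ℓ (coeff m H))

theorem coeffMap_eq (ℓ : ℂ →ₗ[A] A) (H : MvPolynomial (Fin N) ℂ) (T : Finset (Fin N →₀ ℕ))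
    (hT : H.support ⊆ T) : coeffMap ℓ H = ∑ m ∈ T, monomial m (ℓ (coeff m H)) := by
  refine Finset.sum_subset hT ?_
  intro m _ hm
  rw [notMem_support_iff.1 hm]; simp

theorem coeffMap_add (ℓ : ℂ →ₗ[A] A) (H G : MvPolynomial (Fin N) ℂ) :
    coeffMap ℓ (H + G) = coeffMap ℓ H + coeffMap ℓ G := by
  classical
  rw [coeffMap_eq ℓ (H + G) (H.support ∪ G.support) support_add,
    coeffMap_eq ℓ H (H.support ∪ G.support) Finset.subset_union_left,
    coeffMap_eq ℓ G (H.support ∪ G.support) Finset.subset_union_right, ← Finset.sum_add_distrib]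
  exact Finset.sum_congr rfl fun m _ => by simp

theorem coeffMap_monomial (ℓ : ℂ →ₗ[A] A) (m : Fin N →₀ ℕ) (c : ℂ) :
    coeffMap ℓ (monomial m c) = monomial m (ℓ c) := by
  rw [coeffMap_eq ℓ _ {m} support_monomial_subset]; simp

theorem coeffMap_pderiv (ℓ : ℂ →ₗ[A] A) (j : Fin N) (H : MvPolynomial (Fin N) ℂ) :
    coeffMap ℓ (pderiv j H) = pderiv j (coeffMap ℓ H) := by
  induction H using MvPolynomial.induction_on' with
  | monomial m c =>
    rw [pderiv_monomial, coeffMap_monomial, coeffMap_monomial, pderiv_monomial]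
    congr 1
    rw [mul_comm, mul_comm (ℓ c), ← nsmul_eq_mul, ← nsmul_eq_mul, map_nsmul]
  | add p q hp hq => rw [map_add, coeffMap_add, hp, hq, coeffMap_add, map_add]

theorem coeffMap_eval (ℓ : ℂ →ₗ[A] A) (v : Fin N → A) (H : MvPolynomial (Fin N) ℂ) :
    eval v (coeffMap ℓ H) = ℓ (eval (fun i => algebraMap A ℂ (v i)) H) := by
  induction H using MvPolynomial.induction_on' with
  | monomial m c =>
    rw [coeffMap_monomial, eval_monomial, eval_monomial]
    have : (m.prod fun n e => (algebraMap A ℂ (v n)) ^ e) = algebraMap A ℂ (m.prod fun n e => v n ^ e) := by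
      simp [Finsupp.prod]
    rw [this, mul_comm c, ← Algebra.smul_def, map_smul, smul_eq_mul, mul_comm]
  | add p q hp hq => rw [map_add, coeffMap_add, map_add, hp, hq, map_add]

theorem select_cols {c : ℕ} (M : Matrix (Fin c) (Fin N) ℂ) (h : M.rank = c) :
    ∃ a : Fin c → Fin N, Function.Injective a ∧ LinearIndependent ℂ (fun i => M.col (a i)) := by
  obtain ⟨κ, a, ha, hspan, hli⟩ := exists_linearIndependent' ℂ M.col
  rw [Matrix.rank_eq_finrank_span_cols, ← hspan] at h
  have : Finite κ := Finite.of_injective a ha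
  have := Fintype.ofFinite κ
  rw [finrank_span_eq_card hli] at h
  let e : Fin c ≃ κ := (Fintype.equivFinOfCardEq h).symm
  exact ⟨a ∘ e, ha.comp e.injective, hli.comp e e.injective⟩

theorem complete {c : ℕ} (g : Fin c → MvPolynomial (Fin N) ℂ) (P : Fin N → ℂ)
    (h : (Matrix.of fun (i : Fin c) (j : Fin N) => aeval P (pderiv j (g i))).rank = c) :
    ∃ (a : Fin c → Fin N) (Γ : Fin N → MvPolynomial (Fin N) ℂ), Function.Injective a ∧
      (∀ i, Γ (a i) = g i) ∧ (∀ j, j ∉ Set.range a → Γ j = X j) ∧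
      (pjac (RingHom.id ℂ) Γ P).det ≠ 0 := by
  classical
  obtain ⟨a, ha, hli⟩ := select_cols _ h
  let Γ : Fin N → MvPolynomial (Fin N) ℂ := fun j =>
    if hj : ∃ i, a i = j then g hj.choose else X j
  have h1 : ∀ i, Γ (a i) = g i := by
    intro i
    have hj : ∃ i', a i' = a i := ⟨i, rfl⟩
    simp only [Γ, dif_pos hj]
    rw [ha hj.choose_spec]
  have h2 : ∀ j, j ∉ Set.range a → Γ j = X j := by
    intro j hj
    have : ¬ ∃ i, a i = j := hj
    simp only [Γ, dif_neg this]
  refine ⟨a, Γ, ha, h1, h2, ?_⟩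
  intro hdet
  obtain ⟨x, hx, hMx⟩ := Matrix.exists_mulVec_eq_zero_iff.2 hdet
  apply hx
  have h3 : ∀ j, j ∉ Set.range a → x j = 0 := by
    intro j hj
    have := congrFun hMx j
    simp only [Matrix.mulVec, dotProduct, pjac, Matrix.of_apply, h2 j hj, pderiv_X] at this
    rw [Finset.sum_eq_single j] at this
    · simpa using this
    · intro b _ hb; simp [hb.symm]
    · simp
  have h4 : ∀ i, x (a i) = 0 := by
    rw [Fintype.linearIndependent_iff] at hli
    refine hli (fun i => x (a i)) ?_
    ext r
    have := congrFun hMx (a r)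
    simp only [Matrix.mulVec, dotProduct, pjac, Matrix.of_apply, h1] at this
    simp only [Finset.sum_apply, Pi.smul_apply, Matrix.col_apply, Matrix.of_apply, smul_eq_mul]
    rw [Pi.zero_apply] at this
    refine Eq.trans ?_ this
    refine Fintype.sum_of_injective a ha _ _ (fun j hj => by rw [h3 j hj, mul_zero]) ?_
    intro i
    rw [mul_comm]
    rfl
  ext j
  by_cases hj : j ∈ Set.range a
  · obtain ⟨i, rfl⟩ := hj; exact h4 i
  · exact h3 j hj

theorem vanish_all [IsAlgClosed A] (k : Subfield ℂ) (ι : k →+* A)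
    (polys : Finset (MvPolynomial (Fin N) k)) (H : MvPolynomial (Fin N) A)
    (hH : ∀ v : Fin N → A, (∀ F ∈ polys, eval₂ ι v F = 0) → eval v H = 0)
    (f : A →+* ℂ) (v : Fin N → ℂ) (hv : ∀ F ∈ polys, eval₂ (f.comp ι) v F = 0) :
    eval₂ f v H = 0 := by
  let I : Ideal (MvPolynomial (Fin N) A) := Ideal.span ((fun F => map ι F) '' (polys : Set _))
  have h1 : H ∈ vanishingIdeal A (zeroLocus A I) := by
    rw [mem_vanishingIdeal_iff]
    intro x hx
    rw [mem_zeroLocus_iff] at hx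
    rw [aeval_eq_eval]
    refine hH x fun F hF => ?_
    have := hx (map ι F) (Ideal.subset_span ⟨F, hF, rfl⟩)
    rw [aeval_eq_eval] at this
    rw [← eval_map]; exact this
  rw [vanishingIdeal_zeroLocus_eq_radical] at h1
  obtain ⟨n, hn⟩ := h1
  have h2 : I ≤ RingHom.ker (eval₂Hom f v) := by
    rw [Ideal.span_le]
    rintro _ ⟨F, hF, rfl⟩
    have := hv F hF
    change eval₂Hom f v (map ι F) = 0
    rw [coe_eval₂Hom, eval₂_map]; exact this
  have h3 : eval₂Hom f v (H ^ n) = 0 := h2 hn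
  rw [map_pow] at h3
  exact eq_zero_of_pow_eq_zero h3

theorem descent [IsAlgClosed A] (k : Subfield ℂ) (ι : k →+* A)
    (hι : (algebraMap A ℂ).comp ι = k.subtype) (polys : Finset (MvPolynomial (Fin N) k))
    (P0 : Fin N → A) (P : Fin N → ℂ) (hP0 : P = fun i => algebraMap A ℂ (P0 i))
    (S : Set (Fin N → ℂ)) (hS : ∀ v, v ∈ S ↔ ∀ F ∈ polys, eval₂ k.subtype v F = 0) (hPS : P ∈ S)
    {c : ℕ} (g : Fin c → MvPolynomial (Fin N) ℂ) (hg : ∀ i, ∀ v ∈ S, aeval v (g i) = 0)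
    (h : MvPolynomial (Fin N) ℂ) (hhP : aeval P h ≠ 0)
    (hh : ∀ v : Fin N → ℂ, aeval v h ≠ 0 → (v ∈ S ↔ ∀ i, aeval v (g i) = 0))
    (hrank : (Matrix.of fun (i : Fin c) (j : Fin N) => aeval P (pderiv j (g i))).rank = c) :
    ∃ (C : Set (Fin N)) (Φ : Fin N → MvPolynomial (Fin N) A),
      (pjac (algebraMap A ℂ) Φ P).det ≠ 0 ∧
      (∀ i ∈ C, ∀ (f : A →+* ℂ) (v : Fin N → ℂ), (∀ F ∈ polys, eval₂ (f.comp ι) v F = 0) →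
        eval₂ f v (Φ i) = 0) ∧
      ∀ᶠ v in 𝓝 P, (∀ i ∈ C, eval₂ (algebraMap A ℂ) v (Φ i) = 0) → v ∈ S := by
  obtain ⟨a, Γ, ha, hΓa, hΓX, hdetΓ⟩ := complete g P hrank
  obtain ⟨ℓ, hℓ⟩ := det_descent (A := A) _ hdetΓ
  let Φ : Fin N → MvPolynomial (Fin N) A := fun i => coeffMap (ℓ i) (Γ i)
  have hev : ∀ (H : MvPolynomial (Fin N) A) (v : Fin N → A),
      eval₂ (algebraMap A ℂ) (fun i => algebraMap A ℂ (v i)) H = algebraMap A ℂ (eval v H) := by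
    intro H v
    exact (eval₂_comp (algebraMap A ℂ) v H).symm
  have hdetΦ : (pjac (algebraMap A ℂ) Φ P).det ≠ 0 := by
    convert hℓ using 3
    ext i j
    simp only [pjac, Matrix.of_apply, Φ]
    rw [← coeffMap_pderiv, hP0, hev, coeffMap_eval]
    rfl
  have hvan : ∀ i ∈ Set.range a, ∀ (f : A →+* ℂ) (v : Fin N → ℂ),
      (∀ F ∈ polys, eval₂ (f.comp ι) v F = 0) → eval₂ f v (Φ i) = 0 := by
    rintro _ ⟨i, rfl⟩ f v hv
    refine vanish_all k ι polys _ ?_ f v hv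
    intro w hw
    simp only [Φ]
    rw [coeffMap_eval, hΓa]
    have hwS : (fun i => algebraMap A ℂ (w i)) ∈ S := by
      rw [hS]
      intro F hF
      have := congrArg (algebraMap A ℂ) (hw F hF)
      rw [hom_eval₂, map_zero, hι] at this
      exact this
    have := hg i _ hwS
    rw [aeval_eq_eval] at this
    rw [← map_zero (ℓ (a i))]
    exact congrArg _ this
  refine ⟨Set.range a, Φ, hdetΦ, hvan, ?_⟩
  obtain ⟨UΦ, εΦ, ΨΦ, -, hIΦ⟩ := exists_locInv (algebraMap A ℂ) Φ P hdetΦ Set.univ univ_mem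
  have hcont : Continuous fun v : Fin N → ℂ => aeval v h := by
    simp only [aeval_def]
    exact continuous_eval₂ _ h
  obtain ⟨UΓ, εΓ, ΨΓ, hUΓ, hIΓ⟩ := exists_locInv (RingHom.id ℂ) Γ P hdetΓ
    (UΦ ∩ {v | aeval v h ≠ 0})
    (((hIΦ.isOpen.inter (isOpen_ne_fun hcont continuous_const))).mem_nhds ⟨hIΦ.mem, hhP⟩)
  classical
  let t : (Fin N → ℂ) → Fin N → ℂ := fun v j => if j ∈ Set.range a then 0 else v j
  have htc : Continuous t := by
    refine continuous_pi fun j => ?_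
    by_cases hj : j ∈ Set.range a
    · simp only [t, if_pos hj]; exact continuous_const
    · simp only [t, if_neg hj]; exact continuous_apply j
  have htP : t P = pmap (RingHom.id ℂ) Γ P := by
    ext j
    by_cases hj : j ∈ Set.range a
    · simp only [t, if_pos hj, pmap]
      obtain ⟨i, rfl⟩ := hj
      rw [hΓa]; exact (hg i P hPS).symm
    · simp only [t, if_neg hj, pmap, hΓX j hj, eval₂_X]
  have e1 : ∀ᶠ v in 𝓝 P, t v ∈ Metric.ball (pmap (RingHom.id ℂ) Γ P) εΓ := by
    refine htc.continuousAt.eventually (Metric.isOpen_ball.mem_nhds ?_)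
    rw [htP]; exact Metric.mem_ball_self hIΓ.pos
  filter_upwards [e1, hIΦ.isOpen.mem_nhds hIΦ.mem] with v hv hvU hvC
  set w := ΨΓ (t v) with hw
  have hwU : w ∈ UΓ := hIΓ.maps' _ hv
  have hwt : pmap (RingHom.id ℂ) Γ w = t v := hIΓ.right _ hv
  have hwS : w ∈ S := by
    rw [hh w (hUΓ hwU).2]
    intro i
    have := congrFun hwt (a i)
    simp only [pmap, hΓa, t, Set.mem_range_self, if_true] at this
    exact this
  have hwv : w = v := by
    rw [← hIΦ.left w (hUΓ hwU).1, ← hIΦ.left v hvU]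
    congr 1
    ext j
    by_cases hj : j ∈ Set.range a
    · simp only [pmap]
      rw [hvC j hj]
      refine hvan j hj (algebraMap A ℂ) w ?_
      rw [hι]; exact (hS w).1 hwS
    · have := congrFun hwt j
      simp only [pmap, hΓX j hj, eval₂_X, t, if_neg hj] at this
      have hΦj : Φ j = monomial (Finsupp.single j 1) (ℓ j 1) := by
        simp only [Φ, hΓX j hj]
        exact coeffMap_monomial _ _ _
      simp only [pmap, hΦj, eval₂_monomial]
      simp [this]
  rw [← hwv]; exact hwS

end descent
end ConjugateDensity

namespace ConjugateDensity

open Filter Topology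

section assembly
open MvPolynomial

theorem pmap_map {K K' : Type} [Field K] [Field K'] {N : ℕ} (f : K →+* ℂ) (f' : K' →+* ℂ)
    (j : K →+* K') (hf : f'.comp j = f) (Φ : Fin N → MvPolynomial (Fin N) K) (v : Fin N → ℂ) :
    pmap f' (fun i => map j (Φ i)) v = pmap f Φ v := by
  ext i
  simp only [pmap, eval₂_map, hf]

theorem pjac_map {K K' : Type} [Field K] [Field K'] {N : ℕ} (f : K →+* ℂ) (f' : K' →+* ℂ)
    (j : K →+* K') (hf : f'.comp j = f) (Φ : Fin N → MvPolynomial (Fin N) K) (v : Fin N → ℂ) :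
    pjac f' (fun i => map j (Φ i)) v = pjac f Φ v := by
  ext i l
  simp only [pjac, Matrix.of_apply, pderiv_map, eval₂_map, hf]

theorem LocInv.base {K K' : Type} [Field K] [Field K'] {N : ℕ} {f : K →+* ℂ}
    {Φ : Fin N → MvPolynomial (Fin N) K} {P : Fin N → ℂ} {U : Set (Fin N → ℂ)} {ε : ℝ}
    {Ψ : (Fin N → ℂ) → Fin N → ℂ} (h : LocInv f Φ P U ε Ψ) (f' : K' →+* ℂ)
    (j : K →+* K') (hf : f'.comp j = f) : LocInv f' (fun i => map j (Φ i)) P U ε Ψ := by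
  constructor
  · exact h.pos
  · exact h.isOpen
  · exact h.mem
  · simp only [pmap_map f f' j hf]; exact h.maps
  · simp only [pmap_map f f' j hf]; exact h.maps'
  · simp only [pmap_map f f' j hf]; exact h.right
  · simp only [pmap_map f f' j hf]; exact h.left
  · simp only [pmap_map f f' j hf]; exact h.diff
  · simp only [pjac_map f f' j hf]; exact h.det

theorem glue (L : ℕ → Subfield ℂ) (hmono : ∀ n, L n ≤ L (n + 1))
    (halg : ∀ n, ∀ x ∈ L n, IsAlgebraic ℚ x) (τ : ℕ → ℂ →+* ℂ)
    (h : ∀ n, ∀ x ∈ L n, τ (n + 1) x = τ n x) :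
    ∃ σ : ℂ →+* ℂ, ∀ n, ∀ x ∈ L n, σ x = τ n x := by
  have hm : Monotone L := monotone_nat_of_le_succ hmono
  have hτ : ∀ n m, n ≤ m → ∀ x ∈ L n, τ m x = τ n x := by
    intro n m hnm x hx
    induction m, hnm using Nat.le_induction with
    | base => rfl
    | succ m hm' ih => rw [h m x (hm hm' hx), ih]
  have hmem : ∀ x, x ∈ (⨆ n, L n) ↔ ∃ n, x ∈ L n := fun x =>
    Subfield.mem_iSup_of_directed hm.directed_le
  choose ν hν using fun x : (⨆ n, L n : Subfield ℂ) => (hmem x).1 x.2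
  have key : ∀ (x : (⨆ n, L n : Subfield ℂ)) (n : ℕ), (x : ℂ) ∈ L n → τ (ν x) x = τ n x := by
    intro x n hx
    rcases le_total n (ν x) with h1 | h1
    · exact hτ _ _ h1 _ hx
    · exact (hτ _ _ h1 _ (hν x)).symm
  let g : (⨆ n, L n : Subfield ℂ) →+* ℂ :=
    { toFun := fun x => τ (ν x) x
      map_one' := by simp
      map_zero' := by simp
      map_mul' := by
        intro x y
        have hx : (x : ℂ) ∈ L (max (ν x) (ν y)) := hm (le_max_left _ _) (hν x)
        have hy : (y : ℂ) ∈ L (max (ν x) (ν y)) := hm (le_max_right _ _) (hν y)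
        rw [key x _ hx, key y _ hy, key (x * y) _ (mul_mem hx hy)]
        simp
      map_add' := by
        intro x y
        have hx : (x : ℂ) ∈ L (max (ν x) (ν y)) := hm (le_max_left _ _) (hν x)
        have hy : (y : ℂ) ∈ L (max (ν x) (ν y)) := hm (le_max_right _ _) (hν y)
        rw [key x _ hx, key y _ hy, key (x + y) _ (add_mem hx hy)]
        simp }
  obtain ⟨σ, hσ⟩ := ext_hom (⨆ n, L n) (fun x hx => by
    obtain ⟨n, hn⟩ := (hmem x).1 hx
    exact halg n x hn) g
  refine ⟨σ, fun n x hx => ?_⟩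
  have h1 := hσ ⟨x, (hmem x).2 ⟨n, hx⟩⟩
  rw [h1]
  exact key ⟨x, (hmem x).2 ⟨n, hx⟩⟩ n hx

theorem exists_R (x y ε ε' : ℝ) (hx : x < ε) (hy : y < ε') : ∃ R : ℝ, 1 < R ∧ R * x < ε ∧ R * y < ε' := by
  have h1 : ∀ᶠ R in 𝓝[>] (1 : ℝ), R * x < ε :=
    nhdsWithin_le_nhds (((continuous_mul_const x).tendsto 1).eventually_lt_const (by simpa using hx))
  have h2 : ∀ᶠ R in 𝓝[>] (1 : ℝ), R * y < ε' :=
    nhdsWithin_le_nhds (((continuous_mul_const y).tendsto 1).eventually_lt_const (by simpa using hy))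
  obtain ⟨R, ⟨h3, h4⟩, h5⟩ := ((h1.and h2).and self_mem_nhdsWithin).exists
  exact ⟨R, h5, h3, h4⟩

theorem step_lemma {N : ℕ} (L0 : Subfield ℂ) (τ0 : ℂ →+* ℂ)
    (Φ : Fin N → MvPolynomial (Fin N) L0) (a : Fin N → L0) {P Q : Fin N → ℂ}
    (hP : ∀ i, P i = a i) (hQ : ∀ i, Q i = τ0 (a i))
    {U U' : Set (Fin N → ℂ)} {ε ε' : ℝ} {Ψ Ψ' : (Fin N → ℂ) → Fin N → ℂ}
    (h : LocInv L0.subtype Φ P U ε Ψ) (h' : LocInv (τ0.comp L0.subtype) Φ Q U' ε' Ψ')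
    (C : Set (Fin N))
    (L : Subfield ℂ) (hL : FiniteDimensional ℚ L) (hLL : L0 ≤ L) (τ : ℂ →+* ℂ)
    (hτ : ∀ x ∈ L0, τ x = τ0 x) (u u' : Fin N → ℂ) (hu : ‖u‖ < ε) (hu' : ‖u'‖ < ε')
    (huC : ∀ i ∈ C, u i = 0) (huC' : ∀ i ∈ C, u' i = 0) (δ : ℝ) (hδ : 0 < δ) :
    ∃ (L' : Subfield ℂ) (τ' : ℂ →+* ℂ) (b b' : Fin N → ℂ), FiniteDimensional ℚ L' ∧ L ≤ L' ∧
      (∀ x ∈ L, τ' x = τ x) ∧ ‖b‖ < ε ∧ ‖b'‖ < ε' ∧ (∀ i ∈ C, b i = 0) ∧ (∀ i ∈ C, b' i = 0) ∧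
      ‖b - u‖ < δ ∧ ‖b' - u'‖ < δ ∧
      (∀ j, Ψ (pmap L0.subtype Φ P + b) j ∈ L') ∧
      (∀ j, τ' (Ψ (pmap L0.subtype Φ P + b) j) =
        Ψ' (pmap (τ0.comp L0.subtype) Φ Q + b') j) := by
  classical
  obtain ⟨L2, τ1, hL2, hLL2, hτ1, happ⟩ := two_emb L hL τ
  set δ1 := min δ (min (ε - ‖u‖) (ε' - ‖u'‖)) / 2 with hδ1
  have hm1 : 2 * δ1 ≤ δ := by
    have := min_le_left δ (min (ε - ‖u‖) (ε' - ‖u'‖)); linarith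
  have hm2 : 2 * δ1 ≤ ε - ‖u‖ := by
    have := (min_le_right δ (min (ε - ‖u‖) (ε' - ‖u'‖))).trans (min_le_left _ _); linarith
  have hm3 : 2 * δ1 ≤ ε' - ‖u'‖ := by
    have := (min_le_right δ (min (ε - ‖u‖) (ε' - ‖u'‖))).trans (min_le_right _ _); linarith
  have hδ1p : 0 < δ1 := by
    have : 0 < min δ (min (ε - ‖u‖) (ε' - ‖u'‖)) :=
      lt_min hδ (lt_min (by linarith) (by linarith))
    linarith
  choose β hβL hβ hβ' using fun i => happ (u i) (u' i) δ1 hδ1p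
  let b : Fin N → L2 := fun i => if i ∈ C then 0 else ⟨β i, hβL i⟩
  let c : Fin N → ℂ := fun i => (b i : ℂ)
  let c' : Fin N → ℂ := fun i => τ1 (b i)
  have hcC : ∀ i ∈ C, c i = 0 := fun i hi => by simp [c, b, hi]
  have hcC' : ∀ i ∈ C, c' i = 0 := fun i hi => by simp [c', b, hi]
  have hcu : ‖c - u‖ < δ1 := by
    rw [pi_norm_lt_iff hδ1p]
    intro i
    by_cases hi : i ∈ C
    · simp [hcC i hi, huC i hi, hδ1p]
    · simpa [c, b, hi] using hβ i
  have hcu' : ‖c' - u'‖ < δ1 := by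
    rw [pi_norm_lt_iff hδ1p]
    intro i
    by_cases hi : i ∈ C
    · simp [hcC' i hi, huC' i hi, hδ1p]
    · simpa [c', b, hi] using hβ' i
  have tri : ∀ x y : Fin N → ℂ, ∀ d, ‖x - y‖ < d → ‖x‖ < ‖y‖ + d := by
    intro x y d hd
    have := norm_le_norm_add_norm_sub' x y
    linarith
  have hcε : ‖c‖ < ε := by have := tri _ _ _ hcu; linarith
  have hcε' : ‖c'‖ < ε' := by have := tri _ _ _ hcu'; linarith
  have hτ10 : ∀ x ∈ L0, τ1 x = τ0 x := fun x hx => by rw [hτ1 x (hLL hx), hτ x hx]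
  have h02 : L0 ≤ L2 := hLL.trans hLL2
  by_cases hb0 : ∀ i, b i = 0
  · have e1 : c = 0 := by ext i; simp [c, hb0]
    have e2 : c' = 0 := by ext i; simp [c', hb0]
    refine ⟨L2, τ1, c, c', hL2, hLL2, hτ1, hcε, hcε', hcC, hcC', by linarith, by linarith, ?_, ?_⟩
    · intro j
      rw [e1, add_zero, h.left P h.mem, hP]; exact h02 (a j).2
    · intro j
      rw [e1, e2, add_zero, add_zero, h.left P h.mem, h'.left Q h'.mem, hP, hQ]
      exact hτ10 _ (a j).2
  push Not at hb0
  obtain ⟨i0, hi0⟩ := hb0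
  obtain ⟨R, hR1, hR2, hR3⟩ := exists_R ‖c‖ ‖c'‖ ε ε' hcε hcε'
  let ι : L0 →+* L2 := Subfield.inclusion h02
  have hι : L2.subtype.comp ι = L0.subtype := rfl
  have hι' : (τ1.comp L2.subtype).comp ι = τ0.comp L0.subtype := by
    ext x; exact hτ10 x x.2
  have g := h.base L2.subtype ι hι
  have g' := h'.base (τ1.comp L2.subtype) ι hι'
  let a2 : Fin N → L2 := fun i => ι (a i)
  have ha2 : (fun i => L2.subtype (a2 i)) = P := by ext i; rw [hP]; rfl
  have ha2' : (fun i => (τ1.comp L2.subtype) (a2 i)) = Q := by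
    ext i; rw [hQ]; exact hτ10 _ (a i).2
  let p : Fin N → L2 := fun i => eval a2 (map ι (Φ i))
  have hp : ∀ i, L2.subtype (p i) = pmap L2.subtype (fun i => map ι (Φ i)) P i := by
    intro i
    rw [← ha2]
    exact eval₂_comp L2.subtype a2 _
  have hp' : ∀ i, (τ1.comp L2.subtype) (p i) =
      pmap (τ1.comp L2.subtype) (fun i => map ι (Φ i)) Q i := by
    intro i
    rw [← ha2']
    exact eval₂_comp (τ1.comp L2.subtype) a2 _
  have k := g.curve p b hp hcε R hR2
  have k' := g'.curve p b hp' hcε' R hR3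
  set δ2 := min (δ1 / ε) (δ1 / ε') with hδ2
  have hδ2p : 0 < δ2 := lt_min (div_pos hδ1p h.pos) (div_pos hδ1p h'.pos)
  obtain ⟨s, hs, halg, τ', hτ', hτy⟩ := curve_lemma L2 hL2 τ1 k k' a2
    (by
      intro i
      simp only [zero_mul, add_zero]
      have := g.left P g.mem
      rw [show (fun i => pmap L2.subtype (fun i => map ι (Φ i)) P i) =
        pmap L2.subtype (fun i => map ι (Φ i)) P from rfl, this, ← ha2]; rfl)
    (by
      intro i
      simp only [zero_mul, add_zero]
      have := g'.left Q g'.mem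
      rw [show (fun i => pmap (τ1.comp L2.subtype) (fun i => map ι (Φ i)) Q i) =
        pmap (τ1.comp L2.subtype) (fun i => map ι (Φ i)) Q from rfl, this, ← ha2']; rfl)
    hR1 i0 hi0 δ2 hδ2p
  have hy : (fun i => pmap L2.subtype (fun i => map ι (Φ i)) P i + (s : ℂ) * L2.subtype (b i)) =
      pmap L0.subtype Φ P + (s : ℂ) • c := by
    rw [pmap_map _ _ ι hι]; rfl
  have hy' : (fun i => pmap (τ1.comp L2.subtype) (fun i => map ι (Φ i)) Q i +
      (s : ℂ) * (τ1.comp L2.subtype) (b i)) =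
      pmap (τ0.comp L0.subtype) Φ Q + (s : ℂ) • c' := by
    rw [pmap_map _ _ ι hι']; rfl
  simp only [hy] at halg hτy
  simp only [hy'] at hτy
  have hs2 : ∀ (x w : Fin N → ℂ) (e : ℝ), 0 < e → ‖x‖ < e → δ2 ≤ δ1 / e → ‖x - w‖ < δ1 →
      ‖(s : ℂ) • x - w‖ < 2 * δ1 := by
    intro x w e he hx hd hxw
    have e1 : (s : ℂ) • x - w = ((s : ℂ) - 1) • x + (x - w) := by
      rw [sub_smul, one_smul]; abel
    have e2 : ‖((s : ℂ) - 1)‖ = |(s : ℝ) - 1| := by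
      rw [← Real.norm_eq_abs, ← Complex.norm_real]; simp
    rw [e1]
    refine (norm_add_le _ _).trans_lt ?_
    rw [norm_smul, e2]
    have e3 : |(s : ℝ) - 1| * ‖x‖ ≤ δ1 / e * e :=
      mul_le_mul (hs.le.trans hd) hx.le (norm_nonneg _) (by positivity)
    rw [div_mul_cancel₀ _ he.ne'] at e3
    linarith
  have r1 := hs2 c u ε h.pos hcε (min_le_left _ _) hcu
  have r2 := hs2 c' u' ε' h'.pos hcε' (min_le_right _ _) hcu'
  obtain ⟨L3, hL3, hLL3, hmem3⟩ := exists_big L2 hL2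
    (Set.range (Ψ (pmap L0.subtype Φ P + (s : ℂ) • c))) (Set.finite_range _)
    (by rintro _ ⟨j, rfl⟩; exact halg j)
  refine ⟨L3, τ', (s : ℂ) • c, (s : ℂ) • c', hL3, hLL2.trans hLL3, ?_, ?_, ?_, ?_, ?_, ?_, ?_, ?_, hτy⟩
  · intro x hx; rw [hτ' x (hLL2 hx), hτ1 x hx]
  · have := tri _ _ _ r1; linarith
  · have := tri _ _ _ r2; linarith
  · intro i hi; simp [hcC i hi]
  · intro i hi; simp [hcC' i hi]
  · linarith
  · linarith
  · intro j; exact hmem3 ⟨j, rfl⟩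

end assembly
end ConjugateDensity

namespace ConjugateDensity

open Filter Topology

section recursion
open MvPolynomial

theorem core {N : ℕ} (L0 : Subfield ℂ) (hL0 : FiniteDimensional ℚ L0) (τ0 : ℂ →+* ℂ)
    (Φ : Fin N → MvPolynomial (Fin N) L0) (a : Fin N → L0) {P Q : Fin N → ℂ}
    (hP : ∀ i, P i = a i) (hQ : ∀ i, Q i = τ0 (a i))
    {U U' : Set (Fin N → ℂ)} {ε ε' : ℝ} {Ψ Ψ' : (Fin N → ℂ) → Fin N → ℂ}
    (h : LocInv L0.subtype Φ P U ε Ψ) (h' : LocInv (τ0.comp L0.subtype) Φ Q U' ε' Ψ')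
    (C : Set (Fin N)) :
    ∃ τ : ℂ →+* ℂ, (∀ x ∈ L0, τ x = τ0 x) ∧ ∃ b b' : ℕ → Fin N → ℂ,
      (∀ n, ‖b n‖ < ε) ∧ (∀ n, ‖b' n‖ < ε') ∧ (∀ n, ∀ i ∈ C, b n i = 0) ∧
      (∀ n, ∀ i ∈ C, b' n i = 0) ∧
      (∀ n j, IsAlgebraic ℚ (Ψ (pmap L0.subtype Φ P + b n) j)) ∧
      (∀ n j, τ (Ψ (pmap L0.subtype Φ P + b n) j) =
        Ψ' (pmap (τ0.comp L0.subtype) Φ Q + b' n) j) ∧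
      (∀ u, ‖u‖ < ε → (∀ i ∈ C, u i = 0) → ∀ η > 0, ∃ n, ‖b n - u‖ < η) ∧
      (∀ u, ‖u‖ < ε' → (∀ i ∈ C, u i = 0) → ∀ η > 0, ∃ n, ‖b' n - u‖ < η) := by
  let B := {u : Fin N → ℂ // ‖u‖ < ε ∧ ∀ i ∈ C, u i = 0}
  let B' := {u : Fin N → ℂ // ‖u‖ < ε' ∧ ∀ i ∈ C, u i = 0}
  have : Nonempty B := ⟨⟨0, by simpa using h.pos, fun _ _ => rfl⟩⟩
  have : Nonempty B' := ⟨⟨0, by simpa using h'.pos, fun _ _ => rfl⟩⟩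
  let d : ℕ → B × B' := TopologicalSpace.denseSeq (B × B')
  have hd : DenseRange d := TopologicalSpace.denseRange_denseSeq _
  let St := {s : Subfield ℂ × (ℂ →+* ℂ) // FiniteDimensional ℚ s.1 ∧ L0 ≤ s.1 ∧
    ∀ x ∈ L0, s.2 x = τ0 x}
  have hpos : ∀ n : ℕ, (0 : ℝ) < 1 / ((n.unpair.2 : ℝ) + 1) := fun n => by positivity
  have hstep : ∀ (s : St) (n : ℕ), ∃ (s' : St) (bb : (Fin N → ℂ) × (Fin N → ℂ)), s.1.1 ≤ s'.1.1 ∧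
      (∀ x ∈ s.1.1, s'.1.2 x = s.1.2 x) ∧ ‖bb.1‖ < ε ∧ ‖bb.2‖ < ε' ∧ (∀ i ∈ C, bb.1 i = 0) ∧
      (∀ i ∈ C, bb.2 i = 0) ∧
      ‖bb.1 - (d n.unpair.1).1.1‖ < 1 / ((n.unpair.2 : ℝ) + 1) ∧
      ‖bb.2 - (d n.unpair.1).2.1‖ < 1 / ((n.unpair.2 : ℝ) + 1) ∧
      (∀ j, Ψ (pmap L0.subtype Φ P + bb.1) j ∈ s'.1.1) ∧
      (∀ j, s'.1.2 (Ψ (pmap L0.subtype Φ P + bb.1) j) =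
        Ψ' (pmap (τ0.comp L0.subtype) Φ Q + bb.2) j) := by
    rintro ⟨⟨L, τ⟩, hL, hLL, hτ⟩ n
    obtain ⟨L', τ', b, b', q1, q2, q3, q4⟩ := step_lemma L0 τ0 Φ a hP hQ h h' C L hL hLL τ hτ
      (d n.unpair.1).1.1 (d n.unpair.1).2.1 (d n.unpair.1).1.2.1 (d n.unpair.1).2.2.1
      (d n.unpair.1).1.2.2 (d n.unpair.1).2.2.2 _ (hpos n)
    exact ⟨⟨⟨L', τ'⟩, q1, hLL.trans q2, fun x hx => by
      rw [← hτ x hx]; exact q3 x (hLL hx)⟩, (b, b'), q2, q3, q4⟩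
  choose nx bb hnx using hstep
  let s : ℕ → St := fun n => Nat.rec ⟨⟨L0, τ0⟩, hL0, le_rfl, fun _ _ => rfl⟩ (fun n s => nx s n) n
  have hs : ∀ n, s (n + 1) = nx (s n) n := fun n => rfl
  have hs0 : (s 0).1 = (L0, τ0) := rfl
  obtain ⟨τ, hτ⟩ := glue (fun n => (s n).1.1) (fun n => (hnx (s n) n).1)
    (fun n => alg_of_fin _ (s n).2.1) (fun n => (s n).1.2) (fun n => (hnx (s n) n).2.1)
  refine ⟨τ, fun x hx => hτ 0 x hx, fun n => (bb (s n) n).1, fun n => (bb (s n) n).2, ?_⟩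
  choose _ _ r1 r2 r3 r4 r5 r6 r7 r8 using fun n => hnx (s n) n
  refine ⟨r1, r2, r3, r4, ?_, ?_, ?_, ?_⟩
  · intro n j
    exact alg_of_fin _ (s (n + 1)).2.1 _ (r7 n j)
  · intro n j
    rw [← r8 n j]
    exact hτ (n + 1) _ (r7 n j)
  · intro u hu huC η hη
    let w : B × B' := (⟨u, hu, huC⟩, ⟨0, by simpa using h'.pos, fun _ _ => rfl⟩)
    obtain ⟨i, hi⟩ := hd.exists_dist_lt w (half_pos hη)
    obtain ⟨l, hl⟩ := exists_nat_one_div_lt (half_pos hη)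
    have h5 := r5 (Nat.pair i l)
    rw [Nat.unpair_pair] at h5
    rw [Prod.dist_eq, max_lt_iff] at hi
    have h6 : ‖(d i).1.1 - u‖ < η / 2 := by
      rw [← dist_eq_norm, dist_comm]; exact hi.1
    refine ⟨Nat.pair i l, ?_⟩
    have := norm_sub_le_norm_sub_add_norm_sub (bb (s (Nat.pair i l)) (Nat.pair i l)).1 (d i).1.1 u
    simp only at h5
    linarith
  · intro u hu huC η hη
    let w : B × B' := (⟨0, by simpa using h.pos, fun _ _ => rfl⟩, ⟨u, hu, huC⟩)
    obtain ⟨i, hi⟩ := hd.exists_dist_lt w (half_pos hη)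
    obtain ⟨l, hl⟩ := exists_nat_one_div_lt (half_pos hη)
    have h5 := r6 (Nat.pair i l)
    rw [Nat.unpair_pair] at h5
    rw [Prod.dist_eq, max_lt_iff] at hi
    have h6 : ‖(d i).2.1 - u‖ < η / 2 := by
      rw [← dist_eq_norm, dist_comm]; exact hi.2
    refine ⟨Nat.pair i l, ?_⟩
    have := norm_sub_le_norm_sub_add_norm_sub (bb (s (Nat.pair i l)) (Nat.pair i l)).2 (d i).2.1 u
    simp only at h5
    linarith

end recursion
end ConjugateDensity

namespace ConjugateDensity

open Filter Topology

section finish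
open MvPolynomial

theorem LocInv.dense {K : Type} [Field K] {N : ℕ} {f : K →+* ℂ}
    {Φ : Fin N → MvPolynomial (Fin N) K} {P : Fin N → ℂ} {U : Set (Fin N → ℂ)} {ε : ℝ}
    {Ψ : (Fin N → ℂ) → Fin N → ℂ} (h : LocInv f Φ P U ε Ψ) (C : Set (Fin N)) (b : ℕ → Fin N → ℂ)
    (hb : ∀ u, ‖u‖ < ε → (∀ i ∈ C, u i = 0) → ∀ η > 0, ∃ n, ‖b n - u‖ < η)
    (x : Fin N → ℂ) (hx : x ∈ U) (hxC : ∀ i ∈ C, eval₂ f x (Φ i) = eval₂ f P (Φ i))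
    (η : ℝ) (hη : 0 < η) : ∃ n, dist x (Ψ (pmap f Φ P + b n)) < η := by
  have h1 := h.maps x hx
  have hc : ContinuousAt Ψ (pmap f Φ x) :=
    ((h.diff _ h1).differentiableAt (Metric.isOpen_ball.mem_nhds h1)).continuousAt
  obtain ⟨δ, hδ, hδ'⟩ := Metric.continuousAt_iff.1 hc η hη
  obtain ⟨n, hn⟩ := hb (pmap f Φ x - pmap f Φ P) (by rwa [mem_ball_iff_norm] at h1)
    (fun i hi => by simp [pmap, hxC i hi]) δ hδ
  refine ⟨n, ?_⟩
  have := hδ' (x := pmap f Φ P + b n) (by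
    rw [dist_eq_norm]
    have e : pmap f Φ P + b n - pmap f Φ x = b n - (pmap f Φ x - pmap f Φ P) := by abel
    rw [e]; exact hn)
  rwa [h.left x hx, dist_comm] at this

theorem LocInv.in_ball {K : Type} [Field K] {N : ℕ} {f : K →+* ℂ}
    {Φ : Fin N → MvPolynomial (Fin N) K} {P : Fin N → ℂ} {ε : ℝ} (b : Fin N → ℂ) (hb : ‖b‖ < ε) :
    pmap f Φ P + b ∈ Metric.ball (pmap f Φ P) ε := by
  rw [mem_ball_iff_norm, add_sub_cancel_left]; exact hb

theorem lift_field {N : ℕ} (L : Subfield ℂ) (H : MvPolynomial (Fin N) ℂ)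
    (h : ∀ m, coeff m H ∈ L) : ∃ G : MvPolynomial (Fin N) L, map L.subtype G = H := by
  classical
  refine ⟨∑ m ∈ H.support, monomial m ⟨coeff m H, h m⟩, ?_⟩
  rw [map_sum]
  conv_rhs => rw [← support_sum_monomial_coeff H]
  exact Finset.sum_congr rfl fun m _ => by simp

theorem isAlgClosed_alg : IsAlgClosed (algebraicClosure ℚ ℂ) :=
  (algebraicClosure.isAlgClosure ℚ ℂ).isAlgClosed

theorem descent_field {N : ℕ} (k : Subfield ℂ) (hk : FiniteDimensional ℚ k)
    (polys : Finset (MvPolynomial (Fin N) k)) (P : Fin N → ℂ) (hPalg : ∀ i, IsAlgebraic ℚ (P i))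
    (S : Set (Fin N → ℂ)) (hS : ∀ v, v ∈ S ↔ ∀ F ∈ polys, eval₂ k.subtype v F = 0) (hPS : P ∈ S)
    {c : ℕ} (g : Fin c → MvPolynomial (Fin N) ℂ) (hg : ∀ i, ∀ v ∈ S, aeval v (g i) = 0)
    (h : MvPolynomial (Fin N) ℂ) (hhP : aeval P h ≠ 0)
    (hh : ∀ v : Fin N → ℂ, aeval v h ≠ 0 → (v ∈ S ↔ ∀ i, aeval v (g i) = 0))
    (hrank : (Matrix.of fun (i : Fin c) (j : Fin N) => aeval P (pderiv j (g i))).rank = c) :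
    ∃ (L : Subfield ℂ) (C : Set (Fin N)) (Φ : Fin N → MvPolynomial (Fin N) L),
      FiniteDimensional ℚ L ∧ k ≤ L ∧ (∀ i, P i ∈ L) ∧ 
      (pjac L.subtype Φ P).det ≠ 0 ∧
      (∀ i ∈ C, ∀ (τ : ℂ →+* ℂ) (v : Fin N → ℂ), (∀ F ∈ polys, eval₂ (τ.comp k.subtype) v F = 0) →
        eval₂ (τ.comp L.subtype) v (Φ i) = 0) ∧
      ∀ᶠ v in 𝓝 P, (∀ i ∈ C, eval₂ L.subtype v (Φ i) = 0) → v ∈ S := by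
  have := isAlgClosed_alg
  have hka : ∀ x ∈ k, x ∈ algebraicClosure ℚ ℂ := fun x hx =>
    mem_algebraicClosure_iff.2 (alg_of_fin k hk x hx)
  let ι : k →+* algebraicClosure ℚ ℂ := k.subtype.codRestrict (algebraicClosure ℚ ℂ)
    (fun x => hka x x.2)
  let f : algebraicClosure ℚ ℂ →+* ℂ := algebraMap (algebraicClosure ℚ ℂ) ℂ
  have hι : f.comp ι = k.subtype := rfl
  obtain ⟨C, Φ, h1, h2, h3⟩ := descent k ι hι polys
    (fun i => ⟨P i, mem_algebraicClosure_iff.2 (hPalg i)⟩) P rfl S hS hPS g hg h hhP hh hrank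
  obtain ⟨L, hL, hkL, hmem⟩ := exists_big k hk
    (Set.range P ∪ ⋃ i, (fun m => f (coeff m (Φ i))) '' (Φ i).support)
    ((Set.finite_range P).union (Set.finite_iUnion fun i => (Finset.finite_toSet _).image _))
    (by
      rintro x (⟨i, rfl⟩ | hx)
      · exact hPalg i
      · obtain ⟨i, m, _, rfl⟩ := Set.mem_iUnion.1 hx
        exact mem_algebraicClosure_iff.1 (coeff m (Φ i)).2)
  have hcoef : ∀ i m, coeff m (map f (Φ i)) ∈ L := by
    intro i m
    rw [coeff_map]
    by_cases hm : m ∈ (Φ i).support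
    · exact hmem (Or.inr (Set.mem_iUnion.2 ⟨i, m, hm, rfl⟩))
    · rw [notMem_support_iff.1 hm, map_zero]; exact zero_mem _
  choose Φ' hΦ' using fun i => lift_field L (map f (Φ i)) (hcoef i)
  have hev : ∀ (τ : ℂ →+* ℂ) (v : Fin N → ℂ) i,
      eval₂ (τ.comp L.subtype) v (Φ' i) = eval₂ (τ.comp f) v (Φ i) := by
    intro τ v i
    rw [← eval₂_map, hΦ', eval₂_map]
  refine ⟨L, C, Φ', hL, hkL, fun i => hmem (Or.inl ⟨i, rfl⟩), ?_, ?_, ?_⟩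
  · have e1 := pjac_map L.subtype (RingHom.id ℂ) L.subtype rfl Φ' P
    have e2 := pjac_map f (RingHom.id ℂ) f rfl Φ P
    rw [← e1]
    simp only [hΦ']
    rw [e2]; exact h1
  · intro i hi τ v hv
    rw [hev]
    exact h2 i hi (τ.comp f) v hv
  · filter_upwards [h3] with v hv hvC
    refine hv fun i hi => ?_
    have := hvC i hi
    have e := hev (RingHom.id ℂ) v i
    rw [RingHom.id_comp, RingHom.id_comp] at e
    rw [← this, e]

end finish
end ConjugateDensity

namespace ConjugateDensity

open MvPolynomial Filter Topology

variable {N : ℕ}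

/-- Proposition: let `X` be an algebraic variety over a number field
`k ⊆ ℂ`, let `P` be a smooth algebraic point of `X`, let `σ ∈ Gal(k(P)/ℚ)` (an
embedding of `k(P)` into `ℂ`), and let `Q = P^σ` be the conjugate point on the conjugate
variety `X^σ`.  Then for all Euclidean-open sets `V_P ∋ P` in `X(ℂ)` and `V_Q ∋ Q` in
`X^σ(ℂ)` there exist an extension `τ` of `σ` to `ℚ̄` (indeed to all of `ℂ`), an open
neighbourhood `U_P ⊆ V_P` of `P` containing a sequence `(P_i)` of algebraic points of
`X` dense in `U_P`, and an open neighbourhood `U_Q ⊆ V_Q` of `Q`, such that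
`P_i^σ ∈ U_Q` for all `i` and `{P_i^σ}` is dense in `U_Q`. -/
theorem conjugate_points_dense
    (k : Subfield ℂ) (hknum : FiniteDimensional ℚ k)
    (polys : Finset (MvPolynomial (Fin N) k))
    (P : Fin N → ℂ)
    (hP : P ∈ pointsOf k polys k.subtype)
    (hPalg : ∀ i, IsAlgebraic ℚ (P i))
    (hsmooth : SmoothAt (pointsOf k polys k.subtype) P)
    (σ : kRes k P →+* ℂ)
    (hQ : conjPoint k P σ ∈
      pointsOf k polys (σ.comp (Subfield.inclusion (le_kRes k P))))
    (VP : Set (pointsOf k polys k.subtype)) (hVPopen : IsOpen VP)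
    (hPVP : ⟨P, hP⟩ ∈ VP)
    (VQ : Set (pointsOf k polys (σ.comp (Subfield.inclusion (le_kRes k P)))))
    (hVQopen : IsOpen VQ) (hQVQ : ⟨conjPoint k P σ, hQ⟩ ∈ VQ) :
    ∃ τ : ℂ →+* ℂ, (∀ x : kRes k P, τ x = σ x) ∧
    ∃ UP : Set (pointsOf k polys k.subtype),
      IsOpen UP ∧ UP ⊆ VP ∧ ⟨P, hP⟩ ∈ UP ∧
    ∃ UQ : Set (pointsOf k polys (σ.comp (Subfield.inclusion (le_kRes k P)))),
      IsOpen UQ ∧ UQ ⊆ VQ ∧ ⟨conjPoint k P σ, hQ⟩ ∈ UQ ∧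
    ∃ Pt : ℕ → pointsOf k polys k.subtype,
      (∀ i, Pt i ∈ UP) ∧
      (∀ i j, IsAlgebraic ℚ ((Pt i : Fin N → ℂ) j)) ∧
      UP ⊆ closure {x | ∃ i, x = Pt i} ∧
      ∃ hPtσ : ∀ i, (fun j => τ ((Pt i : Fin N → ℂ) j)) ∈
          pointsOf k polys (σ.comp (Subfield.inclusion (le_kRes k P))),
        (∀ i, (⟨fun j => τ ((Pt i : Fin N → ℂ) j), hPtσ i⟩ :
            pointsOf k polys (σ.comp (Subfield.inclusion (le_kRes k P)))) ∈ UQ) ∧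
        UQ ⊆ closure {y : pointsOf k polys (σ.comp (Subfield.inclusion (le_kRes k P))) |
          ∃ i, (y : Fin N → ℂ) = fun j => τ ((Pt i : Fin N → ℂ) j)} := by
  have ev : ∀ (f : k →+* ℂ) (v : Fin N → ℂ),
      v ∈ pointsOf k polys f ↔ ∀ F ∈ polys, eval₂ f v F = 0 := by
    intro f v
    simp only [pointsOf, aeval_def, eval₂_map]
    rfl
  set σk := σ.comp (Subfield.inclusion (le_kRes k P)) with hσk
  obtain ⟨c, g, hg, ⟨h, hhP, hh⟩, hrank⟩ := hsmooth
  obtain ⟨L0, C, Φ, hL0, hkL, hPL, hdet, hvan, hnear⟩ := descent_field k hknum polys P hPalg _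
    (ev k.subtype) hP g hg h hhP hh hrank
  have hresL : kRes k P ≤ L0 := by
    refine Subfield.closure_le.2 ?_
    rintro x (hx | ⟨i, rfl⟩)
    · exact hkL hx
    · exact hPL i
  obtain ⟨τ0, hτ0⟩ := ext_hom (kRes k P) (fun x hx => alg_of_fin L0 hL0 x (hresL hx)) σ
  have hσk0 : τ0.comp k.subtype = σk := by
    ext x
    exact hτ0 (Subfield.inclusion (le_kRes k P) x)
  set Q := conjPoint k P σ with hQdef
  have hQP : ∀ i, Q i = τ0 (P i) := fun i =>
    (hτ0 ⟨P i, Subfield.subset_closure (Or.inr ⟨i, rfl⟩)⟩).symm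
  have hdetQ : (pjac (τ0.comp L0.subtype) Φ Q).det ≠ 0 := by
    have e : pjac (τ0.comp L0.subtype) Φ Q = τ0.mapMatrix (pjac L0.subtype Φ P) := by
      ext i j
      have hQ' : Q = fun i => τ0 (P i) := funext hQP
      simp only [pjac, Matrix.of_apply, RingHom.mapMatrix_apply, Matrix.map_apply, hQ']
      exact (hom_eval₂ _ _ _ _).symm
    rw [e, ← RingHom.map_det]
    exact (map_ne_zero τ0).2 hdet
  obtain ⟨V, hV, rfl⟩ := isOpen_induced_iff.1 hVPopen
  obtain ⟨V', hV', rfl⟩ := isOpen_induced_iff.1 hVQopen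
  obtain ⟨U, ε, Ψ, hUV, hI⟩ := exists_locInv L0.subtype Φ P hdet _
    (inter_mem (hV.mem_nhds hPVP) hnear)
  obtain ⟨U', ε', Ψ', hUV', hI'⟩ := exists_locInv (τ0.comp L0.subtype) Φ Q hdetQ _
    (hV'.mem_nhds hQVQ)
  obtain ⟨τ, hτ, b, b', hb, hb', hbC, -, halg, hconj, hdense, hdense'⟩ :=
    core L0 hL0 τ0 Φ (fun i => ⟨P i, hPL i⟩) (fun _ => rfl) hQP hI hI' C
  have hτσ : ∀ x : kRes k P, τ x = σ x := fun x => by rw [hτ x (hresL x.2), hτ0 x]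
  have hvX : ∀ v ∈ pointsOf k polys k.subtype, ∀ i ∈ C, eval₂ L0.subtype v (Φ i) = 0 := by
    intro v hv i hi
    exact hvan i hi (RingHom.id ℂ) v ((ev _ v).1 hv)
  have hvXσ : ∀ v ∈ pointsOf k polys σk, ∀ i ∈ C, eval₂ (τ0.comp L0.subtype) v (Φ i) = 0 := by
    intro v hv i hi
    refine hvan i hi τ0 v ?_
    rw [hσk0]; exact (ev _ v).1 hv
  have hPtU : ∀ n, Ψ (pmap L0.subtype Φ P + b n) ∈ U := fun n =>
    hI.maps' _ (LocInv.in_ball _ (hb n))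
  have hPtX : ∀ n, Ψ (pmap L0.subtype Φ P + b n) ∈ pointsOf k polys k.subtype := by
    intro n
    refine (hUV (hPtU n)).2 fun i hi => ?_
    have := congrFun (hI.right _ (LocInv.in_ball _ (hb n))) i
    rw [Pi.add_apply, hbC n i hi, add_zero] at this
    exact this.trans (hvX P hP i hi)
  have hτk : τ.comp k.subtype = σk := by
    ext x
    exact hτσ (Subfield.inclusion (le_kRes k P) x)
  have hPtQ : ∀ n, (fun j => τ (Ψ (pmap L0.subtype Φ P + b n) j)) ∈ pointsOf k polys σk := by
    intro n
    rw [ev, ← hτk]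
    intro F hF
    have h1 := congrArg τ ((ev _ _).1 (hPtX n) F hF)
    rw [hom_eval₂, map_zero] at h1
    exact h1
  have hfun : ∀ n, (fun j => τ (Ψ (pmap L0.subtype Φ P + b n) j)) =
      Ψ' (pmap (τ0.comp L0.subtype) Φ Q + b' n) := fun n => funext (hconj n)
  refine ⟨τ, hτσ, Subtype.val ⁻¹' U, hI.isOpen.preimage continuous_subtype_val,
    fun x hx => (hUV hx).1, hI.mem, Subtype.val ⁻¹' U', hI'.isOpen.preimage continuous_subtype_val,
    fun x hx => hUV' hx, hI'.mem, fun n => ⟨_, hPtX n⟩, hPtU, halg, ?_, hPtQ, ?_, ?_⟩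
  · rintro ⟨x, hxX⟩ hxU
    rw [Metric.mem_closure_iff]
    intro η hη
    obtain ⟨n, hn⟩ := hI.dense C b hdense x hxU
      (fun i hi => by rw [hvX x hxX i hi, hvX P hP i hi]) η hη
    exact ⟨_, ⟨n, rfl⟩, hn⟩
  · intro n
    change (fun j => τ (Ψ (pmap L0.subtype Φ P + b n) j)) ∈ U'
    rw [hfun]
    exact hI'.maps' _ (LocInv.in_ball _ (hb' n))
  · rintro ⟨x, hxX⟩ hxU
    rw [Metric.mem_closure_iff]
    intro η hη
    obtain ⟨n, hn⟩ := hI'.dense C b' hdense' x hxU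
      (fun i hi => by rw [hvXσ x hxX i hi, hvXσ Q hQ i hi]) η hη
    refine ⟨⟨_, hPtQ n⟩, ⟨n, rfl⟩, ?_⟩
    change dist x (fun j => τ (Ψ (pmap L0.subtype Φ P + b n) j)) < η
    rw [hfun]; exact hn

end ConjugateDensity
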